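/- Assume the local multiplier setup with g of the standard form, and let ε, d be the ball exponents of g with ε < 1/2. Let l be a line through the origin with unit direction v, and let δ_v, e_v be the strip exponents of g in direction v. Suppose v is perpendicular to one of the lines l₁,…,l_p. Then, provided the support of the bump function φ is sufficiently small (depending on v), there is a constant C (depending on g, φ, H, l, and A) such that for all (t,u) ∈ l_H one has |K_φ(t,u)| ≤ C (2+|(t,u)|)^{−δ_v} (ln(2+|(t,u)|))^{e_v}. -/

import Mathlib

open MeasureTheory Real Set Filter Metric
open scoped Topology ENNReal

noncomputable section

/-- The Euclidean magnitude `|(x,y)| = √(x²+y²)` of a point of `ℝ²`. -/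
def nrm2 (p : ℝ × ℝ) : ℝ := Real.sqrt (p.1 ^ 2 + p.2 ^ 2)

/-- The open Euclidean disk `{(x,y) : x²+y² < r²}` centered at the origin. -/
def disk2 (r : ℝ) : Set (ℝ × ℝ) := {p : ℝ × ℝ | p.1 ^ 2 + p.2 ^ 2 < r ^ 2}

/-- The closed Euclidean disk `{(x,y) : x²+y² ≤ r²}` centered at the origin. -/
def closedDisk2 (r : ℝ) : Set (ℝ × ℝ) := {p : ℝ × ℝ | p.1 ^ 2 + p.2 ^ 2 ≤ r ^ 2}

/-- The circle `{(x,y) : x²+y² = r²}` centered at the origin. -/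
def circle2 (r : ℝ) : Set (ℝ × ℝ) := {p : ℝ × ℝ | p.1 ^ 2 + p.2 ^ 2 = r ^ 2}

/-- Dot product on `ℝ²`. -/
def dot2 (p q : ℝ × ℝ) : ℝ := p.1 * q.1 + p.2 * q.2

/-- The perpendicular vector `v^⊥ = (v₂, −v₁)`. -/
def perp2 (v : ℝ × ℝ) : ℝ × ℝ := (v.2, -v.1)

/-- The function `g = χ_E · ∏ᵢ |fᵢ|^(γᵢ)`. -/
def stdFun (n : ℕ) (f : Fin n → ℝ × ℝ → ℝ) (γ : Fin n → ℝ) (E : Set (ℝ × ℝ)) :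
    ℝ × ℝ → ℝ :=
  E.indicator fun p => ∏ i, |f i p| ^ (γ i)

/-- A boundary curve for the region `E`: one half of a graph `y = h(|x|^{1/N})` or
`x = h(|y|^{1/N})` with `h` real analytic, `h 0 = 0`, joining the origin to the circle
of radius `r₀`. -/
def IsPuiseuxBdryCurve (r₀ : ℝ) (C : Set (ℝ × ℝ)) : Prop :=
  ∃ (N : ℕ) (h : ℝ → ℝ) (I : Set ℝ) (σ : ℝ),
    0 < N ∧ (σ = 1 ∨ σ = -1) ∧ IsOpen I ∧ Icc (0:ℝ) (r₀ ^ ((N:ℝ)⁻¹)) ⊆ I ∧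
    AnalyticOnNhd ℝ h I ∧ h 0 = 0 ∧
    (C = {p : ℝ × ℝ | p ∈ closedDisk2 r₀ ∧ 0 ≤ σ * p.1 ∧
            p.2 = h (|p.1| ^ ((N:ℝ)⁻¹))} ∨
     C = {p : ℝ × ℝ | p ∈ closedDisk2 r₀ ∧ 0 ≤ σ * p.2 ∧
            p.1 = h (|p.2| ^ ((N:ℝ)⁻¹))}) ∧
    (0:ℝ×ℝ) ∈ C ∧ ∃ p ∈ C, nrm2 p = r₀

/-- The admissible form of the set `E`: either a disk centered at the origin, or a finite
disjoint union of open regions, each bounded by two Puiseux boundary curves joining the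
origin to the circle of radius `r₀` together with an arc of that circle, where all the
boundary curves are pairwise disjoint in the closed disk minus the origin. -/
def IsStdDomain (E : Set (ℝ × ℝ)) : Prop :=
  (∃ r₀ > (0:ℝ), E = disk2 r₀) ∨
  (∃ r₀ > (0:ℝ), ∃ m : ℕ, ∃ Es : Fin m → Set (ℝ × ℝ), ∃ Cs : Fin m → Fin 2 → Set (ℝ × ℝ),
    E = Set.iUnion Es ∧
    (Pairwise fun i j => Disjoint (Es i) (Es j)) ∧
    (∀ i, IsOpen (Es i) ∧ Es i ⊆ disk2 r₀ ∧ (0:ℝ×ℝ) ∈ closure (Es i) ∧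
      frontier (Es i) ⊆ Cs i 0 ∪ Cs i 1 ∪ circle2 r₀) ∧
    (∀ i j, IsPuiseuxBdryCurve r₀ (Cs i j)) ∧
    (Pairwise fun (q q' : Fin m × Fin 2) =>
      Disjoint (Cs q.1 q.2 ∩ (closedDisk2 r₀ \ {0}))
               (Cs q'.1 q'.2 ∩ (closedDisk2 r₀ \ {0}))))

/-- The standard form of the paper: the `fᵢ` are real analytic and not identically zero
near the origin, `g = χ_E ∏ |fᵢ|^(γᵢ)` is integrable near the origin, and `E` is an
admissible domain. -/
structure StandardForm (n : ℕ) (f : Fin n → ℝ × ℝ → ℝ) (γ : Fin n → ℝ)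
    (E : Set (ℝ × ℝ)) : Prop where
  analytic : ∃ U ∈ 𝓝 (0 : ℝ × ℝ), ∀ i, AnalyticOnNhd ℝ (f i) U
  nontriv : ∀ i, ¬ (∀ᶠ p in 𝓝 (0 : ℝ × ℝ), f i p = 0)
  integ : ∃ U ∈ 𝓝 (0 : ℝ × ℝ), IntegrableOn (stdFun n f γ E) U
  domain : IsStdDomain E

/-- The two-sided bound `c₁ rᵉ |log r|^d ≤ ∫_{x²+y²<r²} g ≤ c₂ rᵉ |log r|^d` for all small
`r` ("ball exponents" `ε`, `d` of `g`, as in Lemma 1.1). -/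
def BallBound (g : ℝ × ℝ → ℝ) (ε : ℝ) (d : ℕ) : Prop :=
  0 < ε ∧ d ≤ 1 ∧ ∃ c₁ > (0:ℝ), ∃ c₂ > (0:ℝ), ∃ c₃ > (0:ℝ), ∀ r : ℝ, 0 < r → r < c₃ →
    c₁ * r ^ ε * |Real.log r| ^ d ≤ (∫ p in disk2 r, g p) ∧
    (∫ p in disk2 r, g p) ≤ c₂ * r ^ ε * |Real.log r| ^ d

/-- The strip `{(x,y) : |(x,y)·v| < r, |(x,y)·v^⊥| < c}`. -/
def strip2 (v : ℝ × ℝ) (r c : ℝ) : Set (ℝ × ℝ) :=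
  {p : ℝ × ℝ | |dot2 p v| < r ∧ |dot2 p (perp2 v)| < c}

/-- The two-sided bound `a r^δ |log r|^e ≤ ∫_{strip} g ≤ b r^δ |log r|^e` for all small `r`,
for every small `c` ("strip exponents" `δ_v`, `e_v` of `g` in the direction `v`, as in
Lemma 1.2). -/
def StripBound (g : ℝ × ℝ → ℝ) (v : ℝ × ℝ) (δ : ℝ) (e : ℕ) : Prop :=
  0 < δ ∧ e ≤ 1 ∧ ∃ cv > (0:ℝ), ∀ c : ℝ, 0 < c → c < cv →
    ∃ a > (0:ℝ), ∃ b > (0:ℝ), ∀ r : ℝ, 0 < r → r < c →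
      a * r ^ δ * |Real.log r| ^ e ≤ (∫ p in strip2 v r c, g p) ∧
      (∫ p in strip2 v r c, g p) ≤ b * r ^ δ * |Real.log r| ^ e

/-- The order of vanishing of `f` at the origin. -/
def vanishingOrder (f : ℝ × ℝ → ℝ) : ℕ :=
  sInf {k : ℕ | iteratedFDeriv ℝ k f 0 ≠ 0}

/-- (A constant multiple of) the sum of the terms of lowest total degree in the Taylor
expansion of `f` at the origin, as a homogeneous function on `ℝ²`. -/
def lowestPart (f : ℝ × ℝ → ℝ) (p : ℝ × ℝ) : ℝ :=
  iteratedFDeriv ℝ (vanishingOrder f) f 0 (fun _ => p)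

/-- `w` is a tangent direction of the set `C` at the origin. -/
def IsTangentDirAt (C : Set (ℝ × ℝ)) (w : ℝ × ℝ) : Prop :=
  ∃ p : ℕ → ℝ × ℝ, (∀ k, p k ∈ C ∧ p k ≠ 0) ∧
    Tendsto p atTop (𝓝 (0:ℝ×ℝ)) ∧
    (Tendsto (fun k => (nrm2 (p k))⁻¹ • p k) atTop (𝓝 w) ∨
     Tendsto (fun k => (nrm2 (p k))⁻¹ • p k) atTop (𝓝 (-w)))

/-- `w` is the direction of one of the lines `l₁, …, l_p`: a line through the origin in the
zero set of the lowest-degree Taylor part of some `fᵢ`, or a tangent line at the origin to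
one of the boundary curves of `E`. -/
def ExceptionalDir (n : ℕ) (f : Fin n → ℝ × ℝ → ℝ) (E : Set (ℝ × ℝ)) (w : ℝ × ℝ) : Prop :=
  (∃ i, lowestPart (f i) w = 0) ∨ IsTangentDirAt (frontier E) w

/-- Conditions (1.2)-(1.3) on the factor `α`: `C¹` away from the origin, bounded by `A`,
with gradient bounded by `A (x²+y²)^{-1/2}`. -/
def AlphaBound (α : ℝ × ℝ → ℝ) (A : ℝ) : Prop :=
  ContDiffOn ℝ 1 α {(0:ℝ×ℝ)}ᶜ ∧ (∀ p, |α p| ≤ A) ∧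
  ∀ p : ℝ × ℝ, p ≠ 0 → ‖fderiv ℝ α p‖ ≤ A * (nrm2 p)⁻¹

/-- A smooth bump function equal to `1` near `(x₀, y₀)`, supported within (Euclidean)
distance `r` of `(x₀, y₀)`. -/
def IsBump (φ : ℝ × ℝ → ℝ) (x₀ y₀ : ℝ) (r : ℝ) : Prop :=
  ContDiff ℝ (⊤ : ℕ∞) φ ∧ HasCompactSupport φ ∧ (∀ᶠ p in 𝓝 ((x₀, y₀) : ℝ × ℝ), φ p = 1) ∧
    tsupport φ ⊆ {p : ℝ × ℝ | (p.1 - x₀) ^ 2 + (p.2 - y₀) ^ 2 < r ^ 2}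

/-- The oscillatory integral `∫_S h(x,y) e^{i(tx+uy)} dx dy`. -/
def oscInt (h : ℝ × ℝ → ℝ) (S : Set (ℝ × ℝ)) (t u : ℝ) : ℂ :=
  ∫ p in S, (h p : ℂ) * Complex.exp (Complex.I * ((t : ℂ) * (p.1 : ℂ) + (u : ℂ) * (p.2 : ℂ)))

/-- The convolution kernel `K(t,u) = ∫ m(x,y) e^{i(tx+uy)} dx dy`. -/
def Kfull (m : ℝ × ℝ → ℝ) (t u : ℝ) : ℂ :=
  oscInt m Set.univ t u

/-- The localized kernel `K_φ(t,u) = ∫ φ(x,y) m(x,y) e^{i(tx+uy)} dx dy`. -/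
def Kphi (φ m : ℝ × ℝ → ℝ) (t u : ℝ) : ℂ :=
  oscInt (fun p => φ p * m p) Set.univ t u

/-- `k` is a Puiseux function of index `N` on `[0,a]`: `k(x) = k'(x^{1/N})` for a function
`k'` real analytic on an open set containing `[0, a^{1/N}]`; equivalently `x ↦ k(x^N)` is
real analytic. -/
def PuiseuxOn (N : ℕ) (a : ℝ) (k : ℝ → ℝ) : Prop :=
  ∃ (k' : ℝ → ℝ) (I : Set ℝ), IsOpen I ∧ Icc (0:ℝ) (a ^ ((N:ℝ)⁻¹)) ⊆ I ∧
    AnalyticOnNhd ℝ k' I ∧ ∀ x ∈ Icc (0:ℝ) a, k x = k' (x ^ ((N:ℝ)⁻¹))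

/-- `k(x) = l·x^s + higher order terms` as `x → 0⁺`. -/
def LeadingTerm (k : ℝ → ℝ) (l s : ℝ) : Prop :=
  Tendsto (fun x => k x / x ^ s) (𝓝[>] (0:ℝ)) (𝓝 l)

/-- The mixed partial derivative `∂_x^l ∂_y^m F`. -/
def pderiv2 (l m : ℕ) (F : ℝ × ℝ → ℝ) (p : ℝ × ℝ) : ℝ :=
  iteratedDeriv l (fun x => iteratedDeriv m (fun y => F (x, y)) p.2) p.1

/-- The descending product `α(α−1)⋯(α−l+1)`. -/
def descProd (α : ℝ) (l : ℕ) : ℝ := ∏ j ∈ Finset.range l, (α - (j : ℝ))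

/-- The sliver `{(x,y) : 0 < x < a, g(x) < y < G(x)}`. -/
def sliverSet (a : ℝ) (g G : ℝ → ℝ) : Set (ℝ × ℝ) :=
  {q : ℝ × ℝ | 0 < q.1 ∧ q.1 < a ∧ g q.1 < q.2 ∧ q.2 < G q.1}

/-- A wedge of radius `r₀` at the origin: a region bounded by two lines through the origin
and the circle of radius `r₀`. -/
def IsWedge (r₀ : ℝ) (W : Set (ℝ × ℝ)) : Prop :=
  ∃ θ₁ θ₂ : ℝ, θ₁ < θ₂ ∧ θ₂ ≤ θ₁ + 2 * π ∧
    W = {p : ℝ × ℝ | ∃ ρ θ : ℝ, 0 < ρ ∧ ρ < r₀ ∧ θ₁ < θ ∧ θ < θ₂ ∧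
      p = (ρ * Real.cos θ, ρ * Real.sin θ)}


/-- scaling in second coordinate -/
def Dsc (s : ℝ) : ℝ × ℝ →L[ℝ] ℝ × ℝ :=
  (ContinuousLinearMap.fst ℝ ℝ ℝ).prod (s • ContinuousLinearMap.snd ℝ ℝ ℝ)

lemma Dsc_apply (s : ℝ) (p : ℝ × ℝ) : Dsc s p = (p.1, s * p.2) := by simp [Dsc]

lemma Dsc_norm {s : ℝ} (h : |s| ≤ 1) : ‖Dsc s‖ ≤ 1 := by
  refine ContinuousLinearMap.opNorm_le_bound _ zero_le_one fun p => ?_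
  rw [Dsc_apply, one_mul, Prod.norm_def, Prod.norm_def]
  refine max_le_max le_rfl ?_
  simp only [norm_mul, Real.norm_eq_abs]
  nlinarith [abs_nonneg p.2]

lemma Dsc_cont : Continuous Dsc := by
  have : Dsc = fun s => (ContinuousLinearMap.fst ℝ ℝ ℝ).prod (s • ContinuousLinearMap.snd ℝ ℝ ℝ) := rfl
  have h2 : ∀ s, Dsc s = (ContinuousLinearMap.inl ℝ ℝ ℝ).comp (ContinuousLinearMap.fst ℝ ℝ ℝ)
     + s • (ContinuousLinearMap.inr ℝ ℝ ℝ).comp (ContinuousLinearMap.snd ℝ ℝ ℝ) := by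
    intro s; ext <;> simp [Dsc]
  rw [funext h2]
  fun_prop

lemma Dsc_comp_cont (n : ℕ) (P : ContinuousMultilinearMap ℝ (fun _ : Fin n => ℝ × ℝ) ℝ) :
    Continuous fun s => P.compContinuousLinearMap (fun _ => Dsc s) := by
  have h1 : Continuous fun s => (ContinuousMultilinearMap.compContinuousLinearMapContinuousMultilinear ℝ
    (fun _ : Fin n => ℝ × ℝ) (fun _ : Fin n => ℝ × ℝ) ℝ) (fun _ => Dsc s) :=
      (ContinuousMultilinearMap.cont _).comp (continuous_pi fun _ => Dsc_cont)
  exact (ContinuousLinearMap.apply ℝ _ P).continuous.comp h1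

set_option maxHeartbeats 1000000 in
lemma analyticAt_avg (G : ℝ × ℝ → ℝ) (hG : AnalyticAt ℝ G 0) :
    AnalyticAt ℝ (fun p => ∫ s in (0:ℝ)..1, G (Dsc s p)) 0 := by
  obtain ⟨p, R, hp⟩ := hG
  have hcont : ∀ n, Continuous fun s => (p n).compContinuousLinearMap (fun _ => Dsc s) :=
    fun n => Dsc_comp_cont n (p n)
  let q : FormalMultilinearSeries ℝ (ℝ × ℝ) ℝ := fun n =>
    ∫ s in (0:ℝ)..1, (p n).compContinuousLinearMap (fun _ => Dsc s)
  have hbd : ∀ n, ∀ s ∈ Set.uIoc (0:ℝ) 1, ‖(p n).compContinuousLinearMap (fun _ => Dsc s)‖ ≤ ‖p n‖ := by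
    intro n s hs
    rw [Set.uIoc_of_le zero_le_one] at hs
    refine (ContinuousMultilinearMap.norm_compContinuousLinearMap_le _ _).trans ?_
    have : ∏ i : Fin n, ‖Dsc s‖ ≤ 1 := Finset.prod_le_one (fun _ _ => norm_nonneg _)
      (fun _ _ => Dsc_norm (by rw [abs_of_pos hs.1]; exact hs.2))
    nlinarith [norm_nonneg (p n)]
  have hq : ∀ n, ‖q n‖ ≤ ‖p n‖ := by
    intro n
    have := intervalIntegral.norm_integral_le_of_norm_le_const (hbd n)
    simpa [q] using this
  refine ⟨q, R, ?_, hp.r_pos, ?_⟩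
  · refine hp.r_le.trans (ENNReal.le_of_forall_nnreal_lt fun r hr => ?_)
    obtain ⟨C, hC, h⟩ := p.norm_mul_pow_le_of_lt_radius hr
    exact q.le_radius_of_bound C fun n => le_trans (by gcongr; exact hq n) (h n)
  · intro y hy
    have hsum : Summable fun n => ‖p n‖ * ‖y‖ ^ n := by
      have : (‖y‖₊ : ℝ≥0∞) < p.radius := lt_of_lt_of_le (by simpa [enorm_eq_nnnorm] using hy) hp.r_le
      exact p.summable_norm_mul_pow this
    have key := intervalIntegral.hasSum_integral_of_dominated_convergence (μ := volume) (a := (0:ℝ)) (b := 1)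
      (F := fun n s => (p n) (fun _ => Dsc s y)) (f := fun s => G (Dsc s y))
      (fun n _ => ‖p n‖ * ‖y‖ ^ n) ?_ ?_ ?_ ?_ ?_
    · have e : ∀ n, (q n fun _ => y) = ∫ s in (0:ℝ)..1, (p n) (fun _ => Dsc s y) := by
        intro n
        have := (ContinuousMultilinearMap.apply ℝ (fun _ : Fin n => ℝ × ℝ) ℝ (fun _ => y)).intervalIntegral_comp_comm
          ((hcont n).intervalIntegrable (μ := volume) 0 1)
        simpa [q] using this.symm
      simp only [e, zero_add]
      exact key
    · intro n
      exact (Continuous.aestronglyMeasurable (by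
        have := (ContinuousMultilinearMap.apply ℝ (fun _ : Fin n => ℝ × ℝ) ℝ (fun _ => y)).continuous.comp (hcont n)
        exact this))
    · intro n
      refine ae_of_all _ fun s hs => ?_
      have := ((p n).compContinuousLinearMap (fun _ => Dsc s)).le_opNorm (fun _ => y)
      simp only [ContinuousMultilinearMap.compContinuousLinearMap_apply, Finset.prod_const, Finset.card_univ, Fintype.card_fin] at this
      exact this.trans (by gcongr; exact hbd n s hs)
    · exact ae_of_all _ fun s _ => hsum
    · exact intervalIntegrable_const
    · refine ae_of_all _ fun s hs => ?_
      have hs' : |s| ≤ 1 := by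
        rw [Set.uIoc_of_le zero_le_one] at hs
        rw [abs_of_pos hs.1]; exact hs.2
      have : Dsc s y ∈ Metric.eball (0:ℝ×ℝ) R := by
        simp only [Metric.mem_eball, edist_zero_right] at hy ⊢
        refine lt_of_le_of_lt ?_ hy
        have := (Dsc s).le_opNorm y
        have h2 : ‖Dsc s y‖ ≤ ‖y‖ := by nlinarith [Dsc_norm hs', norm_nonneg y]
        rw [← ofReal_norm, ← ofReal_norm]
        exact ENNReal.ofReal_le_ofReal h2
      simpa using hp.hasSum this

lemma analytic_division (F : ℝ × ℝ → ℝ) (hF : AnalyticAt ℝ F 0) :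
    ∃ F1 : ℝ × ℝ → ℝ, AnalyticAt ℝ F1 0 ∧ ∀ᶠ p in 𝓝 (0:ℝ×ℝ), F p = F (p.1, 0) + p.2 * F1 p := by
  have hG : AnalyticAt ℝ (fun p => fderiv ℝ F p (0, 1)) 0 :=
    (ContinuousLinearMap.apply ℝ ℝ ((0:ℝ), (1:ℝ))).analyticAt _ |>.comp hF.fderiv
  refine ⟨_, analyticAt_avg _ hG, ?_⟩
  obtain ⟨r, hr, hball⟩ := Metric.eventually_nhds_iff_ball.1 hF.eventually_analyticAt
  filter_upwards [Metric.ball_mem_nhds 0 hr] with p hp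
  have hin : ∀ s ∈ Set.uIcc (0:ℝ) 1, Dsc s p ∈ ball (0:ℝ×ℝ) r := by
    intro s hs
    rw [Set.uIcc_of_le zero_le_one] at hs
    have h1 : |s| ≤ 1 := by rw [abs_of_nonneg hs.1]; exact hs.2
    simp only [mem_ball, dist_zero_right] at hp ⊢
    have := (Dsc s).le_opNorm p
    nlinarith [Dsc_norm h1, norm_nonneg p]
  have hd : ∀ s ∈ Set.uIcc (0:ℝ) 1, HasDerivAt (fun s => F (Dsc s p)) (p.2 * fderiv ℝ F (Dsc s p) (0,1)) s := by
    intro s hs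
    have h1 : HasFDerivAt F (fderiv ℝ F (Dsc s p)) (Dsc s p) :=
      (hball _ (hin s hs)).differentiableAt.hasFDerivAt
    have h2 : HasDerivAt (fun s => Dsc s p) ((0:ℝ), p.2) s := by
      simp only [Dsc_apply]
      exact (hasDerivAt_const _ _).prodMk (by simpa using (hasDerivAt_id s).mul_const p.2)
    have := h1.comp_hasDerivAt s h2
    have e : (p.2 * fderiv ℝ F (Dsc s p) (0,1)) = (fderiv ℝ F (Dsc s p)) ((0:ℝ), p.2) := by
      rw [← smul_eq_mul, ← map_smul]; simp
    rw [e]; exact this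
  have := intervalIntegral.integral_eq_sub_of_hasDerivAt hd ?_
  · rw [intervalIntegral.integral_const_mul] at this
    rw [this]
    simp [Dsc_apply]
  · apply ContinuousOn.intervalIntegrable
    intro s hs
    refine ContinuousAt.continuousWithinAt (continuousAt_const.mul ?_)
    have h3 : ContinuousAt (fun s => fderiv ℝ F (Dsc s p)) s :=
      ContinuousAt.comp (g := fderiv ℝ F) (hball _ (hin s hs)).fderiv.continuousAt
        ((ContinuousLinearMap.apply ℝ (ℝ × ℝ) p).continuous.comp Dsc_cont).continuousAt
    exact h3.clm_apply continuousAt_const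

def RegD (n : ℕ) (F : ℝ × ℝ → ℝ) (a : ℕ → ℝ → ℝ) (u : ℝ × ℝ → ℝ) : Prop :=
  (∀ k, AnalyticAt ℝ (a k) 0) ∧ (∀ k < n, a k 0 = 0) ∧ AnalyticAt ℝ u 0 ∧ u 0 ≠ 0 ∧
    ∀ᶠ p in 𝓝 (0:ℝ×ℝ), F p = ∑ k ∈ Finset.range n, a k p.1 * p.2 ^ k + p.2 ^ n * u p

lemma analyticAt_slice {F : ℝ × ℝ → ℝ} (hF : AnalyticAt ℝ F 0) : AnalyticAt ℝ (fun y => F (0, y)) 0 :=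
  AnalyticAt.curry_right (p := ((0:ℝ), (0:ℝ))) hF

lemma analyticAt_slice' {F : ℝ × ℝ → ℝ} (hF : AnalyticAt ℝ F 0) : AnalyticAt ℝ (fun t => F (t, 0)) 0 :=
  AnalyticAt.curry_left (p := ((0:ℝ), (0:ℝ))) hF

lemma tendsto_mk_zero_left : Tendsto (fun y : ℝ => ((0:ℝ), y)) (𝓝 0) (𝓝 (0:ℝ×ℝ)) := by
  have : Continuous fun y : ℝ => ((0:ℝ), y) := by fun_prop
  exact this.tendsto' _ _ rfl

lemma tendsto_mk_zero_right : Tendsto (fun y : ℝ => (y, (0:ℝ))) (𝓝 0) (𝓝 (0:ℝ×ℝ)) := by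
  have : Continuous fun y : ℝ => (y, (0:ℝ)) := by fun_prop
  exact this.tendsto' _ _ rfl

lemma tendsto_fst_zero : Tendsto (fun p : ℝ × ℝ => p.1) (𝓝 0) (𝓝 (0:ℝ)) :=
  continuous_fst.tendsto' _ _ rfl

lemma reg_of_order (n : ℕ) : ∀ (F : ℝ × ℝ → ℝ) (w : ℝ → ℝ), AnalyticAt ℝ F 0 → ContinuousAt w 0 → w 0 ≠ 0 →
    (∀ᶠ y in 𝓝 (0:ℝ), F (0, y) = y ^ n * w y) → ∃ a u, RegD n F a u := by
  induction n with
  | zero =>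
    intro F w hF hw hw0 h
    refine ⟨fun _ _ => 0, F, fun _ => analyticAt_const, by simp, hF, ?_, by simp⟩
    have := h.self_of_nhds
    simp only [pow_zero, one_mul] at this
    rw [show (0:ℝ×ℝ) = (0,0) from rfl, this]; exact hw0
  | succ n ih =>
    intro F w hF hw hw0 h
    obtain ⟨F1, hF1, hd⟩ := analytic_division F hF
    have h0 : F (0, 0) = 0 := by simpa using h.self_of_nhds
    have h1 : ∀ᶠ y in 𝓝 (0:ℝ), F1 (0, y) = y ^ n * w y := by
      refine (ContinuousAt.eventuallyEq_nhds_iff_eventuallyEq_nhdsNE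
        (analyticAt_slice hF1).continuousAt ((continuousAt_id.pow n).mul hw)).1 ?_
      have hd' := tendsto_mk_zero_left.eventually hd
      filter_upwards [nhdsWithin_le_nhds h, nhdsWithin_le_nhds hd', self_mem_nhdsWithin] with y h1 h2 hy
      simp only [h0, zero_add] at h2
      have hy : y ≠ 0 := hy
      have : y * F1 (0, y) = y * (y ^ n * w y) := by rw [← h2, h1]; ring
      exact mul_left_cancel₀ hy this
    obtain ⟨a, u, ha, ha0, hu, hu0, he⟩ := ih F1 w hF1 hw hw0 h1
    refine ⟨fun k => Nat.casesOn k (fun t => F (t, 0)) a, u, ?_, ?_, hu, hu0, ?_⟩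
    · rintro (_ | k)
      · exact analyticAt_slice' hF
      · exact ha k
    · rintro (_ | k) hk
      · exact h0
      · exact ha0 k (by omega)
    · filter_upwards [hd, he] with p h2 h3
      rw [Finset.sum_range_succ', h2, h3, mul_add, Finset.mul_sum]
      simp only [pow_zero, mul_one]
      have : ∀ k, p.2 * (a k p.1 * p.2 ^ k) = a k p.1 * p.2 ^ (k+1) := fun k => by ring
      simp only [this]
      change _ = (∑ k ∈ Finset.range n, a k p.1 * p.2 ^ (k+1) + F (p.1,0)) + p.2^(n+1) * u p
      ring

def dy (F : ℝ × ℝ → ℝ) : ℝ × ℝ → ℝ := fun p => fderiv ℝ F p (0, 1)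

lemma dy_analytic {F : ℝ × ℝ → ℝ} {p : ℝ × ℝ} (hF : AnalyticAt ℝ F p) : AnalyticAt ℝ (dy F) p :=
  (ContinuousLinearMap.apply ℝ ℝ ((0:ℝ), (1:ℝ))).analyticAt _ |>.comp hF.fderiv

lemma dy_iter_analytic {F : ℝ × ℝ → ℝ} {p : ℝ × ℝ} (hF : AnalyticAt ℝ F p) (n : ℕ) :
    AnalyticAt ℝ (dy^[n] F) p := by
  induction n generalizing F with
  | zero => exact hF
  | succ n ih => exact ih (dy_analytic hF)

lemma dy_congr {F G : ℝ × ℝ → ℝ} {p : ℝ × ℝ} (h : F =ᶠ[𝓝 p] G) : dy F =ᶠ[𝓝 p] dy G := by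
  filter_upwards [h.fderiv (𝕜 := ℝ)] with q hq
  simp [dy, hq]

lemma dy_iter_congr {F G : ℝ × ℝ → ℝ} {p : ℝ × ℝ} (h : F =ᶠ[𝓝 p] G) (n : ℕ) :
    dy^[n] F =ᶠ[𝓝 p] dy^[n] G := by
  induction n generalizing F G with
  | zero => exact h
  | succ n ih => exact ih (dy_congr h)

lemma hasFDerivAt_dy {F : ℝ × ℝ → ℝ} {p : ℝ × ℝ} (h : DifferentiableAt ℝ F p) :
    HasDerivAt (fun y => F (p.1, y)) (dy F p) p.2 := by
  have h1 : HasFDerivAt F (fderiv ℝ F p) (p.1, p.2) := h.hasFDerivAt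
  have h2 : HasDerivAt (fun y : ℝ => (p.1, y)) ((0:ℝ), (1:ℝ)) p.2 :=
    (hasDerivAt_const _ _).prodMk (hasDerivAt_id _)
  exact h1.comp_hasDerivAt p.2 h2

lemma dy_iter_value (m : ℕ) : ∀ (F : ℝ × ℝ → ℝ) (a : ℕ → ℝ → ℝ) (w : ℝ × ℝ → ℝ),
    (∀ k, AnalyticAt ℝ (a k) 0) → AnalyticAt ℝ w 0 →
    (∀ᶠ p in 𝓝 (0:ℝ×ℝ), F p = ∑ k ∈ Finset.range m, a k p.1 * p.2 ^ k + p.2 ^ m * w p) →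
    ∀ᶠ t in 𝓝 (0:ℝ), dy^[m] F (t, 0) = m.factorial * w (t, 0) := by
  induction m with
  | zero =>
    intro F a w ha hw h
    filter_upwards [tendsto_mk_zero_right.eventually h] with t ht
    simpa using ht
  | succ m ih =>
    intro F a w ha hw h
    have key : ∀ᶠ p in 𝓝 (0:ℝ×ℝ), dy F p = ∑ k ∈ Finset.range m, ((k+1:ℝ) * a (k+1) p.1) * p.2 ^ k
        + p.2 ^ m * ((m+1:ℝ) * w p + p.2 * dy w p) := by
      have hF : AnalyticAt ℝ (fun p : ℝ × ℝ => ∑ k ∈ Finset.range (m+1), a k p.1 * p.2 ^ k + p.2 ^ (m+1) * w p) 0 := by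
        have h2 : AnalyticAt ℝ (fun p : ℝ × ℝ => p.2) 0 := analyticAt_snd
        refine AnalyticAt.add (Finset.analyticAt_fun_sum _ fun k _ => ?_) ((h2.pow _).mul hw)
        have h1 : AnalyticAt ℝ (fun p : ℝ × ℝ => a k p.1) 0 :=
          AnalyticAt.comp (g := a k) (f := fun p : ℝ × ℝ => p.1) (ha k) analyticAt_fst
        exact h1.mul (h2.pow _)
      filter_upwards [dy_congr h, hF.eventually_analyticAt, hw.eventually_analyticAt] with p h1 h2 h3
      rw [h1]
      have hd1 := hasFDerivAt_dy h2.differentiableAt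
      have hd2 : HasDerivAt (fun y => ∑ k ∈ Finset.range (m+1), a k p.1 * y ^ k + y ^ (m+1) * w (p.1, y))
          (∑ k ∈ Finset.range (m+1), a k p.1 * (k * p.2 ^ (k-1)) +
            (((m+1:ℕ):ℝ) * p.2 ^ m * w (p.1, p.2) + p.2 ^ (m+1) * dy w p)) p.2 := by
        refine HasDerivAt.add (HasDerivAt.fun_sum fun k _ => ?_) ?_
        · exact (hasDerivAt_pow k p.2).const_mul _
        · exact (hasDerivAt_pow (m+1) p.2).mul (hasFDerivAt_dy h3.differentiableAt)
      have e := hd1.unique hd2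
      rw [e, Finset.sum_range_succ']
      simp only [Nat.add_sub_cancel, Nat.cast_zero, zero_mul, mul_zero, add_zero]
      congr 1
      · refine Finset.sum_congr rfl fun k _ => ?_
        push_cast; ring
      · push_cast; ring
    have := ih (dy F) (fun k t => (k+1:ℝ) * a (k+1) t) (fun p => (m+1:ℝ) * w p + p.2 * dy w p)
      (fun k => analyticAt_const.mul (ha _))
      ((analyticAt_const.mul hw).add (analyticAt_snd.mul (dy_analytic hw))) key
    filter_upwards [this] with t ht
    rw [Function.iterate_succ_apply, ht, Nat.factorial_succ]
    push_cast; ring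

lemma analytic_implicit (Ψ : ℝ × ℝ → ℝ) (h : AnalyticAt ℝ Ψ 0) (h0 : Ψ 0 = 0) (h1 : dy Ψ 0 ≠ 0) :
    ∃ c : ℝ → ℝ, AnalyticAt ℝ c 0 ∧ c 0 = 0 ∧ ∀ᶠ t in 𝓝 (0:ℝ), Ψ (t, c t) = 0 := by
  have cd : ContDiffAt ℝ ⊤ Ψ 0 := h.contDiffAt
  have inv : (fderiv ℝ Ψ 0 ∘L .inr ℝ ℝ ℝ).IsInvertible := by
    refine ⟨ContinuousLinearEquiv.unitsEquivAut ℝ (Units.mk0 _ h1), ?_⟩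
    ext; simp [dy]
  refine ⟨cd.implicitFunction (by simp) inv, ?_, ?_, ?_⟩
  · exact (cd.contDiffAt_implicitFunction (by simp) inv).analyticAt
  · exact cd.implicitFunction_apply_self (by simp) inv
  · have := cd.eventually_apply_implicitFunction (by simp) inv
    rw [h0] at this
    exact this

def shiftF (c : ℝ → ℝ) (F : ℝ × ℝ → ℝ) : ℝ × ℝ → ℝ := fun p => F (p.1, c p.1 + p.2)

lemma shift_analytic {c : ℝ → ℝ} (hc : AnalyticAt ℝ c 0) (hc0 : c 0 = 0) {F : ℝ × ℝ → ℝ} (hF : AnalyticAt ℝ F 0) :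
    AnalyticAt ℝ (shiftF c F) 0 := by
  have hm : AnalyticAt ℝ (fun p : ℝ × ℝ => (p.1, c p.1 + p.2)) 0 :=
    analyticAt_fst.prod ((AnalyticAt.comp (g := c) (f := fun p : ℝ × ℝ => p.1) hc analyticAt_fst).add analyticAt_snd)
  have : (fun p : ℝ × ℝ => (p.1, c p.1 + p.2)) 0 = 0 := by simp [hc0]
  have h' : AnalyticAt ℝ F ((fun p : ℝ × ℝ => (p.1, c p.1 + p.2)) 0) := by rw [this]; exact hF
  exact AnalyticAt.comp (g := F) (f := fun p : ℝ × ℝ => (p.1, c p.1 + p.2)) h' hm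

lemma shift_tendsto {c : ℝ → ℝ} (hc : AnalyticAt ℝ c 0) (hc0 : c 0 = 0) :
    Tendsto (fun p : ℝ × ℝ => (p.1, c p.1 + p.2)) (𝓝 0) (𝓝 0) := by
  have hm : AnalyticAt ℝ (fun p : ℝ × ℝ => (p.1, c p.1 + p.2)) 0 :=
    analyticAt_fst.prod ((AnalyticAt.comp (g := c) (f := fun p : ℝ × ℝ => p.1) hc analyticAt_fst).add analyticAt_snd)
  have := hm.continuousAt.tendsto
  have e : ((0:ℝ×ℝ).1, c (0:ℝ×ℝ).1 + (0:ℝ×ℝ).2) = 0 := by simp [hc0]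
  rw [e] at this
  exact this

lemma shift_dy {c : ℝ → ℝ} (hc : AnalyticAt ℝ c 0) (hc0 : c 0 = 0) {F : ℝ × ℝ → ℝ} (hF : AnalyticAt ℝ F 0) :
    dy (shiftF c F) =ᶠ[𝓝 0] shiftF c (dy F) := by
  filter_upwards [(shift_tendsto hc hc0).eventually hF.eventually_analyticAt,
    (shift_analytic hc hc0 hF).eventually_analyticAt] with p hp hp2
  have h1 := hasFDerivAt_dy hp2.differentiableAt
  have h2 := hasFDerivAt_dy hp.differentiableAt
  have h3 : HasDerivAt (fun y => F (p.1, c p.1 + y)) (dy F (p.1, c p.1 + p.2)) p.2 :=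
    HasDerivAt.comp_const_add (c p.1) p.2 h2
  exact h1.unique h3

lemma shift_dy_iter {c : ℝ → ℝ} (hc : AnalyticAt ℝ c 0) (hc0 : c 0 = 0) (n : ℕ) :
    ∀ {F : ℝ × ℝ → ℝ} (hF : AnalyticAt ℝ F 0), dy^[n] (shiftF c F) =ᶠ[𝓝 0] shiftF c (dy^[n] F) := by
  induction n with
  | zero => intro F hF; rfl
  | succ n ih =>
    intro F hF
    exact (dy_iter_congr (shift_dy hc hc0 hF) n).trans (ih (dy_analytic hF))

lemma RegD.slice {n : ℕ} {F : ℝ × ℝ → ℝ} {a u} (h : RegD n F a u) :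
    ∀ᶠ y in 𝓝 (0:ℝ), F (0, y) = y ^ n * u (0, y) := by
  filter_upwards [tendsto_mk_zero_left.eventually h.2.2.2.2] with y hy
  rw [hy, Finset.sum_eq_zero, zero_add]
  intro k hk
  simp [h.2.1 k (Finset.mem_range.1 hk)]

/-- Tschirnhaus: after a shift, the subleading coefficient vanishes. -/
lemma tschirnhaus {n : ℕ} {F : ℝ × ℝ → ℝ} {a u} (hF : AnalyticAt ℝ F 0) (h : RegD (n+1) F a u) :
    ∃ c : ℝ → ℝ, AnalyticAt ℝ c 0 ∧ c 0 = 0 ∧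
      ∀ a' u', RegD (n+1) (shiftF c F) a' u' → ∀ᶠ t in 𝓝 (0:ℝ), a' n t = 0 := by
  have hn : ∀ {F : ℝ × ℝ → ℝ} {a u}, RegD (n+1) F a u →
      ∀ᶠ t in 𝓝 (0:ℝ), dy^[n] F (t, 0) = n.factorial * a n t := by
    intro F a u h
    have := dy_iter_value n F a (fun p => a n p.1 + p.2 * u p) h.1
      (AnalyticAt.add (AnalyticAt.comp (g := a n) (f := fun p : ℝ × ℝ => p.1) (h.1 n) analyticAt_fst)
        (analyticAt_snd.mul h.2.2.1)) (by
        filter_upwards [h.2.2.2.2] with p hp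
        rw [hp, Finset.sum_range_succ]; ring)
    simpa using this
  have h1 : dy^[n] F 0 = 0 := by
    have := (hn h).self_of_nhds
    rw [h.2.1 n (by omega), mul_zero] at this
    exact this
  have h2 : dy (dy^[n] F) 0 ≠ 0 := by
    have := (dy_iter_value (n+1) F a u h.1 h.2.2.1 h.2.2.2.2).self_of_nhds
    rw [Function.iterate_succ_apply'] at this
    have h3 : dy (dy^[n] F) 0 = (n+1).factorial * u 0 := this
    rw [h3]
    exact mul_ne_zero (by exact_mod_cast Nat.factorial_ne_zero _) h.2.2.2.1
  obtain ⟨c, hc, hc0, he⟩ := analytic_implicit _ (dy_iter_analytic hF n) h1 h2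
  refine ⟨c, hc, hc0, fun a' u' h' => ?_⟩
  filter_upwards [hn h', tendsto_mk_zero_right.eventually (shift_dy_iter hc hc0 n hF), he] with t h3 h4 h5
  rw [h3] at h4
  simp only [shiftF, add_zero, h5] at h4
  have : (n.factorial : ℝ) ≠ 0 := by exact_mod_cast Nat.factorial_ne_zero _
  exact (mul_eq_zero.1 h4).resolve_left this

def KPat {ι : Type} (F : ι → ℝ × ℝ → ℝ) : Prop :=
  ∃ δ > (0:ℝ), ∃ C : ℝ, ∃ b : ℝ × ℝ → ℝ, ∀ p : ℝ × ℝ, 0 < p.1 → p.1 < δ → |p.2| < δ →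
    ContDiffAt ℝ 1 b p ∧ |b p| ≤ C ∧ |fderiv ℝ b p (0, 1)| ≤ C ∧
    ∀ i, |fderiv ℝ (F i) p (p.1, b p)| ≤ C * |F i p|

/-- box neighbourhoods -/
lemma exists_box {P : ℝ × ℝ → Prop} (h : ∀ᶠ p in 𝓝 (0:ℝ×ℝ), P p) :
    ∃ δ > (0:ℝ), ∀ p : ℝ × ℝ, |p.1| < δ → |p.2| < δ → P p := by
  obtain ⟨δ, hδ, h⟩ := Metric.eventually_nhds_iff.1 h
  refine ⟨δ, hδ, fun p h1 h2 => h ?_⟩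
  rw [dist_zero_right, Prod.norm_def]
  exact max_lt h1 h2

lemma box_mem {δ : ℝ} (hδ : 0 < δ) : ∀ᶠ p in 𝓝 (0:ℝ×ℝ), |p.1| < δ ∧ |p.2| < δ := by
  filter_upwards [Metric.ball_mem_nhds (0:ℝ×ℝ) hδ] with p hp
  rw [mem_ball, dist_zero_right, Prod.norm_def] at hp
  exact ⟨(le_max_left _ _).trans_lt hp, (le_max_right _ _).trans_lt hp⟩

/-- KPat at the level of eventually. -/
lemma kpat_iff {ι : Type} (F : ι → ℝ × ℝ → ℝ) : KPat F ↔ ∃ (C : ℝ) (b : ℝ × ℝ → ℝ),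
    ∀ᶠ p in 𝓝 (0:ℝ×ℝ), 0 < p.1 → ContDiffAt ℝ 1 b p ∧ |b p| ≤ C ∧ |fderiv ℝ b p (0, 1)| ≤ C ∧
    ∀ i, |fderiv ℝ (F i) p (p.1, b p)| ≤ C * |F i p| := by
  constructor
  · rintro ⟨δ, hδ, C, b, h⟩
    refine ⟨C, b, ?_⟩
    filter_upwards [box_mem hδ] with p hp hp1
    exact h p hp1 ((le_abs_self _).trans_lt hp.1) hp.2
  · rintro ⟨C, b, h⟩
    obtain ⟨δ, hδ, h⟩ := exists_box h
    exact ⟨δ, hδ, C, b, fun p h1 h2 h3 => h p (by rwa [abs_of_pos h1]) h3 h1⟩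

lemma kpat_congr {ι : Type} [Fintype ι] {F G : ι → ℝ × ℝ → ℝ} (h : ∀ i, F i =ᶠ[𝓝 0] G i)
    (hF : KPat F) : KPat G := by
  rw [kpat_iff] at *
  obtain ⟨C, b, hb⟩ := hF
  refine ⟨C, b, ?_⟩
  filter_upwards [hb, eventually_all.2 fun i => (h i).eventuallyEq_nhds] with p hp he hp1
  obtain ⟨h1, h2, h3, h4⟩ := hp hp1
  refine ⟨h1, h2, h3, fun i => ?_⟩
  rw [← (he i).fderiv_eq, ← (he i).eq_of_nhds]
  exact h4 i

lemma fderiv_bound_of_continuousAt {F : ℝ × ℝ → ℝ} (hF : AnalyticAt ℝ F 0) :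
    ∃ C > (0:ℝ), ∀ᶠ p in 𝓝 (0:ℝ×ℝ), ‖fderiv ℝ F p‖ ≤ C := by
  have h := hF.fderiv.continuousAt.norm
  refine ⟨‖fderiv ℝ F 0‖ + 1, by positivity, ?_⟩
  filter_upwards [h.eventually_lt_const (lt_add_one _)] with p hp using hp.le

lemma bdd_of_continuousAt {X : Type} [TopologicalSpace X] {F : X → ℝ} {x : X} (hF : ContinuousAt F x) :
    ∃ C > (0:ℝ), ∀ᶠ p in 𝓝 x, |F p| ≤ C := by
  have h := hF.norm
  refine ⟨‖F x‖ + 1, by positivity, ?_⟩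
  filter_upwards [h.eventually_lt_const (lt_add_one _)] with p hp using hp.le

lemma hasFDerivAt_comp_fst {c : ℝ → ℝ} {c' : ℝ} {p : ℝ × ℝ} (h : HasDerivAt c c' p.1) :
    HasFDerivAt (fun p : ℝ × ℝ => c p.1) (c' • ContinuousLinearMap.fst ℝ ℝ ℝ) p :=
  h.comp_hasFDerivAt p hasFDerivAt_fst

lemma kpat_shift {ι : Type} [Fintype ι] {F : ι → ℝ × ℝ → ℝ} (hF : ∀ i, AnalyticAt ℝ (F i) 0)
    {c : ℝ → ℝ} (hc : AnalyticAt ℝ c 0) (hc0 : c 0 = 0) (h : KPat fun i => shiftF c (F i)) : KPat F := by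
  rw [kpat_iff] at *
  obtain ⟨C, b, hb⟩ := h
  have hcm : AnalyticAt ℝ (fun t => - c t) 0 := hc.neg
  have ht := shift_tendsto hcm (by simp [hc0])
  obtain ⟨Cd, hCd, hcd⟩ := bdd_of_continuousAt (F := fun t => t * deriv c t) (x := 0)
    (continuousAt_id.mul hc.deriv.continuousAt)
  refine ⟨C + Cd, fun p => b (p.1, - c p.1 + p.2) + p.1 * deriv c p.1, ?_⟩
  filter_upwards [ht.eventually hb, tendsto_fst_zero.eventually hc.eventually_analyticAt,
    tendsto_fst_zero.eventually hcd,
    ht.eventually (eventually_all.2 fun i => (shift_analytic hc hc0 (hF i)).eventually_analyticAt)] with p hp hcp hcdp hFp hp1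
  obtain ⟨h1, h2, h3, h4⟩ := hp hp1
  set q : ℝ × ℝ := (p.1, - c p.1 + p.2) with hq
  have hΨ : HasFDerivAt (fun p : ℝ × ℝ => (p.1, - c p.1 + p.2))
      ((ContinuousLinearMap.fst ℝ ℝ ℝ).prod (-(deriv c p.1 • ContinuousLinearMap.fst ℝ ℝ ℝ) + ContinuousLinearMap.snd ℝ ℝ ℝ)) p := by
    refine HasFDerivAt.prodMk hasFDerivAt_fst (HasFDerivAt.add ?_ hasFDerivAt_snd)
    have := hasFDerivAt_comp_fst hcp.differentiableAt.hasDerivAt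
    exact this.neg
  have hΨ2 : ContDiffAt ℝ 1 (fun p : ℝ × ℝ => (p.1, - c p.1 + p.2)) p := by
    have : ContDiffAt ℝ 1 (fun p : ℝ × ℝ => c p.1) p := hcp.contDiffAt.comp p contDiffAt_fst
    exact contDiffAt_fst.prodMk (this.neg.add contDiffAt_snd)
  have hb1 : ContDiffAt ℝ 1 (fun p : ℝ × ℝ => b (p.1, - c p.1 + p.2)) p := ContDiffAt.comp p h1 hΨ2
  have hdc : HasFDerivAt (fun p : ℝ × ℝ => p.1 * deriv c p.1)
     (p.1 • (deriv (deriv c) p.1 • ContinuousLinearMap.fst ℝ ℝ ℝ) + deriv c p.1 • ContinuousLinearMap.fst ℝ ℝ ℝ) p := by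
    have := hasFDerivAt_comp_fst hcp.deriv.differentiableAt.hasDerivAt
    exact hasFDerivAt_fst.mul this
  have hbd : HasFDerivAt (fun p : ℝ × ℝ => b (p.1, - c p.1 + p.2)) _ p :=
    HasFDerivAt.comp p (h1.differentiableAt one_ne_zero).hasFDerivAt hΨ
  refine ⟨?_, ?_, ?_, fun i => ?_⟩
  · have : ContDiffAt ℝ 1 (fun p : ℝ × ℝ => deriv c p.1) p := hcp.deriv.contDiffAt.comp p contDiffAt_fst
    exact hb1.add (contDiffAt_fst.mul this)
  · exact (abs_add_le _ _).trans (add_le_add h2 hcdp)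
  · rw [(hbd.fun_add hdc).fderiv]
    simp
    linarith
  · have he : F i = fun p => shiftF c (F i) (p.1, - c p.1 + p.2) := by
      ext p; simp [shiftF]
    have hFd : HasFDerivAt (fun p : ℝ × ℝ => shiftF c (F i) (p.1, - c p.1 + p.2)) _ p :=
      HasFDerivAt.comp (g := shiftF c (F i)) p (hFp i).differentiableAt.hasFDerivAt hΨ
    have h5 : fderiv ℝ (F i) p = (fderiv ℝ (shiftF c (F i)) q).comp ((ContinuousLinearMap.fst ℝ ℝ ℝ).prod (-(deriv c p.1 • ContinuousLinearMap.fst ℝ ℝ ℝ) + ContinuousLinearMap.snd ℝ ℝ ℝ)) := by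
      conv_lhs => rw [he]
      exact hFd.fderiv
    have h6 : F i p = shiftF c (F i) q := by conv_lhs => rw [he]
    rw [h5, h6]
    have := h4 i
    simp only [ContinuousLinearMap.comp_apply, ContinuousLinearMap.prod_apply, ContinuousLinearMap.coe_fst',
      ContinuousLinearMap.add_apply, ContinuousLinearMap.neg_apply, _root_.smul_apply, ContinuousLinearMap.coe_snd', smul_eq_mul]
    have e : (-(deriv c p.1 * p.1) + (b (p.1, -c p.1 + p.2) + p.1 * deriv c p.1)) = b q := by
      rw [hq]; ring
    rw [e]
    refine this.trans ?_
    gcongr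
    linarith

lemma kpat_pow {ι : Type} [Fintype ι] {F : ι → ℝ × ℝ → ℝ} {M : ℕ} (hM : M ≠ 0)
    (hF : ∀ i, AnalyticAt ℝ (F i) 0) (h : KPat fun i (p : ℝ × ℝ) => F i (p.1 ^ M, p.2)) : KPat F := by
  rw [kpat_iff] at *
  obtain ⟨C, b, hb⟩ := h
  have hM0 : (0:ℝ) < M := by exact_mod_cast Nat.pos_of_ne_zero hM
  have hM1 : (1:ℝ) ≤ M := by exact_mod_cast Nat.pos_of_ne_zero hM
  have hM1' : ((M:ℝ)⁻¹) ≤ 1 := inv_le_one_of_one_le₀ hM1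
  have ht : Tendsto (fun p : ℝ × ℝ => (p.1 ^ ((M:ℝ)⁻¹), p.2)) (𝓝 0) (𝓝 0) := by
    have : ContinuousAt (fun p : ℝ × ℝ => (p.1 ^ ((M:ℝ)⁻¹), p.2)) 0 :=
      ContinuousAt.prodMk (continuousAt_fst.rpow_const (Or.inr (by positivity))) continuousAt_snd
    have := this.tendsto
    have e : ((0:ℝ×ℝ).1 ^ ((M:ℝ)⁻¹), (0:ℝ×ℝ).2) = 0 := by
      simp only [Prod.fst_zero, Prod.snd_zero]
      rw [Real.zero_rpow (by positivity)]; rfl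
    rwa [e] at this
  have ht2 : Tendsto (fun p : ℝ × ℝ => (p.1 ^ M, p.2)) (𝓝 0) (𝓝 0) := by
    have : Continuous (fun p : ℝ × ℝ => (p.1 ^ M, p.2)) := by fun_prop
    exact this.tendsto' _ _ (by simp [hM])
  refine ⟨|C|, fun p => (M:ℝ)⁻¹ * b (p.1 ^ ((M:ℝ)⁻¹), p.2), ?_⟩
  filter_upwards [ht.eventually hb, 
    eventually_all.2 fun i => (hF i).eventually_analyticAt] with p hp hFp hp1
  have hr0 : 0 < p.1 ^ ((M:ℝ)⁻¹) := Real.rpow_pos_of_pos hp1 _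
  obtain ⟨h1, h2, h3, h4⟩ := hp hr0
  set q : ℝ × ℝ := (p.1 ^ ((M:ℝ)⁻¹), p.2) with hq
  have hqM : (q.1 ^ M, q.2) = p := by
    simp only [hq]; rw [Real.rpow_inv_natCast_pow hp1.le hM]
  have hΨ : HasFDerivAt (fun p : ℝ × ℝ => (p.1 ^ ((M:ℝ)⁻¹), p.2))
      ((((M:ℝ)⁻¹ * p.1 ^ ((M:ℝ)⁻¹ - 1)) • (ContinuousLinearMap.fst ℝ ℝ ℝ)).prod (ContinuousLinearMap.snd ℝ ℝ ℝ)) p := by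
    refine HasFDerivAt.prodMk ?_ hasFDerivAt_snd
    exact (Real.hasDerivAt_rpow_const (p := (M:ℝ)⁻¹) (Or.inl hp1.ne')).comp_hasFDerivAt p hasFDerivAt_fst
  have hΨ2 : ContDiffAt ℝ 1 (fun p : ℝ × ℝ => (p.1 ^ ((M:ℝ)⁻¹), p.2)) p :=
    (contDiffAt_fst.rpow_const_of_ne hp1.ne').prodMk contDiffAt_snd
  have hb1 : ContDiffAt ℝ 1 (fun p : ℝ × ℝ => b (p.1 ^ ((M:ℝ)⁻¹), p.2)) p := ContDiffAt.comp p h1 hΨ2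
  have hbd : HasFDerivAt (fun p : ℝ × ℝ => b (p.1 ^ ((M:ℝ)⁻¹), p.2)) _ p :=
    HasFDerivAt.comp p (h1.differentiableAt one_ne_zero).hasFDerivAt hΨ
  have hCC : 0 ≤ |C| := abs_nonneg _
  have hCl := le_abs_self C
  refine ⟨contDiffAt_const.mul hb1, ?_, ?_, fun i => ?_⟩
  · rw [abs_mul, abs_of_pos (by positivity)]
    calc (M:ℝ)⁻¹ * |b q| ≤ 1 * |C| := mul_le_mul hM1' (h2.trans hCl) (abs_nonneg _) zero_le_one
      _ = _ := one_mul _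
  · rw [(hbd.const_mul _).fderiv]
    simp only [_root_.smul_apply, ContinuousLinearMap.comp_apply, ContinuousLinearMap.prod_apply, ContinuousLinearMap.coe_fst', ContinuousLinearMap.coe_snd', smul_eq_mul, mul_zero]
    rw [abs_mul, abs_of_pos (by positivity)]
    calc (M:ℝ)⁻¹ * |fderiv ℝ b q (0,1)| ≤ 1 * |C| := mul_le_mul hM1' (h3.trans hCl) (abs_nonneg _) zero_le_one
      _ = _ := one_mul _
  · -- fderiv of F' at q in terms of F at p
    have hΦ : HasFDerivAt (fun p : ℝ × ℝ => (p.1 ^ M, p.2))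
      (((M * q.1 ^ (M - 1)) • (ContinuousLinearMap.fst ℝ ℝ ℝ)).prod (ContinuousLinearMap.snd ℝ ℝ ℝ)) q := by
      refine HasFDerivAt.prodMk ?_ hasFDerivAt_snd
      exact (hasDerivAt_pow M q.1).comp_hasFDerivAt q hasFDerivAt_fst
    have hFd : HasFDerivAt (F i) (fderiv ℝ (F i) p) (q.1 ^ M, q.2) := by
      rw [hqM]; exact (hFp i).differentiableAt.hasFDerivAt
    have := h4 i
    have e1 := (HasFDerivAt.comp q hFd hΦ).fderiv
    have e1' : fderiv ℝ (fun p : ℝ × ℝ => F i (p.1 ^ M, p.2)) q = _ := e1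
    rw [e1', hqM] at this
    simp only [ContinuousLinearMap.comp_apply, ContinuousLinearMap.prod_apply, _root_.smul_apply, ContinuousLinearMap.coe_fst', ContinuousLinearMap.coe_snd', smul_eq_mul] at this
    have e2 : (M:ℝ) * q.1 ^ (M-1) * q.1 = M * p.1 := by
      rw [mul_assoc, pow_sub_one_mul hM, ← (Prod.ext_iff.1 hqM).1]
    rw [e2] at this
    have e3 : ((p.1, (M:ℝ)⁻¹ * b q) : ℝ × ℝ) = (M:ℝ)⁻¹ • ((M * p.1, b q) : ℝ × ℝ) := by
      simp; field_simp
    rw [e3, map_smul, smul_eq_mul, abs_mul, abs_of_pos (by positivity)]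
    calc (M:ℝ)⁻¹ * |fderiv ℝ (F i) p (M * p.1, b q)| ≤ 1 * (|C| * |F i p|) := by
          gcongr; exact this.trans (by gcongr)
      _ = _ := one_mul _

lemma pou (R : ℝ) (δ : ℝ → ℝ) (hδ : ∀ z, 0 < δ z) : ∃ (t : Finset ℝ) (ψ : t → ℝ → ℝ),
    (∀ j, ContDiff ℝ 1 (ψ j)) ∧ (∀ j, tsupport (ψ j) ⊆ ball (j:ℝ) (δ j)) ∧ (∀ j z, 0 ≤ ψ j z) ∧
    (∀ z, ∑ j, ψ j z ≤ 1) ∧ (∀ z, |z| ≤ R → ∑ j, ψ j z = 1) := by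
  obtain ⟨t, -, ht⟩ := (isCompact_Icc (a := -R) (b := R)).elim_nhds_subcover (fun z => ball z (δ z))
    fun z _ => ball_mem_nhds z (hδ z)
  obtain ⟨ψ, hψ⟩ := SmoothPartitionOfUnity.exists_isSubordinate (modelWithCornersSelf ℝ ℝ) (s := Icc (-R) R)
    isClosed_Icc (fun j : t => ball (j:ℝ) (δ j)) (fun j => isOpen_ball) (by
      intro z hz
      have := ht hz
      simp only [mem_iUnion] at this ⊢
      obtain ⟨j, hj, h⟩ := this
      exact ⟨⟨j, hj⟩, h⟩)
  refine ⟨t, fun j => ψ j, fun j => ?_, fun j => hψ j, fun j z => ψ.nonneg j z, fun z => ?_, fun z hz => ?_⟩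
  · exact ((ψ j).contMDiff.contDiff).of_le (by norm_cast)
  · have := ψ.sum_le_one z
    rwa [finsum_eq_sum_of_fintype] at this
  · have := ψ.sum_eq_one (abs_le.1 hz)
    rwa [finsum_eq_sum_of_fintype] at this

def BlowD (n : ℕ) (F : ℝ × ℝ → ℝ) (q : ℕ) (a : ℕ → ℝ → ℝ) (u : ℝ × ℝ → ℝ) : Prop :=
  (∀ k, AnalyticAt ℝ (a k) 0) ∧ AnalyticAt ℝ u 0 ∧ u 0 ≠ 0 ∧
    ∀ᶠ p in 𝓝 (0:ℝ×ℝ), F p = ∑ k ∈ Finset.range n, p.1 ^ (q * (n - k)) * a k p.1 * p.2 ^ k + p.2 ^ n * u p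

def Gz (n q : ℕ) (a : ℕ → ℝ → ℝ) (u : ℝ × ℝ → ℝ) (z : ℝ) : ℝ × ℝ → ℝ := fun p =>
  ∑ k ∈ Finset.range n, a k p.1 * (z + p.2) ^ k + (z + p.2) ^ n * u (p.1, p.1 ^ q * (z + p.2))

lemma analyticAt_comp_fst {a : ℝ → ℝ} (h : AnalyticAt ℝ a 0) : AnalyticAt ℝ (fun p : ℝ × ℝ => a p.1) 0 :=
  AnalyticAt.comp (g := a) (f := fun p : ℝ × ℝ => p.1) h analyticAt_fst

lemma Gz_analytic {n q : ℕ} {F : ℝ × ℝ → ℝ} {a u} (hq : q ≠ 0) (h : BlowD n F q a u) (z : ℝ) :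
    AnalyticAt ℝ (Gz n q a u z) 0 := by
  have hz : AnalyticAt ℝ (fun p : ℝ × ℝ => z + p.2) 0 := analyticAt_const.add analyticAt_snd
  have hu : AnalyticAt ℝ (fun p : ℝ × ℝ => u (p.1, p.1 ^ q * (z + p.2))) 0 := by
    have hm : AnalyticAt ℝ (fun p : ℝ × ℝ => (p.1, p.1 ^ q * (z + p.2))) 0 :=
      analyticAt_fst.prod ((analyticAt_fst.pow q).mul hz)
    refine AnalyticAt.comp (g := u) (f := fun p : ℝ × ℝ => (p.1, p.1 ^ q * (z + p.2))) ?_ hm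
    have : (0:ℝ×ℝ) = ((0:ℝ×ℝ).1, (0:ℝ×ℝ).1 ^ q * (z + (0:ℝ×ℝ).2)) := by simp [hq]; rfl
    exact this ▸ h.2.1
  refine AnalyticAt.add (Finset.analyticAt_fun_sum _ fun k _ => ?_) ((hz.pow n).mul hu)
  exact (analyticAt_comp_fst (h.1 k)).mul (hz.pow k)

lemma BlowD.analytic {n q : ℕ} {F : ℝ × ℝ → ℝ} {a u} (h : BlowD n F q a u) : AnalyticAt ℝ F 0 := by
  have : AnalyticAt ℝ (fun p : ℝ × ℝ => ∑ k ∈ Finset.range n, p.1 ^ (q * (n - k)) * a k p.1 * p.2 ^ k + p.2 ^ n * u p) 0 := by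
    refine AnalyticAt.add (Finset.analyticAt_fun_sum _ fun k _ => ?_) ((analyticAt_snd.pow n).mul h.2.1)
    exact ((analyticAt_fst.pow _).mul (analyticAt_comp_fst (h.1 k))).mul (analyticAt_snd.pow k)
  exact this.congr (h.2.2.2.mono fun p hp => hp.symm)

lemma blow_inner {n q : ℕ} {F : ℝ × ℝ → ℝ} {a u} (hq : q ≠ 0) (h : BlowD n F q a u) (z : ℝ) :
    ∀ᶠ p in 𝓝 (0:ℝ×ℝ), ∀ p' : ℝ × ℝ, 0 < p'.1 → p = (p'.1, p'.1 ^ q * (z + p'.2)) →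
      AnalyticAt ℝ (Gz n q a u z) p' → ∀ b C : ℝ, |fderiv ℝ (Gz n q a u z) p' (p'.1, b)| ≤ C * |Gz n q a u z p'| →
      |fderiv ℝ F p (p.1, q * p.2 + p.1 ^ q * b)| ≤ (q * n + C) * |F p| := by
  filter_upwards [h.2.2.2.eventually_nhds, h.analytic.eventually_analyticAt] with p hp hFp p' hp'0 hpp' hG b C hC
  subst hpp'
  set Φ : ℝ × ℝ → ℝ × ℝ := fun p => (p.1, p.1 ^ q * (z + p.2)) with hΦ
  have hΦc : Continuous Φ := by fun_prop
  have hev : (fun r => F (Φ r)) =ᶠ[𝓝 p'] fun r => r.1 ^ (q * n) * Gz n q a u z r := by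
    filter_upwards [hΦc.continuousAt.eventually hp] with r hr
    rw [hr, Gz, mul_add, Finset.mul_sum]
    congr 1
    · refine Finset.sum_congr rfl fun k hk => ?_
      have hk := Finset.mem_range.1 hk
      have : q * n = q * (n - k) + q * k := by rw [← mul_add]; congr 1; omega
      rw [this, pow_add, pow_mul _ q k, hΦ]; simp only; rw [mul_pow]; ring
    · rw [hΦ]; simp only; rw [mul_pow, pow_mul]; ring
  have hΦd : HasFDerivAt Φ ((ContinuousLinearMap.fst ℝ ℝ ℝ).prod
      (p'.1 ^ q • ContinuousLinearMap.snd ℝ ℝ ℝ + (z + p'.2) • (((q:ℝ) * p'.1 ^ (q-1)) • ContinuousLinearMap.fst ℝ ℝ ℝ))) p' := by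
    refine HasFDerivAt.prodMk hasFDerivAt_fst ?_
    exact (hasFDerivAt_comp_fst (hasDerivAt_pow q p'.1)).mul (hasFDerivAt_snd.const_add z)
  have d1 := (HasFDerivAt.comp p' hFp.differentiableAt.hasFDerivAt hΦd).fderiv
  have d2 := ((hasFDerivAt_comp_fst (hasDerivAt_pow (q*n) p'.1)).mul hG.differentiableAt.hasFDerivAt).fderiv
  have d3 : fderiv ℝ (F ∘ Φ) p' = fderiv ℝ (fun r => r.1 ^ (q * n) * Gz n q a u z r) p' := hev.fderiv_eq
  rw [d1] at d3
  have d4 := congrArg (fun L => L (p'.1, b)) (d3.trans d2)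
  simp only [ContinuousLinearMap.comp_apply, ContinuousLinearMap.prod_apply, _root_.smul_apply, _root_.add_apply, ContinuousLinearMap.coe_fst', ContinuousLinearMap.coe_snd', smul_eq_mul] at d4
  have e1 : p'.1 ^ q * b + (z + p'.2) * (↑q * p'.1 ^ (q - 1) * p'.1) = q * (p'.1 ^ q * (z + p'.2)) + p'.1 ^ q * b := by
    rw [mul_assoc (q:ℝ), pow_sub_one_mul hq]; ring
  rw [e1] at d4
  have hv : F (Φ p') = p'.1 ^ (q * n) * Gz n q a u z p' := hev.eq_of_nhds
  have e2 : fderiv ℝ F (Φ p') (p'.1, q * (p'.1 ^ q * (z + p'.2)) + p'.1 ^ q * b) = 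
     p'.1 ^ (q * n) * fderiv ℝ (Gz n q a u z) p' (p'.1, b) + (q * n : ℝ) * (p'.1 ^ (q*n) * Gz n q a u z p') := by
    rw [d4]
    rcases Nat.eq_zero_or_pos (q * n) with h0 | h0
    · have : (q * n : ℝ) = 0 := by exact_mod_cast h0
      simp [h0, this]
    · rw [mul_assoc ((q * n : ℕ):ℝ), pow_sub_one_mul h0.ne']; push_cast; ring
  change |fderiv ℝ F (Φ p') (p'.1, q * (p'.1 ^ q * (z + p'.2)) + p'.1 ^ q * b)| ≤ (q * n + C) * |F (Φ p')|
  rw [e2, hv]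
  have hpos : 0 < p'.1 ^ (q*n) := by positivity
  calc _ ≤ |p'.1 ^ (q * n) * fderiv ℝ (Gz n q a u z) p' (p'.1, b)| + |(q * n : ℝ) * (p'.1 ^ (q*n) * Gz n q a u z p')| := abs_add_le _ _
    _ = p'.1 ^ (q * n) * |fderiv ℝ (Gz n q a u z) p' (p'.1, b)| + (q * n : ℝ) * |p'.1 ^ (q*n) * Gz n q a u z p'| := by
      rw [abs_mul (p'.1 ^ (q*n)) (fderiv ℝ _ _ _), abs_mul (q * n : ℝ), abs_of_pos hpos, abs_of_nonneg (by positivity : (0:ℝ) ≤ q * n)]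
    _ ≤ p'.1 ^ (q * n) * (C * |Gz n q a u z p'|) + (q * n : ℝ) * |p'.1 ^ (q*n) * Gz n q a u z p'| := by gcongr
    _ = _ := by rw [abs_mul, abs_of_pos hpos]; ring

lemma outer_term {n q k : ℕ} {a : ℝ → ℝ} {a' : ℝ} {p : ℝ × ℝ} (ha : HasDerivAt a a' p.1) (hk : k ≤ n) :
    ∃ L : ℝ × ℝ →L[ℝ] ℝ, HasFDerivAt (fun p : ℝ × ℝ => p.1 ^ (q * (n - k)) * a p.1 * p.2 ^ k) L p ∧
      L (p.1, q * p.2) = (q * n : ℝ) * (p.1 ^ (q * (n - k)) * a p.1 * p.2 ^ k) + p.1 ^ (q * (n - k)) * (p.1 * a') * p.2 ^ k := by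
  have h1 := hasFDerivAt_comp_fst ((hasDerivAt_pow (q * (n - k)) p.1).mul ha)
  have h2 : HasFDerivAt (fun p : ℝ × ℝ => p.2 ^ k) (((k:ℝ) * p.2 ^ (k-1)) • ContinuousLinearMap.snd ℝ ℝ ℝ) p :=
    (hasDerivAt_pow k p.2).comp_hasFDerivAt p hasFDerivAt_snd
  refine ⟨_, h1.mul h2, ?_⟩
  simp only [_root_.smul_apply, _root_.add_apply, ContinuousLinearMap.coe_fst', ContinuousLinearMap.coe_snd', smul_eq_mul, Pi.mul_apply]
  have e1 : (k:ℝ) * p.2 ^ (k-1) * (q * p.2) = k * q * p.2 ^ k := by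
    rcases Nat.eq_zero_or_pos k with h0 | h0
    · simp [h0]
    · rw [← pow_sub_one_mul h0.ne' p.2]; ring
  have e2 : ((q * (n-k) : ℕ):ℝ) * p.1 ^ (q * (n-k) - 1) * p.1 = ((q * (n-k) : ℕ):ℝ) * p.1 ^ (q * (n-k)) := by
    rcases Nat.eq_zero_or_pos (q * (n-k)) with h0 | h0
    · simp [h0]
    · rw [mul_assoc, pow_sub_one_mul h0.ne']
  have e3 : ((q * (n-k) : ℕ):ℝ) = q * n - q * k := by push_cast [hk]; ring
  rw [e1, add_mul _ _ p.1]
  have e4 : ((q * (n-k) : ℕ):ℝ) * p.1 ^ (q * (n-k) - 1) * a p.1 * p.1 = ((q * (n-k) : ℕ):ℝ) * p.1 ^ (q * (n-k)) * a p.1 := by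
    rw [mul_right_comm, e2]
  rw [e4, e3]; ring

lemma blow_outer {n q : ℕ} {F : ℝ × ℝ → ℝ} {a u} (hq : q ≠ 0) (h : BlowD n F q a u) :
    ∃ R C : ℝ, 0 ≤ C ∧ ∀ᶠ p in 𝓝 (0:ℝ×ℝ), 0 < p.1 → R * p.1 ^ q ≤ |p.2| →
      |fderiv ℝ F p (p.1, q * p.2)| ≤ C * |F p| := by
  choose A hA0 hA using fun k => bdd_of_continuousAt (h.1 k).continuousAt
  choose B hB0 hB using fun k => bdd_of_continuousAt (F := fun t => t * deriv (a k) t) (x := 0)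
    (continuousAt_id.mul (h.1 k).deriv.continuousAt)
  obtain ⟨Cu, hCu0, hCu⟩ := fderiv_bound_of_continuousAt h.2.1
  set c0 := |u 0| / 2 with hc0
  have hc0p : 0 < c0 := by have := abs_pos.2 h.2.2.1; positivity
  have hu : ∀ᶠ p in 𝓝 (0:ℝ×ℝ), c0 < |u p| :=
    h.2.1.continuousAt.abs.eventually_const_lt (by rw [hc0]; linarith)
  set SA := ∑ k ∈ Finset.range n, A k
  set SB := ∑ k ∈ Finset.range n, B k
  have hSA : 0 ≤ SA := Finset.sum_nonneg fun k _ => (hA0 k).le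
  have hSB : 0 ≤ SB := Finset.sum_nonneg fun k _ => (hB0 k).le
  set R := 1 + 2 * SA / c0 with hR
  have hR1 : 1 ≤ R := by have : 0 ≤ 2 * SA / c0 := by positivity
                         linarith
  have hRSA : SA / R ≤ c0 / 2 := by
    rw [div_le_iff₀ (by linarith), hR]; field_simp; nlinarith
  refine ⟨R, q * n + (SB + Cu * (q + 1)) * (2 / c0), by positivity, ?_⟩
  filter_upwards [h.2.2.2.eventually_nhds, tendsto_fst_zero.eventually ((Filter.eventually_all_finset (Finset.range n)).2 fun k _ => hA k),
    tendsto_fst_zero.eventually ((Filter.eventually_all_finset (Finset.range n)).2 fun k _ => hB k), hCu, hu,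
    tendsto_fst_zero.eventually ((Filter.eventually_all_finset (Finset.range n)).2 fun k _ => (h.1 k).eventually_analyticAt),
    h.2.1.eventually_analyticAt, box_mem one_pos] with p hp hAp hBp hCup hup hap hua hbox hp0 hRp
  have hy0 : 0 ≤ |p.2| := abs_nonneg _
  have hpw : ∀ k ∈ Finset.range n, p.1 ^ (q * (n - k)) * |p.2| ^ k ≤ |p.2| ^ n / R := by
    intro k hk
    have hk := Finset.mem_range.1 hk
    have h1 : p.1 ^ q ≤ |p.2| / R := by rw [le_div_iff₀ (by linarith)]; linarith
    have h2 : p.1 ^ (q * (n - k)) ≤ |p.2| ^ (n-k) / R := by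
      rw [pow_mul]
      calc (p.1 ^ q) ^ (n-k) ≤ (|p.2| / R) ^ (n-k) := by gcongr
        _ = |p.2| ^ (n-k) / R ^ (n-k) := div_pow _ _ _
        _ ≤ |p.2| ^ (n-k) / R := by
          gcongr
          exact le_self_pow₀ hR1 (by omega)
    calc p.1 ^ (q * (n - k)) * |p.2| ^ k ≤ |p.2| ^ (n-k) / R * |p.2| ^ k := by gcongr
      _ = |p.2| ^ n / R := by
        rw [div_mul_eq_mul_div, ← pow_add]; congr 2; omega
  have hS : ∀ (w B : ℕ → ℝ), (∀ k ∈ Finset.range n, |w k| ≤ B k) →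
      |∑ k ∈ Finset.range n, p.1 ^ (q * (n - k)) * w k * p.2 ^ k| ≤ (∑ k ∈ Finset.range n, B k) * (|p.2| ^ n / R) := by
    intro w B hw
    refine (Finset.abs_sum_le_sum_abs _ _).trans ?_
    rw [Finset.sum_mul]
    refine Finset.sum_le_sum fun k hk => ?_
    rw [abs_mul, abs_mul, abs_pow, abs_pow, abs_of_pos hp0]
    calc p.1 ^ (q * (n - k)) * |w k| * |p.2| ^ k = |w k| * (p.1 ^ (q * (n - k)) * |p.2| ^ k) := by ring
      _ ≤ B k * (|p.2| ^ n / R) := by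
        gcongr
        · exact (abs_nonneg _).trans (hw k hk)
        · exact hw k hk
        · exact hpw k hk
  have hyn : 0 ≤ |p.2| ^ n := by positivity
  -- lower bound
  have hlow : c0 / 2 * |p.2| ^ n ≤ |F p| := by
    rw [hp.self_of_nhds]
    have h1 := hS (fun k => a k p.1) A hAp
    have h2 : |p.2 ^ n * u p| ≥ |p.2| ^ n * c0 := by
      rw [abs_mul, abs_pow]; gcongr
    have h3 := abs_sub_abs_le_abs_add (p.2 ^ n * u p) (∑ k ∈ Finset.range n, p.1 ^ (q * (n - k)) * a k p.1 * p.2 ^ k)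
    have h4 : SA * (|p.2| ^ n / R) ≤ c0 / 2 * |p.2| ^ n := by
      calc SA * (|p.2| ^ n / R) = SA / R * |p.2| ^ n := by ring
        _ ≤ _ := by gcongr
    rw [add_comm]
    linarith
  choose! L hL hLV using fun k (hk : k ∈ Finset.range n) => outer_term (q := q) (n := n) (k := k) (hap k hk).differentiableAt.hasDerivAt (Finset.mem_range.1 hk).le
  have hpn : HasFDerivAt (fun p : ℝ × ℝ => p.2 ^ n) (((n:ℝ) * p.2 ^ (n-1)) • ContinuousLinearMap.snd ℝ ℝ ℝ) p :=
    (hasDerivAt_pow n p.2).comp_hasFDerivAt p hasFDerivAt_snd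
  have hd := ((HasFDerivAt.fun_sum hL).fun_add (hpn.mul hua.differentiableAt.hasFDerivAt)).fderiv
  have hp' : F =ᶠ[𝓝 p] fun p => ∑ k ∈ Finset.range n, p.1 ^ (q * (n - k)) * a k p.1 * p.2 ^ k + p.2 ^ n * u p := hp
  have hd2 : fderiv ℝ F p (p.1, q * p.2) = (q * n : ℝ) * F p + (∑ k ∈ Finset.range n, p.1 ^ (q * (n - k)) * (p.1 * deriv (a k) p.1) * p.2 ^ k)
      + p.2 ^ n * fderiv ℝ u p (p.1, q * p.2) := by
    rw [hp'.fderiv_eq, hp'.eq_of_nhds]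
    refine (congrArg (fun L => L (p.1, q * p.2)) hd).trans ?_
    simp only [_root_.add_apply, _root_.sum_apply, _root_.smul_apply, ContinuousLinearMap.coe_snd', smul_eq_mul]
    rw [Finset.sum_congr rfl hLV, Finset.sum_add_distrib, ← Finset.mul_sum]
    have e1 : (n:ℝ) * p.2 ^ (n-1) * (q * p.2) = n * q * p.2 ^ n := by
      rcases Nat.eq_zero_or_pos n with h0 | h0
      · simp [h0]
      · rw [← pow_sub_one_mul h0.ne' p.2]; ring
    rw [e1]; ring
  rw [hd2]
  have hV : ‖((p.1, q * p.2) : ℝ × ℝ)‖ ≤ q + 1 := by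
    rw [Prod.norm_def]
    have h1 := hbox.1.le
    have h2 := hbox.2.le
    have hq0 : (0:ℝ) ≤ q := by positivity
    refine max_le ?_ ?_
    · simp only [Real.norm_eq_abs]; linarith
    · simp only [Real.norm_eq_abs, abs_mul, Nat.abs_cast]; nlinarith
  have h1 := hS (fun k => p.1 * deriv (a k) p.1) B hBp
  have h1' : SB * (|p.2| ^ n / R) ≤ SB * |p.2| ^ n := by
    gcongr; exact div_le_self hyn hR1
  have h2 : |p.2 ^ n * fderiv ℝ u p (p.1, q * p.2)| ≤ |p.2| ^ n * (Cu * (q + 1)) := by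
    rw [abs_mul, abs_pow]
    gcongr
    refine ((fderiv ℝ u p).le_opNorm _).trans ?_
    gcongr
  have h3 : |p.2| ^ n ≤ 2 / c0 * |F p| := by
    rw [div_mul_eq_mul_div, le_div_iff₀ hc0p]; linarith
  have h4 : |(q * n : ℝ) * F p| = q * n * |F p| := by rw [abs_mul, abs_of_nonneg (by positivity)]
  have h5 : (SB + Cu * (q + 1)) * |p.2| ^ n ≤ (SB + Cu * (q + 1)) * (2 / c0 * |F p|) := by gcongr
  have := abs_add_three ((q * n : ℝ) * F p) (∑ k ∈ Finset.range n, p.1 ^ (q * (n - k)) * (p.1 * deriv (a k) p.1) * p.2 ^ k) (p.2 ^ n * fderiv ℝ u p (p.1, q * p.2))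
  nlinarith

lemma glue_term {b : ℝ × ℝ → ℝ} {δ C z0 : ℝ} (hδ : 0 < δ)
    (hb : ∀ p : ℝ × ℝ, 0 < p.1 → p.1 < δ → |p.2| < δ → ContDiffAt ℝ 1 b p ∧ |b p| ≤ C ∧ |fderiv ℝ b p (0, 1)| ≤ C)
    {ψ : ℝ → ℝ} (hψ : ContDiff ℝ 1 ψ) (hs : tsupport ψ ⊆ ball z0 δ) (h0 : ∀ z, 0 ≤ ψ z) (h1 : ∀ z, ψ z ≤ 1) :
    ∃ D ≥ (0:ℝ), ∀ p : ℝ × ℝ, 0 < p.1 → p.1 < δ →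
      ContDiffAt ℝ 1 (fun p : ℝ × ℝ => ψ p.2 * b (p.1, p.2 - z0)) p ∧ |ψ p.2 * b (p.1, p.2 - z0)| ≤ D ∧
      |fderiv ℝ (fun p : ℝ × ℝ => ψ p.2 * b (p.1, p.2 - z0)) p (0, 1)| ≤ D := by
  have hcs : HasCompactSupport ψ :=
    HasCompactSupport.of_support_subset_isCompact (isCompact_closedBall z0 δ)
      ((subset_tsupport ψ).trans (hs.trans ball_subset_closedBall))
  obtain ⟨D1, hD1⟩ := (hcs.deriv).exists_bound_of_continuous (hψ.continuous_deriv le_rfl)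
  have hD1' : 0 ≤ D1 := (norm_nonneg _).trans (hD1 0)
  refine ⟨|C| + D1 * |C|, by positivity, fun p hp0 hpδ => ?_⟩
  by_cases hz : p.2 ∈ tsupport ψ
  · have hz' := hs hz
    rw [mem_ball, Real.dist_eq] at hz'
    obtain ⟨c1, c2, c3⟩ := hb (p.1, p.2 - z0) hp0 hpδ hz'
    have hψ2 : HasFDerivAt (fun p : ℝ × ℝ => ψ p.2) (deriv ψ p.2 • ContinuousLinearMap.snd ℝ ℝ ℝ) p :=
      (hψ.differentiable one_ne_zero _).hasDerivAt.comp_hasFDerivAt p hasFDerivAt_snd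
    have hΨ : HasFDerivAt (fun p : ℝ × ℝ => (p.1, p.2 - z0)) ((ContinuousLinearMap.fst ℝ ℝ ℝ).prod (ContinuousLinearMap.snd ℝ ℝ ℝ)) p :=
      hasFDerivAt_fst.prodMk (hasFDerivAt_snd.sub_const z0)
    have hb2 : HasFDerivAt (fun p : ℝ × ℝ => b (p.1, p.2 - z0)) _ p :=
      HasFDerivAt.comp (g := b) p (c1.differentiableAt one_ne_zero).hasFDerivAt hΨ
    have hCl := le_abs_self C
    have hC0 := abs_nonneg C
    have hab : |ψ p.2| ≤ 1 := by rw [abs_of_nonneg (h0 _)]; exact h1 _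
    refine ⟨?_, ?_, ?_⟩
    · refine ContDiffAt.mul (hψ.contDiffAt.comp p contDiffAt_snd) ?_
      exact ContDiffAt.comp (g := b) p c1 (contDiffAt_fst.prodMk (contDiffAt_snd.sub contDiffAt_const))
    · rw [abs_mul]
      have : |ψ p.2| * |b (p.1, p.2 - z0)| ≤ 1 * |C| := mul_le_mul hab (c2.trans hCl) (abs_nonneg _) zero_le_one
      nlinarith [mul_nonneg hD1' hC0]
    · rw [(hψ2.fun_mul hb2).fderiv]
      simp only [ContinuousLinearMap.comp_apply, ContinuousLinearMap.prod_apply, _root_.smul_apply, _root_.add_apply, ContinuousLinearMap.coe_fst', ContinuousLinearMap.coe_snd', smul_eq_mul, mul_one]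
      refine (abs_add_le _ _).trans ?_
      rw [abs_mul, abs_mul]
      have e1 : |ψ p.2| * |fderiv ℝ b (p.1, p.2 - z0) (0, 1)| ≤ 1 * |C| := mul_le_mul hab (c3.trans hCl) (abs_nonneg _) zero_le_one
      have e2 : |b (p.1, p.2 - z0)| * |deriv ψ p.2| ≤ |C| * D1 :=
        mul_le_mul (c2.trans hCl) (hD1 _) (abs_nonneg _) hC0
      linarith
  · have hev : (fun p : ℝ × ℝ => ψ p.2 * b (p.1, p.2 - z0)) =ᶠ[𝓝 p] fun _ => 0 := by
      have : ∀ᶠ z in 𝓝 p.2, ψ z = 0 := by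
        filter_upwards [(isClosed_tsupport ψ).isOpen_compl.mem_nhds hz] with z hz
        exact image_eq_zero_of_notMem_tsupport hz
      filter_upwards [continuousAt_snd.eventually this] with r hr
      simp [hr]
    refine ⟨contDiffAt_const.congr_of_eventuallyEq hev, ?_, ?_⟩
    · have := hev.eq_of_nhds
      rw [this]; simp; positivity
    · rw [hev.fderiv_eq]; simp; positivity

lemma kpat_blowup {ι : Type} [Fintype ι] {F : ι → ℝ × ℝ → ℝ} {n : ι → ℕ} {q : ℕ} (hq : q ≠ 0)
    {a : ι → ℕ → ℝ → ℝ} {u : ι → ℝ × ℝ → ℝ} (h : ∀ i, BlowD (n i) (F i) q (a i) (u i))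
    (hG : ∀ z, KPat fun i => Gz (n i) q (a i) (u i) z) : KPat F := by
  rw [kpat_iff]
  choose R C hC hout using fun i => blow_outer hq (h i)
  -- local data
  have hloc : ∀ z, ∃ δ > (0:ℝ), ∃ C : ℝ, ∃ b : ℝ × ℝ → ℝ, ∀ p : ℝ × ℝ, 0 < p.1 → p.1 < δ → |p.2| < δ →
    (ContDiffAt ℝ 1 b p ∧ |b p| ≤ C ∧ |fderiv ℝ b p (0, 1)| ≤ C) ∧
    ∀ i, AnalyticAt ℝ (Gz (n i) q (a i) (u i) z) p ∧ |fderiv ℝ (Gz (n i) q (a i) (u i) z) p (p.1, b p)| ≤ C * |Gz (n i) q (a i) (u i) z p| := by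
    intro z
    obtain ⟨C, b, hb⟩ := (kpat_iff _).1 (hG z)
    obtain ⟨δ, hδ, hh⟩ := exists_box (hb.and (eventually_all.2 fun i => (Gz_analytic hq (h i) z).eventually_analyticAt))
    refine ⟨δ, hδ, C, b, fun p h1 h2 h3 => ?_⟩
    obtain ⟨h4, h5⟩ := hh p (by rwa [abs_of_pos h1]) h3
    obtain ⟨h6, h7, h8, h9⟩ := h4 h1
    exact ⟨⟨h6, h7, h8⟩, fun i => ⟨h5 i, h9 i⟩⟩
  choose δ hδ Cz b hb using hloc
  set R0 := ∑ i, |R i| with hR0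
  obtain ⟨t, ψ, hψ, hψs, hψ0, hψ1, hψR⟩ := pou R0 δ hδ
  have hψle : ∀ j z, ψ j z ≤ 1 := fun j z =>
    (Finset.single_le_sum (f := fun j => ψ j z) (fun j _ => hψ0 j z) (Finset.mem_univ j)).trans (hψ1 z)
  choose D hD0 hD using fun j : t => glue_term (hδ j) (fun p h1 h2 h3 => (hb j p h1 h2 h3).1) (hψ j) (hψs j) (hψ0 j) (hψle j)
  set W : ℝ × ℝ → ℝ := fun p => ∑ j : t, ψ j p.2 * b j (p.1, p.2 - j) with hW
  set b' : ℝ × ℝ → ℝ := fun p => q * p.2 + p.1 ^ q * W (p.1, p.2 / p.1 ^ q) with hb'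
  set SD := ∑ j, D j with hSD
  have hSD0 : 0 ≤ SD := Finset.sum_nonneg fun j _ => hD0 j
  set K : ℝ := ∑ i, (C i + ∑ j : t, (q * n i + |Cz j|)) with hK
  have hKi : ∀ i, C i + ∑ j : t, (q * n i + |Cz j|) ≤ K := fun i =>
    Finset.single_le_sum (f := fun i => C i + ∑ j : t, (q * n i + |Cz j|))
      (fun i _ => add_nonneg (hC i) (Finset.sum_nonneg fun j _ => by positivity)) (Finset.mem_univ i)
  have hK0 : 0 ≤ K := Finset.sum_nonneg fun i _ => add_nonneg (hC i) (Finset.sum_nonneg fun j _ => by positivity)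
  refine ⟨q + SD + K, b', ?_⟩
  filter_upwards [eventually_all.2 hout, eventually_all.2 fun j : t => box_mem (hδ j), box_mem one_pos,
    eventually_all.2 fun i => eventually_all.2 fun j : t => blow_inner hq (h i) j,
    eventually_all.2 fun i => (h i).analytic.eventually_analyticAt] with p hpo hpd hbox hpi hFa hp0
  have hpd1 : ∀ j : t, p.1 < δ j := fun j => (le_abs_self _).trans_lt (hpd j).1
  have hpq : 0 < p.1 ^ q := by positivity
  set z := p.2 / p.1 ^ q with hz
  have hzp : p.1 ^ q * z = p.2 := by rw [hz]; field_simp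
  have hW1 : ContDiffAt ℝ 1 W (p.1, z) := ContDiffAt.sum fun j _ => (hD j (p.1, z) hp0 (hpd1 j)).1
  have hW2 : |W (p.1, z)| ≤ SD :=
    (Finset.abs_sum_le_sum_abs _ _).trans (Finset.sum_le_sum fun j _ => (hD j (p.1, z) hp0 (hpd1 j)).2.1)
  have hW3 : |fderiv ℝ W (p.1, z) (0, 1)| ≤ SD := by
    rw [hW, fderiv_fun_sum fun j _ => ((hD j (p.1, z) hp0 (hpd1 j)).1.differentiableAt one_ne_zero), _root_.sum_apply]
    exact (Finset.abs_sum_le_sum_abs _ _).trans (Finset.sum_le_sum fun j _ => (hD j (p.1, z) hp0 (hpd1 j)).2.2)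
  have hp1q : p.1 ^ q ≤ 1 := pow_le_one₀ hp0.le ((le_abs_self _).trans hbox.1.le)
  have hΨ2 : ContDiffAt ℝ 1 (fun p : ℝ × ℝ => (p.1, p.2 / p.1 ^ q)) p :=
    contDiffAt_fst.prodMk (contDiffAt_snd.div (contDiffAt_fst.pow q) hpq.ne')
  have hWΨ : ContDiffAt ℝ 1 (fun p : ℝ × ℝ => W (p.1, p.2 / p.1 ^ q)) p := ContDiffAt.comp (g := W) p hW1 hΨ2
  have hb'1 : ContDiffAt ℝ 1 b' p :=
    (contDiffAt_const.mul contDiffAt_snd).add ((contDiffAt_fst.pow q).mul hWΨ)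
  refine ⟨hb'1, ?_, ?_, fun i => ?_⟩
  · have e1 : |(q:ℝ) * p.2| ≤ q := by
      rw [abs_mul, Nat.abs_cast]
      exact mul_le_of_le_one_right (by positivity) hbox.2.le
    have e2 : |p.1 ^ q * W (p.1, z)| ≤ SD := by
      rw [abs_mul, abs_of_pos hpq]
      calc p.1 ^ q * |W (p.1, z)| ≤ 1 * SD := by gcongr
        _ = SD := one_mul _
    have := abs_add_le ((q:ℝ) * p.2) (p.1 ^ q * W (p.1, z))
    change |(q:ℝ) * p.2 + p.1 ^ q * W (p.1, z)| ≤ _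
    linarith
  · -- derivative in y
    have d1 := hasFDerivAt_dy (hb'1.differentiableAt one_ne_zero)
    have hWd : HasFDerivAt W (fderiv ℝ W (p.1, z)) (p.1, z) := (hW1.differentiableAt one_ne_zero).hasFDerivAt
    have d2 : HasDerivAt (fun y : ℝ => (p.1, y / p.1 ^ q)) ((0:ℝ), 1 / p.1 ^ q) p.2 :=
      (hasDerivAt_const _ _).prodMk ((hasDerivAt_id _).div_const _)
    have d3 : HasDerivAt (fun y : ℝ => W (p.1, y / p.1 ^ q)) (fderiv ℝ W (p.1, z) (0, 1 / p.1 ^ q)) p.2 :=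
      HasFDerivAt.comp_hasDerivAt (l := W) p.2 hWd d2
    have d4 : HasDerivAt (fun y : ℝ => b' (p.1, y)) (q * 1 + p.1 ^ q * (fderiv ℝ W (p.1, z) (0, 1 / p.1 ^ q))) p.2 :=
      HasDerivAt.add ((hasDerivAt_id p.2).const_mul (q:ℝ)) (d3.const_mul (p.1 ^ q))
    have e := d1.unique d4
    rw [dy] at e
    rw [e]
    have e2 : ((0, 1 / p.1 ^ q) : ℝ × ℝ) = (1 / p.1 ^ q) • ((0, 1) : ℝ × ℝ) := by simp
    rw [e2, map_smul, smul_eq_mul, ← mul_assoc, mul_one_div_cancel hpq.ne', one_mul, mul_one]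
    refine (abs_add_le _ _).trans ?_
    rw [Nat.abs_cast]; linarith
  · -- main estimate
    have split : fderiv ℝ (F i) p (p.1, b' p) = (1 - ∑ j, ψ j z) * fderiv ℝ (F i) p (p.1, q * p.2) +
        ∑ j : t, ψ j z * fderiv ℝ (F i) p (p.1, q * p.2 + p.1 ^ q * b j (p.1, z - j)) := by
      have e1 : ∀ j : t, ((p.1, q * p.2 + p.1 ^ q * b j (p.1, z - j)) : ℝ × ℝ) = (p.1, q * p.2) + (p.1 ^ q * b j (p.1, z - j)) • (0, 1) := by
        intro j; simp
      have e2 : ((p.1, b' p) : ℝ × ℝ) = (p.1, q * p.2) + (p.1 ^ q * W (p.1, z)) • (0, 1) := by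
        simp [hb', hz]
      simp only [e1, e2, map_add, map_smul, smul_eq_mul, mul_add, Finset.sum_add_distrib, ← Finset.sum_mul]
      rw [hW]
      simp only [Finset.mul_sum, Finset.sum_mul]
      have e3 : ∀ j : t, p.1 ^ q * (ψ j z * b j (p.1, z - j)) * fderiv ℝ (F i) p (0, 1) = ψ j z * (p.1 ^ q * b j (p.1, z - j) * fderiv ℝ (F i) p (0, 1)) := fun j => by ring
      simp only [e3, sub_mul, one_mul, Finset.sum_mul]; ring
    rw [split]
    have t1 : |(1 - ∑ j, ψ j z) * fderiv ℝ (F i) p (p.1, q * p.2)| ≤ C i * |F i p| := by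
      by_cases hzR : |z| ≤ R0
      · rw [hψR z hzR]; simp; exact mul_nonneg (hC i) (abs_nonneg _)
      · have hR : R i * p.1 ^ q ≤ |p.2| := by
          have : R i ≤ |z| := by
            refine le_trans ?_ (not_le.1 hzR).le
            exact (le_abs_self _).trans (Finset.single_le_sum (f := fun i => |R i|) (fun i _ => abs_nonneg _) (Finset.mem_univ i))
          calc R i * p.1 ^ q ≤ |z| * p.1 ^ q := by gcongr
            _ = |p.2| := by rw [← hzp, abs_mul, abs_of_pos hpq]; ring
        rw [abs_mul]
        have h0 : 0 ≤ ∑ j, ψ j z := Finset.sum_nonneg fun j _ => hψ0 j z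
        have : |1 - ∑ j, ψ j z| ≤ 1 := by
          rw [abs_le]; constructor <;> linarith [hψ1 z]
        calc _ ≤ 1 * (C i * |F i p|) := by
              gcongr; exact hpo i hp0 hR
          _ = _ := one_mul _
    have t2 : ∀ j : t, |ψ j z * fderiv ℝ (F i) p (p.1, q * p.2 + p.1 ^ q * b j (p.1, z - j))| ≤ (q * n i + |Cz j|) * |F i p| := by
      intro j
      by_cases hzs : z ∈ tsupport (ψ j)
      · have hz' := hψs j hzs
        rw [mem_ball, Real.dist_eq] at hz'
        obtain ⟨-, hh⟩ := hb j (p.1, z - j) hp0 (hpd1 j) hz'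
        have := hpi i j (p.1, z - j) hp0 (by simp [hzp]) (hh i).1 _ |Cz j| ((hh i).2.trans (by gcongr; exact le_abs_self _))
        rw [abs_mul, abs_of_nonneg (hψ0 j z)]
        calc _ ≤ 1 * ((q * n i + |Cz j|) * |F i p|) := by
              gcongr; exact hψle j z
          _ = _ := one_mul _
      · rw [image_eq_zero_of_notMem_tsupport hzs]; simp; positivity
    calc _ ≤ C i * |F i p| + ∑ j : t, (q * n i + |Cz j|) * |F i p| :=
          (abs_add_le _ _).trans (add_le_add t1 ((Finset.abs_sum_le_sum_abs _ _).trans (Finset.sum_le_sum fun j _ => t2 j)))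
      _ = (C i + ∑ j : t, (q * n i + |Cz j|)) * |F i p| := by rw [← Finset.sum_mul]; ring
      _ ≤ (q + SD + K) * |F i p| := by
        refine mul_le_mul_of_nonneg_right ?_ (abs_nonneg _)
        have := hKi i
        have : (0:ℝ) ≤ q := by positivity
        linarith

open Polynomial in
lemma Gz_reg {n q : ℕ} {F : ℝ × ℝ → ℝ} {a u} (hq : q ≠ 0) (h : BlowD n F q a u) (z : ℝ) :
    ∃ m ≤ n, (∃ a' u', RegD m (Gz n q a u z) a' u') ∧
      (m = n → ∀ k < n, a k 0 = u 0 * ((-z) ^ (n - k) * (n.choose k : ℝ))) := by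
  classical
  set Q : ℝ[X] := ∑ k ∈ Finset.range n, C (a k 0) * X ^ k + C (u 0) * X ^ n with hQ
  have hcoef : ∀ k < n, Q.coeff k = a k 0 := by
    intro k hk
    simp [hQ, Polynomial.coeff_X_pow, hk, hk.ne]
  have hcoefn : Q.coeff n = u 0 := by
    simp [hQ, Polynomial.coeff_X_pow]
  have hQ0 : Q ≠ 0 := by
    intro h0; rw [h0] at hcoefn; exact h.2.2.1 (by simpa using hcoefn.symm)
  have hdeg : Q.natDegree = n := by
    refine le_antisymm ?_ (le_natDegree_of_ne_zero (by rw [hcoefn]; exact h.2.2.1))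
    refine (natDegree_add_le _ _).trans (max_le ?_ (natDegree_C_mul_X_pow_le _ _))
    refine natDegree_sum_le_of_forall_le _ _ fun k hk => ?_
    exact (natDegree_C_mul_X_pow_le _ _).trans (Finset.mem_range.1 hk).le
  obtain ⟨S, hS, hSd⟩ := exists_eq_pow_rootMultiplicity_mul_and_not_dvd Q hQ0 z
  set m := rootMultiplicity z Q
  have hS0 : S ≠ 0 := by rintro rfl; simp at hSd
  have hmS : n = m + S.natDegree := by
    rw [← hdeg, hS, natDegree_mul (pow_ne_zero _ (X_sub_C_ne_zero z)) hS0, natDegree_pow, natDegree_X_sub_C, mul_one]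
  refine ⟨m, by omega, ?_, ?_⟩
  · refine reg_of_order m _ (fun y => S.eval (z + y)) (Gz_analytic hq h z) ?_ ?_ ?_
    · exact (S.continuous.comp (continuous_const.add continuous_id)).continuousAt
    · simp only [add_zero]
      intro h0; exact hSd (dvd_iff_isRoot.2 h0)
    · refine Eventually.of_forall fun y => ?_
      have : Gz n q a u z (0, y) = Q.eval (z + y) := by
        simp only [Gz, hQ, eval_add, eval_finsetSum, eval_mul, eval_C, eval_pow, eval_X, zero_pow hq, zero_mul]
        congr 1
        exact mul_comm _ _
      rw [this, hS]; simp
  · intro hmn k hk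
    have hSd0 : S.natDegree = 0 := by omega
    obtain ⟨s, hs⟩ := natDegree_eq_zero.1 hSd0
    have e : Q = (X + C (-z)) ^ n * C s := by rw [hS, hs, hmn, C_neg, sub_eq_add_neg]
    have e2 : s = u 0 := by
      rw [← hcoefn, e, coeff_mul_C, coeff_X_add_C_pow]; simp
    rw [← hcoef k hk, e, coeff_mul_C, coeff_X_add_C_pow, e2]; ring

lemma kpat_monomial {ι : Type} [Fintype ι] {F : ι → ℝ × ℝ → ℝ} {n : ι → ℕ} {u : ι → ℝ × ℝ → ℝ}
    (hu : ∀ i, AnalyticAt ℝ (u i) 0) (hu0 : ∀ i, u i 0 ≠ 0)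
    (h : ∀ i, ∀ᶠ p in 𝓝 (0:ℝ×ℝ), F i p = p.2 ^ n i * u i p) : KPat F := by
  rw [kpat_iff]
  choose Cu hCu0 hCu using fun i => fderiv_bound_of_continuousAt (hu i)
  have hlow : ∀ i, ∀ᶠ p in 𝓝 (0:ℝ×ℝ), |u i 0| / 2 < |u i p| := fun i =>
    (hu i).continuousAt.abs.eventually_const_lt (by have := abs_pos.2 (hu0 i); linarith)
  set K := ∑ i, Cu i / (|u i 0| / 2) with hK
  have hKn : ∀ i, 0 ≤ Cu i / (|u i 0| / 2) := fun i => div_nonneg (hCu0 i).le (by positivity)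
  refine ⟨K, fun _ => 0, ?_⟩
  filter_upwards [eventually_all.2 hCu, eventually_all.2 hlow, eventually_all.2 fun i => (h i).eventually_nhds,
    eventually_all.2 fun i => (hu i).eventually_analyticAt, box_mem one_pos] with p h1 h2 h3 h4 h5 hp0
  have hK0 : 0 ≤ K := Finset.sum_nonneg fun i _ => hKn i
  refine ⟨contDiffAt_const, by simpa, by simpa, fun i => ?_⟩
  have h3' : F i =ᶠ[𝓝 p] fun p => p.2 ^ n i * u i p := h3 i
  have hpn : HasFDerivAt (fun p : ℝ × ℝ => p.2 ^ n i) (((n i:ℝ) * p.2 ^ (n i-1)) • ContinuousLinearMap.snd ℝ ℝ ℝ) p :=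
    (hasDerivAt_pow (n i) p.2).comp_hasFDerivAt p hasFDerivAt_snd
  rw [h3'.fderiv_eq, h3'.eq_of_nhds, (hpn.fun_mul (h4 i).differentiableAt.hasFDerivAt).fderiv]
  simp only [_root_.smul_apply, _root_.add_apply, ContinuousLinearMap.coe_snd', smul_eq_mul, mul_zero, add_zero]
  rw [abs_mul, abs_mul]
  have hV : ‖((p.1, 0) : ℝ × ℝ)‖ ≤ 1 := by
    rw [Prod.norm_def]; simp [h5.1.le]
  have e1 : |fderiv ℝ (u i) p (p.1, 0)| ≤ Cu i := by
    refine ((fderiv ℝ (u i) p).le_opNorm _).trans ?_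
    calc _ ≤ Cu i * 1 := mul_le_mul (h1 i) hV (norm_nonneg _) (hCu0 i).le
      _ = _ := mul_one _
  have hup : 0 < |u i 0| / 2 := by have := abs_pos.2 (hu0 i); positivity
  have e2 : Cu i ≤ K * |u i p| := by
    calc Cu i = Cu i / (|u i 0| / 2) * (|u i 0| / 2) := (div_mul_cancel₀ _ hup.ne').symm
      _ ≤ K * |u i p| := by
        refine mul_le_mul ?_ (h2 i).le hup.le hK0
        exact Finset.single_le_sum (f := fun i => Cu i / (|u i 0| / 2)) (fun i _ => hKn i) (Finset.mem_univ i)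
  calc _ ≤ |p.2 ^ n i| * (K * |u i p|) := by gcongr; exact e1.trans e2
    _ = _ := by ring

theorem kpat_main {ι : Type} [Fintype ι] (N : ℕ) : ∀ (F : ι → ℝ × ℝ → ℝ) (n : ι → ℕ),
    (∀ i, AnalyticAt ℝ (F i) 0) → (∀ i, ∃ a u, RegD (n i) (F i) a u) → ∑ i, n i = N → KPat F := by
  classical
  induction N using Nat.strong_induction_on with
  | _ N ih =>
  intro F n hF hR hN
  by_cases hn : ∀ i, n i = 0
  · choose a u hau using hR
    refine kpat_monomial (n := n) (fun i => (hau i).2.2.1) (fun i => (hau i).2.2.2.1) fun i => ?_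
    have := (hau i).2.2.2.2
    simpa [hn i] using this
  push Not at hn
  obtain ⟨i0, hi0⟩ := hn
  obtain ⟨k0, hk0⟩ := Nat.exists_eq_succ_of_ne_zero hi0
  obtain ⟨a0, u0, hau0⟩ := hR i0
  rw [hk0] at hau0
  obtain ⟨c, hc, hc0, htc⟩ := tschirnhaus (hF i0) hau0
  refine kpat_shift hF hc hc0 ?_
  have hF1 : ∀ i, AnalyticAt ℝ (shiftF c (F i)) 0 := fun i => shift_analytic hc hc0 (hF i)
  have hR1 : ∀ i, ∃ a u, RegD (n i) (shiftF c (F i)) a u := by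
    intro i
    obtain ⟨a, u, hau⟩ := hR i
    refine reg_of_order (n i) _ (fun y => u (0, y)) (hF1 i) (analyticAt_slice hau.2.2.1).continuousAt hau.2.2.2.1 ?_
    filter_upwards [hau.slice] with y hy
    simp [shiftF, hc0, hy]
  choose a u hau using hR1
  have hT : ∀ᶠ t in 𝓝 (0:ℝ), a i0 k0 t = 0 := htc _ _ (by have := hau i0; rwa [hk0] at this)
  by_cases hz : ∀ i, ∀ k < n i, ∀ᶠ t in 𝓝 (0:ℝ), a i k t = 0
  · refine kpat_monomial (n := n) (fun i => (hau i).2.2.1) (fun i => (hau i).2.2.2.1) fun i => ?_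
    filter_upwards [(hau i).2.2.2.2, tendsto_fst_zero.eventually ((Filter.eventually_all_finset (Finset.range (n i))).2 fun k hk => hz i k (Finset.mem_range.1 hk))] with p h1 h2
    rw [h1, Finset.sum_eq_zero, zero_add]
    intro k hk
    rw [h2 k hk, zero_mul]
  obtain ⟨iz, kz, hkz, hz⟩ : ∃ i k, k < n i ∧ ¬ ∀ᶠ t in 𝓝 (0:ℝ), a i k t = 0 := by
    by_contra hcon
    exact hz fun i k hk => by by_contra h; exact hcon ⟨i, k, hk, h⟩
  have hord : ∀ i k, (¬ ∀ᶠ t in 𝓝 (0:ℝ), a i k t = 0) → ∃ (e : ℕ) (w : ℝ → ℝ), AnalyticAt ℝ w 0 ∧ w 0 ≠ 0 ∧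
      ∀ᶠ t in 𝓝 (0:ℝ), a i k t = t ^ e * w t := by
    intro i k h
    obtain ⟨e, w, hw, hw0, he⟩ := (AnalyticAt.exists_eventuallyEq_pow_smul_nonzero_iff ((hau i).1 k)).2 h
    exact ⟨e, w, hw, hw0, by simpa using he⟩
  choose! e w hw hw0 hew using hord
  have he1 : ∀ i, ∀ k < n i, (¬ ∀ᶠ t in 𝓝 (0:ℝ), a i k t = 0) → e i k ≠ 0 := by
    intro i k hk h h0
    have := (hew i k h).self_of_nhds
    rw [(hau i).2.1 k hk, h0] at this
    exact hw0 i k h (by simpa using this.symm)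
  set S : Finset (Σ i, Fin (n i)) := Finset.univ.filter fun s => ¬ ∀ᶠ t in 𝓝 (0:ℝ), a s.1 s.2 t = 0 with hS
  have hSne : S.Nonempty := ⟨⟨iz, ⟨kz, hkz⟩⟩, by simp only [hS, Finset.mem_filter, Finset.mem_univ, true_and]; exact hz⟩
  obtain ⟨⟨i1, k1⟩, hs1, hmin⟩ := S.exists_min_image (fun s => (e s.1 s.2 : ℚ) / ((n s.1 - s.2 : ℕ) : ℚ)) hSne
  have hs1' : ¬ ∀ᶠ t in 𝓝 (0:ℝ), a i1 k1 t = 0 := (Finset.mem_filter.1 hs1).2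
  set M := n i1 - k1 with hM
  have hM0 : M ≠ 0 := by have := k1.2; omega
  set q := e i1 k1 with hq
  have hq0 : q ≠ 0 := he1 i1 k1 k1.2 hs1'
  have hle : ∀ i, ∀ k < n i, (¬ ∀ᶠ t in 𝓝 (0:ℝ), a i k t = 0) → q * (n i - k) ≤ M * e i k := by
    intro i k hk h
    have := hmin ⟨i, ⟨k, hk⟩⟩ (by simp only [hS, Finset.mem_filter, Finset.mem_univ, true_and]; exact h)
    simp only at this
    have hA : (0:ℚ) < ((n i1 - k1 : ℕ) : ℚ) := by exact_mod_cast Nat.pos_of_ne_zero hM0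
    have hB : (0:ℚ) < ((n i - k : ℕ) : ℚ) := by exact_mod_cast (by omega : 0 < n i - k)
    rw [div_le_div_iff₀ hA hB] at this
    have h2 : q * (n i - k) ≤ e i k * M := by exact_mod_cast this
    linarith
  refine kpat_pow hM0 hF1 ?_
  set a' : ι → ℕ → ℝ → ℝ := fun i k => if k < n i ∧ ¬ ∀ᶠ t in 𝓝 (0:ℝ), a i k t = 0 then
    fun t => t ^ (M * e i k - q * (n i - k)) * w i k (t ^ M) else fun _ => 0 with ha'
  have htM : Tendsto (fun t : ℝ => t ^ M) (𝓝 0) (𝓝 0) :=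
    (continuous_pow M).tendsto' _ _ (by simp [hM0])
  have htM2 : Tendsto (fun p : ℝ × ℝ => (p.1 ^ M, p.2)) (𝓝 0) (𝓝 0) := by
    have : Continuous (fun p : ℝ × ℝ => (p.1 ^ M, p.2)) := by fun_prop
    exact this.tendsto' _ _ (by simp [hM0])
  have hcompM : ∀ {g : ℝ → ℝ}, AnalyticAt ℝ g 0 → AnalyticAt ℝ (fun t => g (t ^ M)) 0 := by
    intro g hg
    have h0 : (0:ℝ) = (0:ℝ) ^ M := by simp [hM0]
    exact AnalyticAt.comp (g := g) (f := fun t : ℝ => t ^ M) (h0 ▸ hg) (analyticAt_id.pow M)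
  have hcompM2 : ∀ {g : ℝ × ℝ → ℝ}, AnalyticAt ℝ g 0 → AnalyticAt ℝ (fun p : ℝ × ℝ => g (p.1 ^ M, p.2)) 0 := by
    intro g hg
    have h0 : (0:ℝ×ℝ) = ((0:ℝ×ℝ).1 ^ M, (0:ℝ×ℝ).2) := by simp [hM0]; rfl
    exact AnalyticAt.comp (g := g) (f := fun p : ℝ × ℝ => (p.1 ^ M, p.2)) (h0 ▸ hg) ((analyticAt_fst.pow M).prod analyticAt_snd)
  have hBl : ∀ i, BlowD (n i) (fun p => shiftF c (F i) (p.1 ^ M, p.2)) q (a' i) (fun p => u i (p.1 ^ M, p.2)) := by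
    intro i
    refine ⟨fun k => ?_, hcompM2 (hau i).2.2.1, ?_, ?_⟩
    · simp only [ha']
      split_ifs with h
      · exact (analyticAt_id.pow _).mul (hcompM (hw i k h.2))
      · exact analyticAt_const
    · have := (hau i).2.2.2.1
      simp only [Prod.fst_zero, Prod.snd_zero, zero_pow hM0]
      exact this
    · have hk : ∀ k ∈ Finset.range (n i), ∀ᶠ t in 𝓝 (0:ℝ), a i k (t ^ M) = t ^ (q * (n i - k)) * a' i k t := by
        intro k hk
        have hk := Finset.mem_range.1 hk
        by_cases h : ∀ᶠ t in 𝓝 (0:ℝ), a i k t = 0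
        · filter_upwards [htM.eventually h] with t ht
          have e' : a' i k = fun _ => 0 := if_neg fun hh => hh.2 h
          rw [ht, e', mul_zero]
        · filter_upwards [htM.eventually (hew i k h)] with t ht
          rw [ht]
          have e' : a' i k = fun t => t ^ (M * e i k - q * (n i - k)) * w i k (t ^ M) := if_pos ⟨hk, h⟩
          rw [e', ← mul_assoc, ← pow_add, ← pow_mul]
          congr 2
          have := hle i k hk h
          omega
      filter_upwards [htM2.eventually (hau i).2.2.2.2, tendsto_fst_zero.eventually ((Filter.eventually_all_finset (Finset.range (n i))).2 hk)] with p h1 h2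
      rw [h1]
      congr 1
      refine Finset.sum_congr rfl fun k hk => ?_
      rw [h2 k hk]
  refine kpat_blowup hq0 hBl fun z => ?_
  choose m hmn hmR hme using fun i => Gz_reg hq0 (hBl i) z
  refine ih (∑ i, m i) ?_ _ m (fun i => Gz_analytic hq0 (hBl i) z) hmR rfl
  rw [← hN]
  refine lt_of_le_of_ne (Finset.sum_le_sum fun i _ => hmn i) fun heq => ?_
  have hall := (Finset.sum_eq_sum_iff_of_le fun i _ => hmn i).1 heq
  have hu0 : ∀ i, u i ((0:ℝ×ℝ).1 ^ M, (0:ℝ×ℝ).2) ≠ 0 := fun i => (hBl i).2.2.1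
  have hz0 : z = 0 := by
    have := hme i0 (hall i0 (Finset.mem_univ _)) k0 (by omega)
    have e0 : a' i0 k0 0 = 0 := by
      have e' : a' i0 k0 = fun _ => 0 := if_neg fun hh => hh.2 hT
      rw [e']
    rw [e0, hk0] at this
    have h2 := (mul_eq_zero.1 this.symm).resolve_left (hu0 i0)
    simp at h2
    exact h2.resolve_right (by positivity)
  have := hme i1 (hall i1 (Finset.mem_univ _)) k1 k1.2
  rw [hz0, neg_zero, zero_pow hM0, zero_mul, mul_zero] at this
  have e' : a' i1 k1 = fun t => t ^ (M * e i1 k1 - q * (n i1 - k1)) * w i1 k1 (t ^ M) := if_pos ⟨k1.2, hs1'⟩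
  rw [e'] at this
  simp only at this
  rw [← hM, ← hq, mul_comm M q, Nat.sub_self, pow_zero, one_mul, zero_pow hM0] at this
  exact hw0 i1 k1 hs1' this

lemma pow_decomp (N : ℕ) (hN : 0 < N) (g : ℝ → ℝ) (hg : AnalyticAt ℝ g 0) :
    ∃ G : Fin N → ℝ → ℝ, (∀ j, AnalyticAt ℝ (G j) 0) ∧
      ∀ᶠ t in 𝓝 (0:ℝ), g t = ∑ j : Fin N, t ^ (j:ℕ) * G j (t ^ N) := by
  obtain ⟨p, R, hp⟩ := hg
  set a : ℕ → ℝ := p.coeff with ha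
  obtain ⟨ρ, hρ0, hρ⟩ : ∃ ρ : NNReal, 0 < ρ ∧ (ρ : ℝ≥0∞) < R := by
    obtain ⟨ρ, h1, h2⟩ := ENNReal.lt_iff_exists_nnreal_btwn.1 hp.r_pos
    exact ⟨ρ, by exact_mod_cast h1, h2⟩
  obtain ⟨C, hC0, hC⟩ := p.norm_mul_pow_le_of_lt_radius (hρ.trans_le hp.r_le)
  have hCa : ∀ n, |a n| * (ρ:ℝ) ^ n ≤ C := by
    intro n
    have := hC n
    rwa [FormalMultilinearSeries.norm_apply_eq_norm_coef] at this
  set q : Fin N → FormalMultilinearSeries ℝ ℝ ℝ := fun j => FormalMultilinearSeries.ofScalars ℝ fun m => a (j + N * m) with hq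
  have hrad : ∀ j, ((ρ ^ N : NNReal) : ℝ≥0∞) ≤ (q j).radius := by
    intro j
    refine FormalMultilinearSeries.le_radius_of_bound _ (C / (ρ:ℝ) ^ (j:ℕ)) fun m => ?_
    rw [FormalMultilinearSeries.norm_apply_eq_norm_coef]
    have : (q j).coeff m = a (j + N * m) := by simp [hq]
    rw [this, le_div_iff₀ (by positivity)]
    have := hCa (j + N * m)
    rw [pow_add, pow_mul] at this
    push_cast
    calc _ = |a (j + N * m)| * ((ρ:ℝ) ^ (j:ℕ) * ((ρ:ℝ) ^ N) ^ m) := by rw [Real.norm_eq_abs]; ring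
      _ ≤ _ := this
  have hpos : ∀ j, 0 < (q j).radius := fun j =>
    lt_of_lt_of_le (by exact_mod_cast pow_pos hρ0 N) (hrad j)
  refine ⟨fun j => (q j).sum, fun j => ((q j).hasFPowerSeriesOnBall (hpos j)).analyticAt, ?_⟩
  have hev : ∀ᶠ t in 𝓝 (0:ℝ), |t| < (ρ:ℝ) := by
    have : Tendsto (fun t : ℝ => |t|) (𝓝 0) (𝓝 0) := by simpa using (continuous_abs.tendsto (0:ℝ))
    exact this.eventually_lt_const hρ0
  filter_upwards [hev] with t ht
  have h1 : HasSum (fun n => a n * t ^ n) (g t) := by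
    have := hp.hasSum (y := t) (by
      rw [Metric.mem_eball, edist_zero_right]
      refine lt_trans ?_ hρ
      rw [← ofReal_norm, ← ENNReal.ofReal_coe_nnreal]
      exact (ENNReal.ofReal_lt_ofReal_iff hρ0).2 ht)
    simpa [FormalMultilinearSeries.apply_eq_pow_smul_coeff, mul_comm, ha] using this
  have h2 : ∀ j : Fin N, HasSum (fun m => a (j + N * m) * (t ^ N) ^ m) ((q j).sum (t ^ N)) := by
    intro j
    have := ((q j).hasFPowerSeriesOnBall (hpos j)).hasSum (y := t ^ N) (by
      rw [Metric.mem_eball, edist_zero_right]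
      refine lt_of_lt_of_le ?_ (hrad j)
      rw [← ofReal_norm, ← ENNReal.ofReal_coe_nnreal]
      refine (ENNReal.ofReal_lt_ofReal_iff (by exact_mod_cast pow_pos hρ0 N)).2 ?_
      rw [norm_pow]; push_cast
      exact pow_lt_pow_left₀ ht (abs_nonneg _) hN.ne')
    simpa [FormalMultilinearSeries.apply_eq_pow_smul_coeff, mul_comm, hq] using this
  have : NeZero N := ⟨hN.ne'⟩
  rw [← h1.tsum_eq, Nat.sumByResidueClasses h1.summable N]
  obtain ⟨k, rfl⟩ := Nat.exists_eq_succ_of_ne_zero hN.ne'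
  change ∑ j : Fin (k+1), _ = _
  refine Finset.sum_congr rfl fun j _ => ?_
  rw [← (h2 j).tsum_eq, ← tsum_mul_left]
  refine tsum_congr fun m => ?_
  change a ((j:ℕ) + _) * t ^ ((j:ℕ) + _) = _
  rw [pow_add, pow_mul]; ring

lemma norm_curve (N : ℕ) (hN : 0 < N) (σ : ℝ) (hσ : σ = 1 ∨ σ = -1) (h : ℝ → ℝ) (hh : AnalyticAt ℝ h 0) :
    ∃ F : ℝ × ℝ → ℝ, AnalyticAt ℝ F 0 ∧ (¬ ∀ᶠ p in 𝓝 (0:ℝ×ℝ), F p = 0) ∧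
      ∀ᶠ t in 𝓝 (0:ℝ), F (σ * t ^ N, h t) = 0 := by
  have hσ2 : σ * σ = 1 := by rcases hσ with rfl | rfl <;> norm_num
  choose M hM hMe using fun i : Fin N => pow_decomp N hN (fun t => t ^ (i:ℕ) * h t) ((analyticAt_id.pow _).mul hh)
  set Mx : ℝ → Matrix (Fin N) (Fin N) ℝ := fun x => Matrix.of fun i k => M i k x with hMx
  refine ⟨fun p => (Matrix.scalar (Fin N) p.2 - Mx (σ * p.1)).det, ?_, ?_, ?_⟩
  · simp only [Matrix.det_apply]
    refine Finset.analyticAt_fun_sum _ fun τ _ => ?_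
    have : AnalyticAt ℝ (fun p : ℝ × ℝ => ∏ i, (Matrix.scalar (Fin N) p.2 - Mx (σ * p.1)) (τ i) i) 0 := by
      refine Finset.analyticAt_fun_prod _ fun i _ => ?_
      have h1 : AnalyticAt ℝ (fun p : ℝ × ℝ => M (τ i) i (σ * p.1)) 0 :=
        AnalyticAt.fun_comp (by simpa using hM (τ i) i) (analyticAt_const.mul analyticAt_fst)
      simp only [Matrix.sub_apply, hMx, Matrix.of_apply]
      refine AnalyticAt.sub ?_ h1
      by_cases he : τ i = i
      · simp only [he, Matrix.scalar_apply, Matrix.diagonal_apply_eq]; exact analyticAt_snd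
      · simp only [Matrix.scalar_apply, Matrix.diagonal_apply_ne _ he]; exact analyticAt_const
    rcases Int.units_eq_one_or (Equiv.Perm.sign τ) with hs | hs
    · simpa [hs] using this
    · have h2 := this.fun_neg
      simpa [hs] using h2
  · intro hev
    have h1 := tendsto_mk_zero_left.eventually hev
    have h2 : ∀ᶠ y in 𝓝 (0:ℝ), (Mx 0).charpoly.IsRoot y := by
      filter_upwards [h1] with y hy
      rw [Polynomial.IsRoot, Matrix.eval_charpoly]
      simpa using hy
    have h3 := Polynomial.eq_zero_of_infinite_isRoot _ (infinite_of_mem_nhds (0:ℝ) h2)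
    exact (Matrix.charpoly_monic (Mx 0)).ne_zero h3
  · filter_upwards [eventually_all.2 hMe] with t ht
    rw [← mul_assoc, hσ2, one_mul]
    refine Matrix.exists_mulVec_eq_zero_iff.1 ⟨fun k => t ^ (k:ℕ), ?_, ?_⟩
    · intro h0
      have := congrFun h0 ⟨0, hN⟩
      simp at this
    · ext i
      rw [Matrix.sub_mulVec]
      have e1 : (Matrix.scalar (Fin N) (h t)).mulVec (fun k : Fin N => t ^ (k:ℕ)) i = h t * t ^ (i:ℕ) := by
        simp [Matrix.mulVec_diagonal]
      have e2 : (Mx (t ^ N)).mulVec (fun k : Fin N => t ^ (k:ℕ)) i = t ^ (i:ℕ) * h t := by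
        rw [ht i]; simp [Matrix.mulVec, dotProduct, hMx, mul_comm]
      simp only [Pi.sub_apply, e1, e2, Pi.zero_apply]; ring

lemma curve_cover {r₀ : ℝ} (hr : 0 < r₀) {C : Set (ℝ × ℝ)} (hC : IsPuiseuxBdryCurve r₀ C) :
    ∃ F : ℝ × ℝ → ℝ, AnalyticAt ℝ F 0 ∧ (¬ ∀ᶠ p in 𝓝 (0:ℝ×ℝ), F p = 0) ∧
      ∀ᶠ p in 𝓝 (0:ℝ×ℝ), p ∈ C → F p = 0 := by
  obtain ⟨N, h, I, σ, hN, hσ, hI, hsub, han, h0, hC, -, -⟩ := hC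
  obtain ⟨F, hF, hF0, hFe⟩ := norm_curve N hN σ hσ h (han 0 (hsub ⟨le_rfl, by positivity⟩))
  have hNne : ((N:ℝ)⁻¹) ≠ 0 := by positivity
  have ht : Tendsto (fun x : ℝ => |x| ^ ((N:ℝ)⁻¹)) (𝓝 0) (𝓝 0) := by
    have : Continuous (fun x : ℝ => |x| ^ ((N:ℝ)⁻¹)) :=
      continuous_abs.rpow_const fun x => Or.inr (by positivity)
    exact this.tendsto' _ _ (by simp [Real.zero_rpow hNne])
  have key : ∀ x : ℝ, 0 ≤ σ * x → σ * (|x| ^ ((N:ℝ)⁻¹)) ^ N = x := by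
    intro x hx
    rw [Real.rpow_inv_natCast_pow (abs_nonneg _) hN.ne']
    rcases hσ with rfl | rfl
    · rw [abs_of_nonneg (by linarith)]; ring
    · rw [abs_of_nonpos (by linarith)]; ring
  rcases hC with rfl | rfl
  · refine ⟨F, hF, hF0, ?_⟩
    filter_upwards [(ht.comp tendsto_fst_zero).eventually hFe] with p hp hpC
    obtain ⟨-, h1, h2⟩ := hpC
    simp only [Function.comp] at hp
    rwa [key _ h1, ← h2] at hp
  · have hsw : Tendsto (Prod.swap : ℝ × ℝ → ℝ × ℝ) (𝓝 0) (𝓝 0) := continuous_swap.tendsto' _ _ rfl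
    refine ⟨fun p => F p.swap, ?_, ?_, ?_⟩
    · exact AnalyticAt.fun_comp (g := F) (f := fun p : ℝ × ℝ => p.swap) hF (analyticAt_snd.prod analyticAt_fst)
    · intro h
      apply hF0
      filter_upwards [hsw.eventually h] with p hp
      simpa using hp
    · filter_upwards [((ht.comp tendsto_fst_zero).comp hsw).eventually hFe] with p hp hpC
      obtain ⟨-, h1, h2⟩ := hpC
      simp only [Function.comp, Prod.fst_swap] at hp
      rwa [key _ h1, ← h2] at hp

lemma not_circle_nhds {r₀ : ℝ} (hr : 0 < r₀) : ∀ᶠ p in 𝓝 (0:ℝ×ℝ), p ∉ circle2 r₀ := by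
  have hc : Continuous (fun p : ℝ × ℝ => p.1 ^ 2 + p.2 ^ 2) := by fun_prop
  have := hc.tendsto' 0 0 (by simp)
  filter_upwards [this.eventually_lt_const (show (0:ℝ) < r₀ ^ 2 by positivity)] with p hp h
  exact hp.ne h

lemma frontier_cover {E : Set (ℝ × ℝ)} (hE : IsStdDomain E) :
    ∃ (ι : Type) (_ : Fintype ι) (F : ι → ℝ × ℝ → ℝ), (∀ j, AnalyticAt ℝ (F j) 0) ∧
      (∀ j, ¬ ∀ᶠ p in 𝓝 (0:ℝ×ℝ), F j p = 0) ∧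
      ∀ᶠ p in 𝓝 (0:ℝ×ℝ), p ∈ frontier E → ∃ j, F j p = 0 := by
  rcases hE with ⟨r₀, hr, rfl⟩ | ⟨r₀, hr, m, Es, Cs, rfl, -, hEs, hCs, -⟩
  · refine ⟨Empty, inferInstance, fun e => e.elim, fun e => e.elim, fun e => e.elim, ?_⟩
    filter_upwards [not_circle_nhds hr] with p hp hpf
    exfalso
    apply hp
    have hc : Continuous (fun p : ℝ × ℝ => p.1 ^ 2 + p.2 ^ 2) := by fun_prop
    exact frontier_lt_subset_eq hc continuous_const hpf
  · choose F h1 h2 h3 using fun q : Fin m × Fin 2 => curve_cover hr (hCs q.1 q.2)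
    refine ⟨Fin m × Fin 2, inferInstance, F, h1, h2, ?_⟩
    filter_upwards [not_circle_nhds hr, eventually_all.2 h3] with p hp h3 hpf
    have ho : IsOpen (⋃ i, Es i) := isOpen_iUnion fun i => (hEs i).1
    rw [ho.frontier_eq, closure_iUnion_of_finite] at hpf
    obtain ⟨hpc, hpn⟩ := hpf
    obtain ⟨i, hi⟩ := mem_iUnion.1 hpc
    have : p ∈ frontier (Es i) := by
      rw [(hEs i).1.frontier_eq]; exact ⟨hi, fun h => hpn (mem_iUnion.2 ⟨i, h⟩)⟩
    rcases (hEs i).2.2.2 this with (h | h) | h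
    · exact ⟨(i, 0), h3 (i, 0) h⟩
    · exact ⟨(i, 1), h3 (i, 1) h⟩
    · exact absurd h hp

lemma tendsto_swap_zero : Tendsto (Prod.swap : ℝ × ℝ → ℝ × ℝ) (𝓝 0) (𝓝 0) := continuous_swap.tendsto' _ _ rfl

lemma analyticAt_swap {F : ℝ × ℝ → ℝ} (hF : AnalyticAt ℝ F 0) : AnalyticAt ℝ (fun p : ℝ × ℝ => F p.swap) 0 :=
  AnalyticAt.fun_comp (g := F) (f := fun p : ℝ × ℝ => p.swap) hF (analyticAt_snd.prod analyticAt_fst)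

lemma division_x (F : ℝ × ℝ → ℝ) (hF : AnalyticAt ℝ F 0) (h0 : ∀ᶠ y in 𝓝 (0:ℝ), F (0, y) = 0) :
    ∃ F1 : ℝ × ℝ → ℝ, AnalyticAt ℝ F1 0 ∧ ∀ᶠ p in 𝓝 (0:ℝ×ℝ), F p = p.1 * F1 p := by
  obtain ⟨F1, h1, h2⟩ := analytic_division _ (analyticAt_swap hF)
  refine ⟨fun p => F1 p.swap, analyticAt_swap h1, ?_⟩
  filter_upwards [tendsto_swap_zero.eventually h2, (tendsto_fst_zero.comp tendsto_swap_zero).eventually h0] with p hp hp0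
  simp only [Function.comp, Prod.fst_swap] at hp0
  simpa [hp0] using hp

lemma exists_line (F : ℝ × ℝ → ℝ) (hF : AnalyticAt ℝ F 0) (hn : ¬ ∀ᶠ p in 𝓝 (0:ℝ×ℝ), F p = 0) :
    ∃ w : ℝ × ℝ, AnalyticAt ℝ (fun s : ℝ => F (s • w)) 0 ∧ ¬ ∀ᶠ s in 𝓝 (0:ℝ), F (s • w) = 0 := by
  obtain ⟨δ, hδ, hb⟩ := Metric.eventually_nhds_iff_ball.1 hF.eventually_analyticAt
  have hfr : ∃ᶠ p in 𝓝 (0:ℝ×ℝ), F p ≠ 0 := not_eventually.1 hn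
  obtain ⟨w, hw, hwb⟩ := (hfr.and_eventually (ball_mem_nhds 0 hδ)).exists
  have hlin : ∀ s : ℝ, AnalyticAt ℝ (fun s : ℝ => s • w) s := fun s => analyticAt_id.smul analyticAt_const
  have han : AnalyticOnNhd ℝ (fun s : ℝ => F (s • w)) {s : ℝ | s • w ∈ ball (0:ℝ×ℝ) δ} := fun s hs =>
    AnalyticAt.fun_comp (g := F) (f := fun s : ℝ => s • w) (hb _ hs) (hlin s)
  have hconv : Convex ℝ {s : ℝ | s • w ∈ ball (0:ℝ×ℝ) δ} :=
    (convex_ball (0:ℝ×ℝ) δ).linear_preimage (LinearMap.toSpanSingleton ℝ (ℝ × ℝ) w)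
  have h0 : (0:ℝ) ∈ {s : ℝ | s • w ∈ ball (0:ℝ×ℝ) δ} := by simp [hδ]
  refine ⟨w, han 0 h0, fun hev => hw ?_⟩
  have := han.eqOn_zero_of_preconnected_of_eventuallyEq_zero hconv.isPreconnected h0 hev
    (show (1:ℝ) ∈ {s : ℝ | s • w ∈ ball (0:ℝ×ℝ) δ} by simpa using hwb)
  simpa using this

lemma x_factor_aux (w : ℝ × ℝ) (m : ℕ) : ∀ (F : ℝ × ℝ → ℝ) (G : ℝ → ℝ), AnalyticAt ℝ F 0 → ContinuousAt G 0 → G 0 ≠ 0 →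
    (∀ᶠ s in 𝓝[≠] (0:ℝ), F (s • w) = s ^ m * G s) →
    ∃ (k : ℕ) (F1 : ℝ × ℝ → ℝ), AnalyticAt ℝ F1 0 ∧ (¬ ∀ᶠ y in 𝓝 (0:ℝ), F1 (0, y) = 0) ∧
      ∀ᶠ p in 𝓝 (0:ℝ×ℝ), F p = p.1 ^ k * F1 p := by
  have hsw : Tendsto (fun s : ℝ => s • w) (𝓝 0) (𝓝 0) := by
    have : Continuous (fun s : ℝ => s • w) := by fun_prop
    exact this.tendsto' _ _ (by simp)
  induction m with
  | zero =>
    intro F G hF hG hG0 h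
    refine ⟨0, F, hF, fun hev => hG0 ?_, by simp⟩
    have hF0 : F 0 = 0 := hev.self_of_nhds
    have h1 : Tendsto (fun s : ℝ => F (s • w)) (𝓝[≠] 0) (𝓝 0) := by
      have : Tendsto F (𝓝 0) (𝓝 0) := by simpa [hF0] using hF.continuousAt.tendsto
      exact (this.comp hsw).mono_left nhdsWithin_le_nhds
    have h2 : Tendsto (fun s : ℝ => F (s • w)) (𝓝[≠] 0) (𝓝 (G 0)) := by
      refine (hG.tendsto.mono_left nhdsWithin_le_nhds).congr' ?_
      filter_upwards [h] with s hs
      simpa using hs.symm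
    exact tendsto_nhds_unique h2 h1
  | succ m ih =>
    intro F G hF hG hG0 h
    by_cases hev : ∀ᶠ y in 𝓝 (0:ℝ), F (0, y) = 0
    · obtain ⟨F1, hF1, he⟩ := division_x F hF hev
      have hes : ∀ᶠ s in 𝓝[≠] (0:ℝ), F (s • w) = s * w.1 * F1 (s • w) := by
        filter_upwards [(hsw.eventually he).filter_mono nhdsWithin_le_nhds] with s hs
        simpa using hs
      have hGn : ∀ᶠ s in 𝓝[≠] (0:ℝ), G s ≠ 0 := (hG.eventually_ne hG0).filter_mono nhdsWithin_le_nhds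
      have hw1 : w.1 ≠ 0 := by
        intro hw1
        obtain ⟨s, h1, h2, h3, h4⟩ := (h.and (hes.and (hGn.and self_mem_nhdsWithin))).exists
        rw [h1, hw1, mul_zero, zero_mul] at h2
        exact (mul_ne_zero (pow_ne_zero _ h4) h3) h2
      obtain ⟨k, F2, h2, h3, h4⟩ := ih F1 (fun s => G s / w.1) hF1 (hG.div_const _) (div_ne_zero hG0 hw1) (by
        filter_upwards [h, hes, self_mem_nhdsWithin] with s h1 h2 h3
        have h3 : s ≠ 0 := h3
        rw [h1] at h2
        field_simp
        have : s * (s ^ m * G s) = s * (w.1 * F1 (s • w)) := by rw [← mul_assoc s w.1, ← h2]; ring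
        rw [mul_left_cancel₀ h3 this]; ring)
      refine ⟨k + 1, F2, h2, h3, ?_⟩
      filter_upwards [he, h4] with p h5 h6
      rw [h5, h6]; ring
    · exact ⟨0, F, hF, hev, by simp⟩

lemma x_factor (F : ℝ × ℝ → ℝ) (hF : AnalyticAt ℝ F 0) (hn : ¬ ∀ᶠ p in 𝓝 (0:ℝ×ℝ), F p = 0) :
    ∃ (k : ℕ) (F1 : ℝ × ℝ → ℝ), AnalyticAt ℝ F1 0 ∧ (¬ ∀ᶠ y in 𝓝 (0:ℝ), F1 (0, y) = 0) ∧
      ∀ᶠ p in 𝓝 (0:ℝ×ℝ), F p = p.1 ^ k * F1 p := by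
  obtain ⟨w, h1, h2⟩ := exists_line F hF hn
  obtain ⟨m, G, hG, hG0, he⟩ := (AnalyticAt.exists_eventuallyEq_pow_smul_nonzero_iff h1).2 h2
  exact x_factor_aux w m F G hF hG.continuousAt hG0
    ((by simpa using he : ∀ᶠ s in 𝓝 (0:ℝ), F (s • w) = s ^ m * G s).filter_mono nhdsWithin_le_nhds)

lemma null_zero (F : ℝ × ℝ → ℝ) (hF : AnalyticAt ℝ F 0) (hn : ¬ ∀ᶠ p in 𝓝 (0:ℝ×ℝ), F p = 0) :
    ∃ δ > (0:ℝ), volume {p : ℝ × ℝ | |p.1| < δ ∧ |p.2| < δ ∧ F p = 0} = 0 := by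
  obtain ⟨k, F1, h1, h2, h3⟩ := x_factor F hF hn
  obtain ⟨δ, hδ, hb⟩ := exists_box (h1.eventually_analyticAt.and h3)
  have hfr : ∃ᶠ y in 𝓝 (0:ℝ), F1 (0, y) ≠ 0 := not_eventually.1 h2
  have hyev : ∀ᶠ y in 𝓝 (0:ℝ), |y| < δ := by
    have : Tendsto (fun t : ℝ => |t|) (𝓝 0) (𝓝 0) := by simpa using (continuous_abs.tendsto (0:ℝ))
    exact this.eventually_lt_const hδ
  obtain ⟨y0, hy0, hy0δ⟩ := (hfr.and_eventually hyev).exists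
  have hcx : ∀ᶠ x in 𝓝 (0:ℝ), F1 (x, y0) ≠ 0 := by
    have hc : ContinuousAt F1 (0, y0) := (hb (0, y0) (by simpa) hy0δ).1.continuousAt
    have : Tendsto (fun x : ℝ => (x, y0)) (𝓝 0) (𝓝 (0, y0)) := by
      have : Continuous (fun x : ℝ => (x, y0)) := by fun_prop
      exact this.tendsto' _ _ rfl
    exact (this.eventually (hc.eventually_ne hy0))
  obtain ⟨δ', hδ', hb'⟩ := Metric.eventually_nhds_iff.1 hcx
  set B : Set (ℝ × ℝ) := {p | |p.1| < min δ δ' ∧ |p.2| < min δ δ'} with hB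
  refine ⟨min δ δ', lt_min hδ hδ', ?_⟩
  have hBo : IsOpen B := by
    rw [hB, ofPred_and]
    exact (isOpen_lt (by fun_prop) (by fun_prop)).inter (isOpen_lt (by fun_prop) (by fun_prop))
  have hcont : ContinuousOn F1 B := fun p hp => by
    refine (hb p ?_ ?_).1.continuousAt.continuousWithinAt
    · exact hp.1.trans_le (min_le_left _ _)
    · exact hp.2.trans_le (min_le_left _ _)
  set Z : Set (ℝ × ℝ) := B \ (B ∩ F1 ⁻¹' {0}ᶜ) with hZ
  have hZm : MeasurableSet Z := hBo.measurableSet.diff (hcont.isOpen_inter_preimage hBo isOpen_compl_singleton).measurableSet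
  have hZ0 : volume Z = 0 := by
    rw [Measure.volume_eq_prod, Measure.measure_prod_null hZm]
    refine Eventually.of_forall fun x => ?_
    by_cases hx : |x| < min δ δ'
    · have han : AnalyticOnNhd ℝ (fun y => F1 (x, y)) (ball (0:ℝ) δ) := by
        intro y hy
        have hy' : |y| < δ := by simpa using hy
        exact AnalyticAt.fun_comp (g := F1) (f := fun y => (x, y)) (hb (x, y) (hx.trans_le (min_le_left _ _)) hy').1 (analyticAt_const.prod analyticAt_id)
      rcases han.eqOn_zero_or_eventually_ne_zero_of_preconnected (convex_ball _ _).isPreconnected with h | h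
      · exfalso
        exact hb' (y := x) (by rw [dist_zero_right]; exact hx.trans_le (min_le_right _ _)) (h (show y0 ∈ ball (0:ℝ) δ by simpa using hy0δ))
      · have h4 := ae_restrict_le_codiscreteWithin (μ := volume) measurableSet_ball h
        rw [mem_ae_iff, Measure.restrict_apply' measurableSet_ball] at h4
        refine measure_mono_null ?_ h4
        intro y hy
        have hyB : (x, y) ∈ B := hy.1
        refine ⟨fun hne => hy.2 ⟨hyB, hne⟩, ?_⟩
        simpa using hyB.2.trans_le (min_le_left _ _)
    · refine measure_mono_null (t := ∅) ?_ measure_empty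
      intro y hy
      exact hx hy.1.1
  have hX0 : volume ({p : ℝ × ℝ | p.1 = 0}) = 0 := by
    have : {p : ℝ × ℝ | p.1 = 0} = ({0} : Set ℝ) ×ˢ univ := by ext; simp
    rw [this, Measure.volume_eq_prod, Measure.prod_prod]; simp
  refine measure_mono_null (t := Z ∪ {p : ℝ × ℝ | p.1 = 0}) ?_ (measure_union_null hZ0 hX0)
  rintro p ⟨hp1, hp2, hp3⟩
  rw [(hb p (hp1.trans_le (min_le_left _ _)) (hp2.trans_le (min_le_left _ _))).2] at hp3
  rcases mul_eq_zero.1 hp3 with h | h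
  · right; by_contra hne; exact pow_ne_zero _ hne h
  · left; exact ⟨⟨hp1, hp2⟩, fun h' => h'.2 h⟩

lemma reg_of_slice {F : ℝ × ℝ → ℝ} (hF : AnalyticAt ℝ F 0) (hn : ¬ ∀ᶠ y in 𝓝 (0:ℝ), F (0, y) = 0) :
    ∃ n a u, RegD n F a u := by
  obtain ⟨m, G, hG, hG0, he⟩ := (AnalyticAt.exists_eventuallyEq_pow_smul_nonzero_iff (analyticAt_slice hF)).2 hn
  obtain ⟨a, u, h⟩ := reg_of_order m F G hF hG.continuousAt hG0 (by simpa using he)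
  exact ⟨m, a, u, h⟩

lemma vf0 {J : Type} [Fintype J] (Φ : J → ℝ × ℝ → ℝ) (hΦ : ∀ j, AnalyticAt ℝ (Φ j) 0)
    (hn : ∀ j, ¬ ∀ᶠ p in 𝓝 (0:ℝ×ℝ), Φ j p = 0) :
    ∃ C > (0:ℝ), ∃ b : ℝ × ℝ → ℝ, ∀ᶠ p in 𝓝 (0:ℝ×ℝ), 0 < p.1 → ContDiffAt ℝ 1 b p ∧ |b p| ≤ C * |p.2| ∧
      |fderiv ℝ b p (0, 1)| ≤ C ∧ ∀ j, |fderiv ℝ (Φ j) p (p.1, b p)| ≤ C * |Φ j p| := by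
  choose k F1 h1 h2 h3 using fun j => x_factor (Φ j) (hΦ j) (hn j)
  set Ψ : Option J → ℝ × ℝ → ℝ := fun o => o.elim (fun p => p.2) F1 with hΨ
  have hΨa : ∀ o, AnalyticAt ℝ (Ψ o) 0 := by
    rintro (_ | j)
    · exact analyticAt_snd
    · exact h1 j
  have hΨn : ∀ o, ¬ ∀ᶠ y in 𝓝 (0:ℝ), Ψ o (0, y) = 0 := by
    rintro (_ | j)
    · intro h
      have h : ∀ᶠ y in 𝓝 (0:ℝ), y = 0 := h
      exact (infinite_of_mem_nhds (0:ℝ) h) (Set.finite_singleton (0:ℝ))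
    · exact h2 j
  choose m hm using fun o => reg_of_slice (hΨa o) (hΨn o)
  obtain ⟨C, b, hb⟩ := (kpat_iff _).1 (kpat_main _ Ψ m hΨa hm rfl)
  set K : ℝ := ∑ j, (k j : ℝ) with hK
  have hK0 : 0 ≤ K := Finset.sum_nonneg fun j _ => by positivity
  refine ⟨|C| + K + 1, by positivity, b, ?_⟩
  filter_upwards [hb, eventually_all.2 fun j => (h3 j).eventually_nhds,
    eventually_all.2 fun j => (h1 j).eventually_analyticAt] with p hp h4 h5 hp1
  obtain ⟨e1, e2, e3, e4⟩ := hp hp1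
  have hCC : C ≤ |C| + K + 1 := by have := le_abs_self C; linarith
  refine ⟨e1, ?_, e3.trans hCC, fun j => ?_⟩
  · have := e4 none
    have hs : fderiv ℝ (Ψ none) p = ContinuousLinearMap.snd ℝ ℝ ℝ := hasFDerivAt_snd.fderiv
    rw [hs] at this
    exact this.trans (mul_le_mul_of_nonneg_right hCC (abs_nonneg _))
  · have h4' : Φ j =ᶠ[𝓝 p] fun p => p.1 ^ k j * F1 j p := h4 j
    have hpn : HasFDerivAt (fun p : ℝ × ℝ => p.1 ^ k j) (((k j:ℝ) * p.1 ^ (k j-1)) • ContinuousLinearMap.fst ℝ ℝ ℝ) p :=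
      (hasDerivAt_pow (k j) p.1).comp_hasFDerivAt p hasFDerivAt_fst
    rw [h4'.fderiv_eq, h4'.eq_of_nhds, (hpn.fun_mul (h5 j).differentiableAt.hasFDerivAt).fderiv]
    simp only [_root_.smul_apply, _root_.add_apply, ContinuousLinearMap.coe_fst', smul_eq_mul]
    have e5 : |fderiv ℝ (F1 j) p (p.1, b p)| ≤ |C| * |F1 j p| :=
      (e4 (some j)).trans (mul_le_mul_of_nonneg_right (le_abs_self C) (abs_nonneg _))
    have ek : (k j : ℝ) ≤ K := Finset.single_le_sum (f := fun j => (k j : ℝ)) (fun j _ => by positivity) (Finset.mem_univ j)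
    have e6 : (k j : ℝ) * p.1 ^ (k j - 1) * p.1 = k j * p.1 ^ k j := by
      rcases Nat.eq_zero_or_pos (k j) with h | h
      · simp [h]
      · obtain ⟨l, hl⟩ := Nat.exists_eq_succ_of_ne_zero h.ne'
        rw [hl]; simp [pow_succ]; ring
    have e7 : p.1 ^ k j * fderiv ℝ (F1 j) p (p.1, b p) + F1 j p * ((k j : ℝ) * p.1 ^ (k j - 1) * p.1)
        = p.1 ^ k j * (fderiv ℝ (F1 j) p (p.1, b p) + k j * F1 j p) := by rw [e6]; ring
    rw [e7, abs_mul, abs_mul]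
    have e8 : |fderiv ℝ (F1 j) p (p.1, b p) + k j * F1 j p| ≤ (|C| + K + 1) * |F1 j p| := by
      refine (abs_add_le _ _).trans ?_
      rw [abs_mul, abs_of_nonneg (by positivity : (0:ℝ) ≤ k j)]
      have := mul_le_mul_of_nonneg_right ek (abs_nonneg (F1 j p))
      nlinarith [abs_nonneg (F1 j p)]
    calc _ ≤ |p.1 ^ k j| * ((|C| + K + 1) * |F1 j p|) := mul_le_mul_of_nonneg_left e8 (abs_nonneg _)
      _ = _ := by ring

lemma prod_nontriv {J : Type} [Fintype J] (Φ : J → ℝ × ℝ → ℝ) (hΦ : ∀ j, AnalyticAt ℝ (Φ j) 0)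
    (hn : ∀ j, ¬ ∀ᶠ p in 𝓝 (0:ℝ×ℝ), Φ j p = 0) : ¬ ∀ᶠ p in 𝓝 (0:ℝ×ℝ), ∏ j, Φ j p = 0 := by
  intro h
  choose δ hδ hv using fun j => null_zero (Φ j) (hΦ j) (hn j)
  have hall : ∀ᶠ p in 𝓝 (0:ℝ×ℝ), p ∈ ⋃ j, {p : ℝ × ℝ | |p.1| < δ j ∧ |p.2| < δ j ∧ Φ j p = 0} := by
    filter_upwards [h, eventually_all.2 fun j => box_mem (hδ j)] with p hp hb
    obtain ⟨j, -, hj⟩ := Finset.prod_eq_zero_iff.1 hp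
    exact mem_iUnion.2 ⟨j, (hb j).1, (hb j).2, hj⟩
  have h0 : volume (⋃ j, {p : ℝ × ℝ | |p.1| < δ j ∧ |p.2| < δ j ∧ Φ j p = 0}) = 0 := measure_iUnion_null hv
  exact (Measure.measure_pos_of_mem_nhds volume hall).ne' h0

lemma vector_field {J : Type} [Fintype J] (Φ : J → ℝ × ℝ → ℝ) (hΦ : ∀ j, AnalyticAt ℝ (Φ j) 0)
    (hn : ∀ j, ¬ ∀ᶠ p in 𝓝 (0:ℝ×ℝ), Φ j p = 0) :
    ∃ ρ > (0:ℝ), ∃ C > (0:ℝ), ∃ b P : ℝ × ℝ → ℝ,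
      (∀ p : ℝ × ℝ, 0 < p.1 → p.1 < ρ → |p.2| < ρ → ContDiffAt ℝ 1 b p ∧ |b p| ≤ C * |p.2| ∧
        |fderiv ℝ b p (0, 1)| ≤ C ∧ AnalyticAt ℝ P p ∧ |fderiv ℝ P p (p.1, b p)| ≤ C * |P p| ∧
        (∀ j, AnalyticAt ℝ (Φ j) p ∧ (P p ≠ 0 → Φ j p ≠ 0) ∧ |fderiv ℝ (Φ j) p (p.1, b p)| ≤ C * |Φ j p|)) ∧
      volume {p : ℝ × ℝ | |p.1| < ρ ∧ |p.2| < ρ ∧ P p = 0} = 0 := by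
  have hPa : AnalyticAt ℝ (fun p => ∏ j, Φ j p) 0 := Finset.analyticAt_fun_prod _ fun j _ => hΦ j
  have hPn := prod_nontriv Φ hΦ hn
  obtain ⟨C, hC, b, hb⟩ := vf0 (J := Option J) (fun o => o.elim (fun p => ∏ j, Φ j p) Φ)
    (by rintro (_ | j); exacts [hPa, hΦ j]) (by rintro (_ | j); exacts [hPn, hn j])
  obtain ⟨δ1, hδ1, hv⟩ := null_zero _ hPa hPn
  obtain ⟨δ2, hδ2, hb2⟩ := exists_box (hb.and (hPa.eventually_analyticAt.and (eventually_all.2 fun j => (hΦ j).eventually_analyticAt)))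
  refine ⟨min δ1 δ2, lt_min hδ1 hδ2, C, hC, b, fun p => ∏ j, Φ j p, ?_, ?_⟩
  · intro p h0 h1 h2
    obtain ⟨h3, h4, h5⟩ := hb2 p (by rw [abs_of_pos h0]; exact h1.trans_le (min_le_right _ _)) (h2.trans_le (min_le_right _ _))
    obtain ⟨e1, e2, e3, e4⟩ := h3 h0
    exact ⟨e1, e2, e3, h4, e4 none, fun j => ⟨h5 j, fun hP hj => hP (Finset.prod_eq_zero (Finset.mem_univ j) hj), e4 (some j)⟩⟩
  · refine measure_mono_null ?_ hv
    rintro p ⟨h1, h2, h3⟩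
    exact ⟨h1.trans_le (min_le_left _ _), h2.trans_le (min_le_left _ _), h3⟩

lemma exists_step : ∃ τ : ℝ → ℝ, ContDiff ℝ 1 τ ∧ (∀ x, 0 ≤ τ x) ∧ (∀ x, τ x ≤ 1) ∧ (∀ x ≤ 1, τ x = 0) ∧
    (∀ x, 2 ≤ x → τ x = 1) ∧ ∃ B ≥ (0:ℝ), ∀ x, |x * deriv τ x| ≤ B := by
  have hcd : ContDiff ℝ 1 (fun x : ℝ => Real.smoothTransition (x - 1)) :=
    (Real.smoothTransition.contDiff (n := 1)).comp (contDiff_id.sub contDiff_const)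
  refine ⟨fun x => Real.smoothTransition (x - 1), hcd, fun x => Real.smoothTransition.nonneg _,
    fun x => Real.smoothTransition.le_one _, fun x hx => Real.smoothTransition.zero_of_nonpos (by linarith),
    fun x hx => Real.smoothTransition.one_of_one_le (by linarith), ?_⟩
  have hc : Continuous (fun x : ℝ => x * deriv (fun x : ℝ => Real.smoothTransition (x - 1)) x) :=
    continuous_id.mul (hcd.continuous_deriv le_rfl)
  obtain ⟨B, hB⟩ := (isCompact_Icc (a := (0:ℝ)) (b := 3)).exists_bound_of_continuousOn hc.continuousOn
  refine ⟨|B|, abs_nonneg _, fun x => ?_⟩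
  by_cases hx : x ∈ Icc (0:ℝ) 3
  · exact (hB x hx).trans (le_abs_self _)
  · have : deriv (fun x : ℝ => Real.smoothTransition (x - 1)) x = 0 := by
      rcases lt_or_ge x 0 with h | h
      · have : (fun x : ℝ => Real.smoothTransition (x - 1)) =ᶠ[𝓝 x] fun _ => 0 := by
          filter_upwards [Iio_mem_nhds h] with y hy
          exact Real.smoothTransition.zero_of_nonpos (by have : y < 0 := hy; linarith)
        rw [this.deriv_eq]; simp
      · have h3 : 3 < x := by by_contra h'; exact hx ⟨h, by linarith⟩
        have : (fun x : ℝ => Real.smoothTransition (x - 1)) =ᶠ[𝓝 x] fun _ => 1 := by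
          filter_upwards [Ioi_mem_nhds h3] with y hy
          exact Real.smoothTransition.one_of_one_le (by have : 3 < y := hy; linarith)
        rw [this.deriv_eq]; simp
    rw [this]; simp

def eSW (s w : ℝ) (p : ℝ × ℝ) : ℂ := Complex.exp (Complex.I * ((s : ℂ) * (p.1 : ℂ) + (w : ℂ) * (p.2 : ℂ)))

lemma eSW_norm (s w : ℝ) (p : ℝ × ℝ) : ‖eSW s w p‖ = 1 := by
  have : Complex.I * ((s : ℂ) * (p.1 : ℂ) + (w : ℂ) * (p.2 : ℂ)) = ((s * p.1 + w * p.2 : ℝ) : ℂ) * Complex.I := by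
    push_cast; ring
  rw [eSW, this, Complex.norm_exp_ofReal_mul_I]

lemma eSW_continuous (s w : ℝ) : Continuous (eSW s w) := by unfold eSW; fun_prop

lemma eSW_hasFDerivAt (s w : ℝ) (p : ℝ × ℝ) : HasFDerivAt (eSW s w)
    (eSW s w p • (Complex.I • ((s : ℂ) • (Complex.ofRealCLM.comp (ContinuousLinearMap.fst ℝ ℝ ℝ)) +
      (w : ℂ) • (Complex.ofRealCLM.comp (ContinuousLinearMap.snd ℝ ℝ ℝ))))) p := by
  have h1 : HasFDerivAt (fun p : ℝ × ℝ => (p.1 : ℂ)) (Complex.ofRealCLM.comp (ContinuousLinearMap.fst ℝ ℝ ℝ)) p :=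
    (Complex.ofRealCLM.comp (ContinuousLinearMap.fst ℝ ℝ ℝ)).hasFDerivAt
  have h2 : HasFDerivAt (fun p : ℝ × ℝ => (p.2 : ℂ)) (Complex.ofRealCLM.comp (ContinuousLinearMap.snd ℝ ℝ ℝ)) p :=
    (Complex.ofRealCLM.comp (ContinuousLinearMap.snd ℝ ℝ ℝ)).hasFDerivAt
  exact (((h1.const_mul (s:ℂ)).add (h2.const_mul (w:ℂ))).const_mul Complex.I).cexp

lemma eSW_fderiv (s w : ℝ) (p V : ℝ × ℝ) : fderiv ℝ (eSW s w) p V = Complex.I * (s * V.1 + w * V.2) * eSW s w p := by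
  rw [(eSW_hasFDerivAt s w p).fderiv]
  simp; ring

lemma ibp_exp (Q : ℝ × ℝ → ℝ) (hQ : ContDiff ℝ 1 Q) (hc : HasCompactSupport Q) (s w : ℝ) (V : ℝ × ℝ) :
    (Complex.I * (s * V.1 + w * V.2)) * ∫ p, Q p • eSW s w p = - ∫ p, (fderiv ℝ Q p V) • eSW s w p := by
  have hcf : Continuous fun p => fderiv ℝ Q p V :=
    (hQ.continuous_fderiv one_ne_zero).clm_apply continuous_const
  have hsf : HasCompactSupport fun p => fderiv ℝ Q p V := hc.fderiv_apply ℝ V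
  have i1 : Integrable fun p => fderiv ℝ Q p V • eSW s w p :=
    (hcf.smul (eSW_continuous s w)).integrable_of_hasCompactSupport hsf.smul_right
  have i0 : Integrable fun p => Q p • eSW s w p :=
    (hQ.continuous.smul (eSW_continuous s w)).integrable_of_hasCompactSupport hc.smul_right
  have i2 : Integrable fun p => Q p • fderiv ℝ (eSW s w) p V := by
    refine (hQ.continuous.smul ?_).integrable_of_hasCompactSupport hc.smul_right
    simp only [eSW_fderiv]
    exact continuous_const.mul (eSW_continuous s w)
  have := integral_smul_fderiv_eq_neg_fderiv_smul_of_integrable (μ := volume) (f := Q) (g := eSW s w) (v := V) i1 i2 i0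
    (fun x _ => hQ.differentiable one_ne_zero x) (fun x _ => (eSW_hasFDerivAt s w x).differentiableAt)
  rw [← this, ← integral_const_mul]
  refine integral_congr_ae (Eventually.of_forall fun p => ?_)
  simp only [eSW_fderiv, Complex.real_smul]; ring

structure IBPData (ρ ρ' C : ℝ) (b P h G : ℝ × ℝ → ℝ) : Prop where
  hρ : ρ' < ρ
  hC : 0 ≤ C
  b1 : ∀ p : ℝ × ℝ, 0 < p.1 → p.1 < ρ → |p.2| < ρ → ContDiffAt ℝ 1 b p
  b2 : ∀ p : ℝ × ℝ, 0 < p.1 → p.1 < ρ → |p.2| < ρ → |b p| ≤ C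
  b3 : ∀ p : ℝ × ℝ, 0 < p.1 → p.1 < ρ → |p.2| < ρ → |fderiv ℝ b p (0, 1)| ≤ C
  P1 : ∀ p : ℝ × ℝ, 0 < p.1 → p.1 < ρ → |p.2| < ρ → ContDiffAt ℝ 1 P p
  P2 : ∀ p : ℝ × ℝ, 0 < p.1 → p.1 < ρ → |p.2| < ρ → |fderiv ℝ P p (p.1, b p)| ≤ C * |P p|
  h1 : ∀ p : ℝ × ℝ, 0 < p.1 → p.1 < ρ → |p.2| < ρ → P p ≠ 0 → ContDiffAt ℝ 1 h p
  h2 : ∀ p : ℝ × ℝ, 0 < p.1 → p.1 < ρ → |p.2| < ρ → P p ≠ 0 → |h p| ≤ C * G p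
  h3 : ∀ p : ℝ × ℝ, 0 < p.1 → p.1 < ρ → |p.2| < ρ → P p ≠ 0 → |fderiv ℝ h p (p.1, b p)| ≤ C * G p
  h4 : ∀ p : ℝ × ℝ, 0 < p.1 → p.1 < ρ → |p.2| < ρ → ¬ (p.1 ≤ ρ' ∧ |p.2| ≤ ρ') → h p = 0
  G0 : ∀ p, 0 ≤ G p
  Gi : IntegrableOn G {p : ℝ × ℝ | 0 < p.1 ∧ p.1 < ρ ∧ |p.2| < ρ}
  Pn : volume {p : ℝ × ℝ | 0 < p.1 ∧ p.1 < ρ ∧ |p.2| < ρ ∧ P p = 0} = 0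

def DD (ρ : ℝ) : Set (ℝ × ℝ) := {p : ℝ × ℝ | 0 < p.1 ∧ p.1 < ρ ∧ |p.2| < ρ}

lemma DD_open (ρ : ℝ) : IsOpen (DD ρ) := by
  have : DD ρ = {p : ℝ × ℝ | 0 < p.1} ∩ ({p : ℝ × ℝ | p.1 < ρ} ∩ {p : ℝ × ℝ | |p.2| < ρ}) := rfl
  rw [this]
  exact (isOpen_lt (by fun_prop) (by fun_prop)).inter ((isOpen_lt (by fun_prop) (by fun_prop)).inter (isOpen_lt (by fun_prop) (by fun_prop)))

open Classical in
def qq (ρ : ℝ) (τ : ℝ → ℝ) (P h : ℝ × ℝ → ℝ) (r κ : ℝ) : ℝ × ℝ → ℝ :=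
  (DD ρ).indicator fun p => h p * (τ (p.1 / r) * τ (P p ^ 2 / κ ^ 2) * p.1⁻¹)

section
variable {ρ ρ' C : ℝ} {b P h G : ℝ × ℝ → ℝ} (D : IBPData ρ ρ' C b P h G) {τ : ℝ → ℝ} {B : ℝ}
  (t1 : ContDiff ℝ 1 τ) (t2 : ∀ x, 0 ≤ τ x) (t3 : ∀ x, τ x ≤ 1) (t4 : ∀ x ≤ 1, τ x = 0) (hB : 0 ≤ B) (t5 : ∀ x, |x * deriv τ x| ≤ B)
  {r κ : ℝ} (hr : 0 < r) (hκ : 0 < κ)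

include D t4 hr hκ in
lemma qq_cases (p : ℝ × ℝ) : (p ∈ DD ρ ∧ P p ≠ 0 ∧ r ≤ p.1) ∨ qq ρ τ P h r κ =ᶠ[𝓝 p] 0 := by
  by_cases hpr : p.1 < r
  · right
    filter_upwards [(isOpen_lt (f := fun p : ℝ × ℝ => p.1) (g := fun _ => r) (by fun_prop) (by fun_prop)).mem_nhds hpr] with z hz
    have hz : z.1 < r := hz
    simp only [qq, indicator_apply_eq_zero, Pi.zero_apply]
    intro _
    rw [t4 (z.1 / r) (by rw [div_le_one hr]; exact hz.le)]; simp
  push Not at hpr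
  by_cases hpD : p ∈ DD ρ
  · by_cases hP : P p = 0
    · right
      have hc : ContinuousAt (fun z => P z ^ 2) p := (D.P1 p hpD.1 hpD.2.1 hpD.2.2).continuousAt.pow 2
      have hlt : P p ^ 2 < κ ^ 2 := by rw [hP, zero_pow two_ne_zero]; positivity
      filter_upwards [hc.eventually_lt_const hlt] with z hz
      simp only [qq, indicator_apply_eq_zero, Pi.zero_apply]
      intro _
      rw [t4 (P z ^ 2 / κ ^ 2) (by rw [div_le_one (by positivity)]; exact hz.le)]; simp
    · left; exact ⟨hpD, hP, hpr⟩
  · right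
    have hout : ¬ (p.1 ≤ ρ' ∧ |p.2| ≤ ρ') := by
      rintro ⟨h1, h2⟩
      exact hpD ⟨hr.trans_le hpr, h1.trans_lt D.hρ, h2.trans_lt D.hρ⟩
    have hcl : IsClosed {p : ℝ × ℝ | p.1 ≤ ρ' ∧ |p.2| ≤ ρ'} :=
      (isClosed_le (f := fun p : ℝ × ℝ => p.1) (g := fun _ => ρ') (by fun_prop) (by fun_prop)).inter
        (isClosed_le (f := fun p : ℝ × ℝ => |p.2|) (g := fun _ => ρ') (by fun_prop) (by fun_prop))
    filter_upwards [hcl.isOpen_compl.mem_nhds hout] with z hz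
    simp only [qq, indicator_apply_eq_zero, Pi.zero_apply]
    intro hzD
    rw [D.h4 z hzD.1 hzD.2.1 hzD.2.2 hz, zero_mul]

lemma qq_eq {p : ℝ × ℝ} (hp : p ∈ DD ρ) : qq ρ τ P h r κ =ᶠ[𝓝 p] fun p => h p * (τ (p.1 / r) * τ (P p ^ 2 / κ ^ 2) * p.1⁻¹) := by
  filter_upwards [(DD_open ρ).mem_nhds hp] with z hz
  simp only [qq, indicator_of_mem hz]

include D t1 t4 hr hκ in
lemma qq_contDiff : ContDiff ℝ 1 (qq ρ τ P h r κ) := by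
  rw [contDiff_iff_contDiffAt]
  intro p
  rcases qq_cases D t4 hr hκ p with ⟨hpD, hP, hpr⟩ | h0
  · refine ContDiffAt.congr_of_eventuallyEq ?_ (qq_eq hpD)
    have hh := D.h1 p hpD.1 hpD.2.1 hpD.2.2 hP
    have hPP := D.P1 p hpD.1 hpD.2.1 hpD.2.2
    have e1 : ContDiffAt ℝ 1 (fun p : ℝ × ℝ => τ (p.1 / r)) p :=
      ContDiffAt.comp p t1.contDiffAt (contDiffAt_fst.div_const r)
    have e2 : ContDiffAt ℝ 1 (fun p : ℝ × ℝ => τ (P p ^ 2 / κ ^ 2)) p :=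
      ContDiffAt.comp p t1.contDiffAt ((hPP.pow 2).div_const _)
    exact hh.mul ((e1.mul e2).mul (contDiffAt_fst.inv hpD.1.ne'))
  · exact contDiffAt_const.congr_of_eventuallyEq h0

include D t1 t4 hr hκ in
lemma qqb_contDiff : ContDiff ℝ 1 (fun p => qq ρ τ P h r κ p * b p) := by
  rw [contDiff_iff_contDiffAt]
  intro p
  rcases qq_cases D t4 hr hκ p with ⟨hpD, hP, hpr⟩ | h0
  · exact (qq_contDiff D t1 t4 hr hκ).contDiffAt.mul (D.b1 p hpD.1 hpD.2.1 hpD.2.2)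
  · refine (contDiffAt_const (c := (0:ℝ))).congr_of_eventuallyEq ?_
    filter_upwards [h0] with z hz
    rw [hz]; simp

include D in
lemma qq_compact : HasCompactSupport (qq ρ τ P h r κ) := by
  refine HasCompactSupport.intro ((isCompact_Icc (a := (0:ℝ)) (b := ρ')).prod (isCompact_Icc (a := -ρ') (b := ρ'))) fun p hp => ?_
  simp only [qq, indicator_apply_eq_zero]
  intro hpD
  rw [D.h4 p hpD.1 hpD.2.1 hpD.2.2 ?_, zero_mul]
  rintro ⟨h1, h2⟩
  exact hp ⟨⟨hpD.1.le, h1⟩, abs_le.1 h2⟩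

end

section
variable {ρ ρ' C : ℝ} {b P h G : ℝ × ℝ → ℝ} (D : IBPData ρ ρ' C b P h G) {τ : ℝ → ℝ} {B : ℝ}
  (t1 : ContDiff ℝ 1 τ) (t2 : ∀ x, 0 ≤ τ x) (t3 : ∀ x, τ x ≤ 1) (t4 : ∀ x ≤ 1, τ x = 0) (hB : 0 ≤ B) (t5 : ∀ x, |x * deriv τ x| ≤ B)
  {r κ : ℝ} (hr : 0 < r) (hκ : 0 < κ)

include D t2 t3 in
lemma qq_bound {p : ℝ × ℝ} (hpD : p ∈ DD ρ) (hP : P p ≠ 0) :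
    |qq ρ τ P h r κ p| ≤ C * (G p / p.1) := by
  have hx : 0 < p.1 := hpD.1
  have hh := D.h2 p hpD.1 hpD.2.1 hpD.2.2 hP
  rw [(qq_eq hpD).self_of_nhds, abs_mul, abs_mul, abs_mul, abs_of_nonneg (t2 _), abs_of_nonneg (t2 _),
    abs_of_pos (inv_pos.2 hx)]
  have hT : τ (p.1 / r) * τ (P p ^ 2 / κ ^ 2) ≤ 1 := mul_le_one₀ (t3 _) (t2 _) (t3 _)
  have hi : 0 < p.1⁻¹ := inv_pos.2 hx
  have hT' : τ (p.1 / r) * τ (P p ^ 2 / κ ^ 2) * p.1⁻¹ ≤ p.1⁻¹ := by nlinarith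
  have hT0 : 0 ≤ τ (p.1 / r) * τ (P p ^ 2 / κ ^ 2) * p.1⁻¹ := mul_nonneg (mul_nonneg (t2 _) (t2 _)) hi.le
  calc _ ≤ (C * G p) * p.1⁻¹ := mul_le_mul hh hT' hT0 (mul_nonneg D.hC (D.G0 p))
    _ = _ := by rw [div_eq_mul_inv]; ring

include D t1 t2 t3 hB t5 in
lemma qq_X {p : ℝ × ℝ} (hpD : p ∈ DD ρ) (hP : P p ≠ 0) :
    |fderiv ℝ (qq ρ τ P h r κ) p (p.1, b p)| ≤ C * (2 + B + 2 * B * C) * (G p / p.1) := by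
  have hx : 0 < p.1 := hpD.1
  have hC := D.hC
  have hG := D.G0 p
  have hh := D.h2 p hpD.1 hpD.2.1 hpD.2.2 hP
  have hXh := D.h3 p hpD.1 hpD.2.1 hpD.2.2 hP
  have hXP := D.P2 p hpD.1 hpD.2.1 hpD.2.2
  have dh := ((D.h1 p hpD.1 hpD.2.1 hpD.2.2 hP).differentiableAt one_ne_zero).hasFDerivAt
  have dP := ((D.P1 p hpD.1 hpD.2.1 hpD.2.2).differentiableAt one_ne_zero).hasFDerivAt
  have dτ : ∀ x, HasDerivAt τ (deriv τ x) x := fun x => (t1.differentiable one_ne_zero x).hasDerivAt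
  have dx : HasFDerivAt (fun p : ℝ × ℝ => p.1) (ContinuousLinearMap.fst ℝ ℝ ℝ) p := hasFDerivAt_fst
  have e1 : HasFDerivAt (fun p : ℝ × ℝ => τ (p.1 / r)) (deriv τ (p.1 / r) • (r⁻¹ • ContinuousLinearMap.fst ℝ ℝ ℝ)) p := by
    have : HasFDerivAt (fun p : ℝ × ℝ => p.1 / r) (r⁻¹ • ContinuousLinearMap.fst ℝ ℝ ℝ) p := by
      simp only [div_eq_mul_inv]; exact dx.mul_const _
    exact (dτ _).comp_hasFDerivAt p this
  have e2 : HasFDerivAt (fun p : ℝ × ℝ => τ (P p ^ 2 / κ ^ 2)) (deriv τ (P p ^ 2 / κ ^ 2) • ((κ ^ 2)⁻¹ • ((2 * P p) • fderiv ℝ P p))) p := by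
    have : HasFDerivAt (fun p : ℝ × ℝ => P p ^ 2 / κ ^ 2) ((κ ^ 2)⁻¹ • ((2 * P p) • fderiv ℝ P p)) p := by
      simp only [div_eq_mul_inv]
      refine HasFDerivAt.mul_const ?_ _
      have := dP.pow 2
      simpa using this
    exact (dτ _).comp_hasFDerivAt p this
  have e3 : HasFDerivAt (fun p : ℝ × ℝ => p.1⁻¹) ((-(p.1 ^ 2)⁻¹) • ContinuousLinearMap.fst ℝ ℝ ℝ) p :=
    (hasDerivAt_inv hx.ne').comp_hasFDerivAt p dx
  have := dh.fun_mul ((e1.fun_mul e2).fun_mul e3)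
  rw [(qq_eq hpD).fderiv_eq, this.fderiv]
  set X := fderiv ℝ h p (p.1, b p) with hX
  set Y := fderiv ℝ P p (p.1, b p) with hY
  set T1 := τ (p.1 / r)
  set T2 := τ (P p ^ 2 / κ ^ 2)
  set S1 := (p.1 / r) * deriv τ (p.1 / r) with hS1
  set S2 := (P p ^ 2 / κ ^ 2) * deriv τ (P p ^ 2 / κ ^ 2) with hS2
  have a1 : 0 ≤ T1 := t2 _
  have a2 : T1 ≤ 1 := t3 _
  have a3 : 0 ≤ T2 := t2 _
  have a4 : T2 ≤ 1 := t3 _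
  have b1 : |S1| ≤ B := t5 _
  have b2 : |S2| ≤ B := t5 _
  have hYP : |Y / P p| ≤ C := by rw [abs_div, div_le_iff₀ (abs_pos.2 hP)]; exact hXP
  have key : (h p • ((T1 * T2) • ((-(p.1 ^ 2)⁻¹) • ContinuousLinearMap.fst ℝ ℝ ℝ) +
      p.1⁻¹ • (T1 • deriv τ (P p ^ 2 / κ ^ 2) • ((κ ^ 2)⁻¹ • ((2 * P p) • fderiv ℝ P p)) + T2 • deriv τ (p.1 / r) • (r⁻¹ • ContinuousLinearMap.fst ℝ ℝ ℝ)))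
      + (T1 * T2 * p.1⁻¹) • fderiv ℝ h p) (p.1, b p)
      = (h p * (-(T1 * T2) + (T1 * (2 * S2 * (Y / P p)) + T2 * S1)) + T1 * T2 * X) / p.1 := by
    simp only [_root_.add_apply, _root_.smul_apply, ContinuousLinearMap.coe_fst', smul_eq_mul, ← hX, ← hY]
    rw [hS1, hS2]
    field_simp
  rw [key, abs_div, abs_of_pos hx, ← mul_div_assoc (C * (2 + B + 2 * B * C)) (G p) p.1, div_le_div_iff_of_pos_right hx]
  have hTT : |T1 * T2| ≤ 1 := by rw [abs_mul, abs_of_nonneg a1, abs_of_nonneg a3]; exact mul_le_one₀ a2 a3 a4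
  have m1 : |T1 * (2 * S2 * (Y / P p))| ≤ 2 * B * C := by
    rw [abs_mul, abs_of_nonneg a1, abs_mul, abs_mul, abs_two]
    have : 2 * |S2| * |Y / P p| ≤ 2 * B * C := by
      apply mul_le_mul (by linarith) hYP (abs_nonneg _) (by positivity)
    calc T1 * (2 * |S2| * |Y / P p|) ≤ 1 * (2 * |S2| * |Y / P p|) := mul_le_mul_of_nonneg_right a2 (by positivity)
      _ ≤ _ := by linarith
  have m2 : |T2 * S1| ≤ B := by
    rw [abs_mul, abs_of_nonneg a3]
    calc T2 * |S1| ≤ 1 * |S1| := mul_le_mul_of_nonneg_right a4 (abs_nonneg _)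
      _ ≤ _ := by linarith
  have m3 : |-(T1 * T2) + (T1 * (2 * S2 * (Y / P p)) + T2 * S1)| ≤ 1 + (2 * B * C + B) := by
    refine (abs_add_le _ _).trans (add_le_add ?_ ((abs_add_le _ _).trans (add_le_add m1 m2)))
    rw [abs_neg]; exact hTT
  refine (abs_add_le _ _).trans ?_
  rw [abs_mul, abs_mul (T1 * T2)]
  have n1 : |h p| * |-(T1 * T2) + (T1 * (2 * S2 * (Y / P p)) + T2 * S1)| ≤ (C * G p) * (1 + (2 * B * C + B)) :=
    mul_le_mul hh m3 (abs_nonneg _) (by positivity)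
  have n2 : |T1 * T2| * |X| ≤ 1 * (C * G p) := mul_le_mul hTT hXh (abs_nonneg _) one_pos.le
  linarith

include D t1 t2 t3 t4 hB t5 hr hκ in
lemma qq_ibp {s w H : ℝ} (hw : |w| ≤ H) :
    |s| * ‖∫ p, (qq ρ τ P h r κ p * p.1) • eSW s w p‖ ≤
      (C * (2 + B + 2 * B * C) + C * (1 + C) + H * (C * C)) * ∫ p in DD ρ ∩ {p | r ≤ p.1}, G p / p.1 := by
  have hC := D.hC
  set q := qq ρ τ P h r κ with hq
  have cq : ContDiff ℝ 1 q := qq_contDiff D t1 t4 hr hκ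
  have cqb : ContDiff ℝ 1 (fun p => q p * b p) := qqb_contDiff D t1 t4 hr hκ
  have sq : HasCompactSupport q := qq_compact D
  have cqx : ContDiff ℝ 1 (fun p : ℝ × ℝ => q p * p.1) := cq.mul contDiff_fst
  have I1 := ibp_exp _ cqx (sq.mul_right) s w (1, 0)
  have I2 := ibp_exp _ cqb (sq.mul_right) s w (0, 1)
  have i1 : Integrable fun p => fderiv ℝ (fun p : ℝ × ℝ => q p * p.1) p (1, 0) • eSW s w p :=
    (((cqx.continuous_fderiv one_ne_zero).clm_apply continuous_const).smul (eSW_continuous s w)).integrable_of_hasCompactSupport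
      (HasCompactSupport.smul_right (HasCompactSupport.fderiv_apply ℝ sq.mul_right _))
  have i2 : Integrable fun p => fderiv ℝ (fun p : ℝ × ℝ => q p * b p) p (0, 1) • eSW s w p :=
    (((cqb.continuous_fderiv one_ne_zero).clm_apply continuous_const).smul (eSW_continuous s w)).integrable_of_hasCompactSupport
      (HasCompactSupport.smul_right (HasCompactSupport.fderiv_apply ℝ sq.mul_right _))
  have i3 : Integrable fun p => (q p * b p) • eSW s w p :=
    (cqb.continuous.smul (eSW_continuous s w)).integrable_of_hasCompactSupport
      (HasCompactSupport.smul_right sq.mul_right)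
  have key : (Complex.I * s) * ∫ p, (q p * p.1) • eSW s w p =
      - ∫ p, (fderiv ℝ (fun p : ℝ × ℝ => q p * p.1) p (1, 0) • eSW s w p + fderiv ℝ (fun p : ℝ × ℝ => q p * b p) p (0, 1) • eSW s w p
        + (Complex.I * w) * ((q p * b p) • eSW s w p)) := by
    rw [integral_add (f := fun p => fderiv ℝ (fun p : ℝ × ℝ => q p * p.1) p (1, 0) • eSW s w p + fderiv ℝ (fun p : ℝ × ℝ => q p * b p) p (0, 1) • eSW s w p) (i1.add i2) (i3.const_mul _), integral_add i1 i2, integral_const_mul]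
    simp only [Complex.ofReal_one, Complex.ofReal_zero, mul_one, mul_zero, add_zero, zero_add] at I1 I2
    rw [I2, I1]; ring
  have hn : |s| * ‖∫ p, (q p * p.1) • eSW s w p‖ = ‖(Complex.I * s) * ∫ p, (q p * p.1) • eSW s w p‖ := by
    rw [norm_mul, norm_mul, Complex.norm_I, Complex.norm_real, one_mul, Real.norm_eq_abs]
  rw [hn, key, norm_neg]
  have hmeas : MeasurableSet (DD ρ ∩ {p : ℝ × ℝ | r ≤ p.1}) :=
    (DD_open ρ).measurableSet.inter (measurableSet_le measurable_const measurable_fst)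
  have hGi : IntegrableOn (fun p : ℝ × ℝ => G p / p.1) (DD ρ ∩ {p | r ≤ p.1}) := by
    have g0 : IntegrableOn G (DD ρ ∩ {p | r ≤ p.1}) := IntegrableOn.mono_set D.Gi inter_subset_left
    refine Integrable.mono (g0.const_mul r⁻¹) (g0.aestronglyMeasurable.mul measurable_fst.inv.aestronglyMeasurable) ?_
    refine (ae_restrict_mem hmeas).mono fun p hp => ?_
    have hp2 : r ≤ p.1 := hp.2
    have : 0 < p.1 := hr.trans_le hp.2
    rw [Real.norm_eq_abs, Real.norm_eq_abs, abs_of_nonneg (div_nonneg (D.G0 p) this.le), abs_of_nonneg (mul_nonneg (by positivity) (D.G0 p)),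
      div_eq_mul_inv, mul_comm]
    exact mul_le_mul_of_nonneg_right (inv_anti₀ hr hp.2) (D.G0 p)
  have h0H : 0 ≤ H := (abs_nonneg w).trans hw
  rw [← integral_indicator hmeas, ← integral_const_mul]
  refine norm_integral_le_of_norm_le ((integrable_indicator_iff hmeas).2 hGi |>.const_mul _) (Eventually.of_forall fun p => ?_)
  rcases qq_cases D t4 hr hκ p with ⟨hpD, hP, hpr⟩ | h0
  · rw [indicator_of_mem (show p ∈ DD ρ ∩ {p : ℝ × ℝ | r ≤ p.1} from ⟨hpD, hpr⟩)]
    have hb := D.b2 p hpD.1 hpD.2.1 hpD.2.2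
    have hby := D.b3 p hpD.1 hpD.2.1 hpD.2.2
    have q1 := qq_bound D t2 t3 (r := r) (κ := κ) hpD hP
    have q2 := qq_X D t1 t2 t3 hB t5 (r := r) (κ := κ) hpD hP
    rw [← hq] at q1 q2
    have hg : 0 ≤ G p / p.1 := div_nonneg (D.G0 p) hpD.1.le
    have dq := (cq.differentiable one_ne_zero p).hasFDerivAt
    have db := ((D.b1 p hpD.1 hpD.2.1 hpD.2.2).differentiableAt one_ne_zero).hasFDerivAt
    have dx : HasFDerivAt (fun p : ℝ × ℝ => p.1) (ContinuousLinearMap.fst ℝ ℝ ℝ) p := hasFDerivAt_fst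
    rw [(dq.fun_mul dx).fderiv, (dq.fun_mul db).fderiv]
    have hdiv : (q p • ContinuousLinearMap.fst ℝ ℝ ℝ + p.1 • fderiv ℝ q p) (1, 0) + (q p • fderiv ℝ b p + b p • fderiv ℝ q p) (0, 1)
        = fderiv ℝ q p (p.1, b p) + q p * (1 + fderiv ℝ b p (0, 1)) := by
      have : ((p.1, b p) : ℝ × ℝ) = p.1 • (1, 0) + b p • (0, 1) := by simp
      rw [this, map_add, map_smul, map_smul]
      simp; ring
    rw [← add_smul, hdiv]
    refine (norm_add_le _ _).trans ?_
    rw [norm_smul, eSW_norm, norm_mul, norm_mul, Complex.norm_I, Complex.norm_real, norm_smul, eSW_norm, Real.norm_eq_abs, Real.norm_eq_abs, Real.norm_eq_abs]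
    have c1 : |q p * (1 + fderiv ℝ b p (0, 1))| ≤ (C * (G p / p.1)) * (1 + C) := by
      rw [abs_mul]
      exact mul_le_mul q1 ((abs_add_le _ _).trans (by rw [abs_one]; linarith)) (abs_nonneg _) (by positivity)
    have c2 : |q p * b p| ≤ (C * (G p / p.1)) * C := by
      rw [abs_mul]
      exact mul_le_mul q1 hb (abs_nonneg _) (by positivity)
    have c3 : |w| * |q p * b p| ≤ H * ((C * (G p / p.1)) * C) := mul_le_mul hw c2 (abs_nonneg _) h0H
    have c4 := abs_add_le (fderiv ℝ q p (p.1, b p)) (q p * (1 + fderiv ℝ b p (0, 1)))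
    linarith
  · have e1 : fderiv ℝ (fun p : ℝ × ℝ => q p * p.1) p = 0 := by
      have : (fun p : ℝ × ℝ => q p * p.1) =ᶠ[𝓝 p] fun _ => 0 := by
        filter_upwards [h0] with z hz
        rw [hq, hz]; simp
      rw [this.fderiv_eq]; simp
    have e2 : fderiv ℝ (fun p : ℝ × ℝ => q p * b p) p = 0 := by
      have : (fun p : ℝ × ℝ => q p * b p) =ᶠ[𝓝 p] fun _ => 0 := by
        filter_upwards [h0] with z hz
        rw [hq, hz]; simp
      rw [this.fderiv_eq]; simp
    have e3 : q p = 0 := h0.self_of_nhds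
    rw [e1, e2, e3]
    simp
    refine mul_nonneg (by positivity) (indicator_nonneg (fun z hz => ?_) p)
    exact div_nonneg (D.G0 z) hz.1.1.le
end

section
variable {ρ ρ' C : ℝ} {b P h G : ℝ × ℝ → ℝ} (D : IBPData ρ ρ' C b P h G)

include D in
lemma D_ae : ∀ᵐ p : ℝ × ℝ, p ∈ DD ρ → P p ≠ 0 := by
  have := D.Pn
  rw [ae_iff]
  refine measure_mono_null (fun p hp => ?_) this
  simp only [mem_ofPred_eq, not_forall, not_not] at hp
  obtain ⟨h1, h2⟩ := hp
  exact ⟨h1.1, h1.2.1, h1.2.2, h2⟩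

include D in
lemma D_hi : IntegrableOn h (DD ρ) := by
  have hop : IsOpen (DD ρ ∩ P ⁻¹' {0}ᶜ) :=
    ContinuousOn.isOpen_inter_preimage (fun p hp => (D.P1 p hp.1 hp.2.1 hp.2.2).continuousAt.continuousWithinAt) (DD_open ρ)
      isOpen_compl_singleton
  have hcont : ContinuousOn h (DD ρ ∩ P ⁻¹' {0}ᶜ) := fun p hp =>
    (D.h1 p hp.1.1 hp.1.2.1 hp.1.2.2 hp.2).continuousAt.continuousWithinAt
  have hae : (DD ρ : Set (ℝ × ℝ)) =ᵐ[volume] (DD ρ ∩ P ⁻¹' {0}ᶜ : Set (ℝ × ℝ)) := by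
    filter_upwards [D_ae D] with p hp
    apply propext
    exact ⟨fun h => ⟨h, hp h⟩, fun h => h.1⟩
  have hm : AEStronglyMeasurable h (volume.restrict (DD ρ)) := by
    rw [Measure.restrict_congr_set hae]
    exact hcont.aestronglyMeasurable hop.measurableSet
  refine Integrable.mono' (D.Gi.const_mul C) hm ?_
  rw [ae_restrict_iff' (DD_open ρ).measurableSet]
  filter_upwards [D_ae D] with p hp hpD
  exact D.h2 p hpD.1 hpD.2.1 hpD.2.2 (hp hpD)

include D in
lemma ibp_main (H : ℝ) : ∃ C1 : ℝ, 0 ≤ C1 ∧ ∀ s w r : ℝ, s ≠ 0 → |w| ≤ H → 0 < r →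
    ‖∫ p in DD ρ, h p • eSW s w p‖ ≤ C1 * ((∫ p in DD ρ ∩ {p | p.1 < 2 * r}, G p) +
      |s|⁻¹ * ∫ p in DD ρ ∩ {p | r ≤ p.1}, G p / p.1) := by
  obtain ⟨τ, t1, t2, t3, t4, t6, B, hB, t5⟩ := exists_step
  have hC := D.hC
  set K := C * (2 + B + 2 * B * C) + C * (1 + C) + |H| * (C * C) with hK
  have hK0 : 0 ≤ K := by positivity
  refine ⟨C + K, by positivity, fun s w r hs hw hr => ?_⟩
  have hm := (DD_open ρ).measurableSet
  set J := ∫ p in DD ρ ∩ {p | r ≤ p.1}, G p / p.1 with hJ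
  have hJ0 : 0 ≤ J := setIntegral_nonneg (hm.inter (measurableSet_le measurable_const measurable_fst))
    fun p hp => div_nonneg (D.G0 p) hp.1.1.le
  have hL0 : 0 ≤ ∫ p in DD ρ ∩ {p | p.1 < 2 * r}, G p := integral_nonneg D.G0
  have hCG : Integrable ((DD ρ).indicator fun p => C * G p) := (integrable_indicator_iff hm).2 (D.Gi.const_mul C)
  have lim : Tendsto (fun n : ℕ => ∫ p, (qq ρ τ P h r (1 / ((n:ℝ) + 1)) p * p.1) • eSW s w p) atTop
      (𝓝 (∫ p, ((DD ρ).indicator (fun p => h p * τ (p.1 / r)) p) • eSW s w p)) := by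
    refine tendsto_integral_of_dominated_convergence ((DD ρ).indicator fun p => C * G p) ?_ hCG ?_ ?_
    · intro n
      have hκ : (0:ℝ) < 1 / ((n:ℝ) + 1) := by positivity
      exact (((qq_contDiff D t1 t4 hr hκ).continuous.mul continuous_fst).smul (eSW_continuous s w)).aestronglyMeasurable
    · intro n
      filter_upwards [D_ae D] with p hp
      rw [norm_smul, eSW_norm, mul_one, Real.norm_eq_abs]
      by_cases hpD : p ∈ DD ρ
      · rw [indicator_of_mem hpD, abs_mul, abs_of_pos hpD.1]
        have := qq_bound D t2 t3 (r := r) (κ := 1 / ((n:ℝ) + 1)) hpD (hp hpD)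
        calc _ ≤ C * (G p / p.1) * p.1 := mul_le_mul_of_nonneg_right this hpD.1.le
          _ = _ := by rw [mul_assoc, div_mul_cancel₀ _ hpD.1.ne']
      · rw [indicator_of_notMem hpD]; simp [qq, indicator_of_notMem hpD]
    · filter_upwards [D_ae D] with p hp
      by_cases hpD : p ∈ DD ρ
      · have hP := hp hpD
        refine tendsto_const_nhds.congr' ?_
        have hP2 : 0 < P p ^ 2 := by positivity
        have ht : Tendsto (fun n : ℕ => P p ^ 2 * ((n:ℝ) + 1)) atTop atTop :=
          (tendsto_atTop_add_const_right _ _ tendsto_natCast_atTop_atTop).const_mul_atTop hP2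
        filter_upwards [ht.eventually_ge_atTop 2] with n hn
        rw [(qq_eq hpD).self_of_nhds, indicator_of_mem hpD]
        have : τ (P p ^ 2 / (1 / ((n:ℝ) + 1)) ^ 2) = 1 := by
          apply t6
          have h1 : (1:ℝ) ≤ (n:ℝ) + 1 := by linarith [Nat.cast_nonneg (α := ℝ) n]
          have : P p ^ 2 / (1 / ((n:ℝ) + 1)) ^ 2 = P p ^ 2 * ((n:ℝ) + 1) * ((n:ℝ) + 1) := by field_simp
          rw [this]; nlinarith
        have hx0 := hpD.1.ne'
        beta_reduce
        rw [this]
        congr 1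
        field_simp
      · simp [qq, indicator_of_notMem hpD]
  have bd : |s| * ‖∫ p, ((DD ρ).indicator (fun p => h p * τ (p.1 / r)) p) • eSW s w p‖ ≤ K * J := by
    refine le_of_tendsto (lim.norm.const_mul |s|) (Eventually.of_forall fun n => ?_)
    exact qq_ibp D t1 t2 t3 t4 hB t5 hr (by positivity) (hw.trans (le_abs_self H))
  have hs' : 0 < |s| := abs_pos.2 hs
  have bd' : ‖∫ p, ((DD ρ).indicator (fun p => h p * τ (p.1 / r)) p) • eSW s w p‖ ≤ K * (|s|⁻¹ * J) := by
    have : |s|⁻¹ * (|s| * ‖∫ p, ((DD ρ).indicator (fun p => h p * τ (p.1 / r)) p) • eSW s w p‖) ≤ |s|⁻¹ * (K * J) :=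
      mul_le_mul_of_nonneg_left bd (by positivity)
    rw [← mul_assoc, inv_mul_cancel₀ hs'.ne', one_mul] at this
    linarith
  have hhi : Integrable ((DD ρ).indicator h) := (integrable_indicator_iff hm).2 (D_hi D)
  have ie : ∀ k : ℝ × ℝ → ℝ, Integrable k → Integrable fun p => k p • eSW s w p := fun k hk => by
    refine Integrable.mono hk (hk.aestronglyMeasurable.smul (eSW_continuous s w).aestronglyMeasurable) (Eventually.of_forall fun p => ?_)
    rw [norm_smul, eSW_norm, mul_one]
  have ihτ : Integrable ((DD ρ).indicator fun p => h p * τ (p.1 / r)) := by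
    have hτ : Continuous fun p : ℝ × ℝ => τ (p.1 / r) := t1.continuous.comp (continuous_fst.div_const r)
    have := hhi.mul_bdd (g := fun p : ℝ × ℝ => τ (p.1 / r)) (c := 1) hτ.aestronglyMeasurable (Eventually.of_forall fun p => by
      rw [Real.norm_eq_abs, abs_of_nonneg (t2 _)]; exact t3 _)
    refine this.congr (Eventually.of_forall fun p => ?_)
    by_cases hpD : p ∈ DD ρ <;> simp [hpD]
  have ihd := hhi.sub ihτ
  have split : ∫ p in DD ρ, h p • eSW s w p = (∫ p, ((DD ρ).indicator (fun p => h p * τ (p.1 / r)) p) • eSW s w p)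
      + ∫ p, ((DD ρ).indicator h - (DD ρ).indicator fun p => h p * τ (p.1 / r)) p • eSW s w p := by
    rw [← integral_add (ie _ ihτ) (ie _ ihd), ← integral_indicator hm]
    refine integral_congr_ae (Eventually.of_forall fun p => ?_)
    by_cases hpD : p ∈ DD ρ <;> simp [hpD]
    ring
  have hm2 : MeasurableSet (DD ρ ∩ {p : ℝ × ℝ | p.1 < 2 * r}) := hm.inter (measurableSet_lt measurable_fst measurable_const)
  have bd2 : ‖∫ p, ((DD ρ).indicator h - (DD ρ).indicator fun p => h p * τ (p.1 / r)) p • eSW s w p‖ ≤ C * ∫ p in DD ρ ∩ {p | p.1 < 2 * r}, G p := by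
    rw [← integral_indicator hm2, ← integral_const_mul]
    refine norm_integral_le_of_norm_le (((integrable_indicator_iff hm2).2 (IntegrableOn.mono_set D.Gi inter_subset_left)).const_mul _) ?_
    filter_upwards [D_ae D] with p hp
    rw [norm_smul, eSW_norm, mul_one, Real.norm_eq_abs, Pi.sub_apply]
    have hnn : 0 ≤ C * (DD ρ ∩ {p : ℝ × ℝ | p.1 < 2 * r}).indicator G p := mul_nonneg hC (indicator_nonneg (fun z _ => D.G0 z) p)
    by_cases hpD : p ∈ DD ρ
    · rw [indicator_of_mem hpD, indicator_of_mem hpD]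
      by_cases hx : p.1 < 2 * r
      · rw [indicator_of_mem (show p ∈ DD ρ ∩ {p : ℝ × ℝ | p.1 < 2 * r} from ⟨hpD, hx⟩)]
        have e : h p - h p * τ (p.1 / r) = h p * (1 - τ (p.1 / r)) := by ring
        have f1 := t2 (p.1 / r)
        have f2 := t3 (p.1 / r)
        rw [e, abs_mul, abs_of_nonneg (show 0 ≤ 1 - τ (p.1 / r) by linarith)]
        have := D.h2 p hpD.1 hpD.2.1 hpD.2.2 (hp hpD)
        have f3 := abs_nonneg (h p)
        nlinarith
      · rw [t6 (p.1 / r) (by rw [le_div_iff₀ hr]; linarith)]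
        simpa using hnn
    · rw [indicator_of_notMem hpD, indicator_of_notMem hpD]; simpa using hnn
  rw [split]
  refine (norm_add_le _ _).trans ?_
  have z1 : 0 ≤ K * ∫ p in DD ρ ∩ {p | p.1 < 2 * r}, G p := mul_nonneg hK0 hL0
  have z2 : 0 ≤ C * (|s|⁻¹ * J) := mul_nonneg hC (mul_nonneg (by positivity) hJ0)
  nlinarith
end

lemma log_abs_mono {r t c : ℝ} (hr : 0 < r) (hrt : r ≤ t) (htc : t < c) (hc : c ≤ 1/3) : |Real.log t| ≤ |Real.log r| := by
  have h1 : Real.log r ≤ Real.log t := Real.log_le_log hr hrt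
  have h2 : Real.log t ≤ 0 := Real.log_nonpos (by linarith) (by linarith)
  rw [abs_of_nonpos h2, abs_of_nonpos (h1.trans h2)]; linarith

lemma one_le_log {r c : ℝ} (hr : 0 < r) (hrc : r < c) (hc : c ≤ 1/3) : 1 ≤ |Real.log r| := by
  have h0 : Real.log r ≤ 0 := Real.log_nonpos hr.le (by linarith)
  rw [abs_of_nonpos h0]
  have h1 : Real.log r ≤ -1 := by
    rw [Real.log_le_iff_le_exp hr]
    have h2 : Real.exp 1 < 2.7182818286 := Real.exp_one_lt_d9
    rw [Real.exp_neg]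
    have : (1/3:ℝ) ≤ (Real.exp 1)⁻¹ := by
      rw [one_div]; exact inv_anti₀ (Real.exp_pos _) (by linarith)
    linarith
  linarith

lemma dyadic_M {c δ bb : ℝ} {e : ℕ} {G : ℝ × ℝ → ℝ} (hc3 : c ≤ 1/3) (hδ : 0 < δ) (hbb : 0 ≤ bb)
    (hG : ∀ p, 0 ≤ G p) (hGi : IntegrableOn G (DD c))
    (hM : ∀ r, 0 < r → r < c → ∫ p in DD c ∩ {p | p.1 < r}, G p ≤ bb * r ^ δ * |Real.log r| ^ e) :
    ∃ K ≥ 0, ∀ r, 0 < r → r < c → ∀ t, r ≤ t → ∫ p in DD c ∩ {p | p.1 < t}, G p ≤ K * t ^ δ * |Real.log r| ^ e := by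
  have hI : 0 ≤ ∫ p in DD c, G p := integral_nonneg hG
  have hcδ : 0 ≤ |c| ^ (-δ) := Real.rpow_nonneg (abs_nonneg c) _
  refine ⟨bb + (∫ p in DD c, G p) * |c| ^ (-δ), by positivity, fun r hr hrc t hrt => ?_⟩
  have ht : 0 < t := hr.trans_le hrt
  have hc : 0 < c := hr.trans hrc
  have htδ : 0 ≤ t ^ δ := Real.rpow_nonneg ht.le _
  have hl : 1 ≤ |Real.log r| := one_le_log hr hrc hc3
  have hle : 1 ≤ |Real.log r| ^ e := one_le_pow₀ hl
  rcases lt_or_ge t c with h | h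
  · refine (hM t ht h).trans ?_
    have : |Real.log t| ^ e ≤ |Real.log r| ^ e := pow_le_pow_left₀ (abs_nonneg _) (log_abs_mono hr hrt h hc3) e
    calc bb * t ^ δ * |Real.log t| ^ e ≤ bb * t ^ δ * |Real.log r| ^ e := mul_le_mul_of_nonneg_left this (by positivity)
      _ ≤ _ := by
        refine mul_le_mul_of_nonneg_right ?_ (by positivity)
        refine mul_le_mul_of_nonneg_right ?_ htδ
        linarith [mul_nonneg hI hcδ]
  · have h1 : ∫ p in DD c ∩ {p | p.1 < t}, G p ≤ ∫ p in DD c, G p :=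
      setIntegral_mono_set hGi (Eventually.of_forall hG) (Eventually.of_forall fun p hp => hp.1)
    refine h1.trans ?_
    rw [abs_of_pos hc]
    have h2 : 1 ≤ c ^ (-δ) * t ^ δ := by
      rw [Real.rpow_neg hc.le, inv_mul_eq_div, one_le_div (Real.rpow_pos_of_pos hc _)]
      exact Real.rpow_le_rpow hc.le h hδ.le
    have h3 : 0 ≤ bb * t ^ δ * |Real.log r| ^ e := by positivity
    have h4 : 1 ≤ c ^ (-δ) * t ^ δ * |Real.log r| ^ e := one_le_mul_of_one_le_of_one_le h2 hle
    nlinarith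

lemma dyadic_sum {c δ : ℝ} {e : ℕ} {G : ℝ × ℝ → ℝ} (hδ1 : δ < 1) 
    (hG : ∀ p, 0 ≤ G p) (hGi : IntegrableOn G (DD c)) {K : ℝ} (hK : 0 ≤ K)
    (hM : ∀ r, 0 < r → r < c → ∀ t, r ≤ t → ∫ p in DD c ∩ {p | p.1 < t}, G p ≤ K * t ^ δ * |Real.log r| ^ e) :
    ∃ K' ≥ 0, ∀ r, 0 < r → r < c → ∫ p in DD c ∩ {p | r ≤ p.1}, G p / p.1 ≤ K' * r ^ (δ - 1) * |Real.log r| ^ e := by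
  set q : ℝ := 2 ^ (δ - 1) with hq
  have hq0 : 0 < q := Real.rpow_pos_of_pos (by norm_num) _
  have hq1 : q < 1 := Real.rpow_lt_one_of_one_lt_of_neg (by norm_num) (by linarith)
  have h2δ : (0:ℝ) < 2 ^ δ := Real.rpow_pos_of_pos (by norm_num) _
  refine ⟨K * 2 ^ δ * (1 - q)⁻¹, mul_nonneg (by positivity) (inv_nonneg.2 (by linarith)), fun r hr hrc => ?_⟩
  obtain ⟨N, hN⟩ := pow_unbounded_of_one_lt (c / r) (one_lt_two (α := ℝ))
  have hm := (DD_open c).measurableSet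
  have hmA : MeasurableSet (DD c ∩ {p : ℝ × ℝ | r ≤ p.1}) := hm.inter (measurableSet_le measurable_const measurable_fst)
  have hmB : ∀ t : ℝ, MeasurableSet (DD c ∩ {p : ℝ × ℝ | p.1 < t}) := fun t => hm.inter (measurableSet_lt measurable_fst measurable_const)
  set S : ℕ → ℝ × ℝ → ℝ := fun k => (DD c ∩ {p : ℝ × ℝ | p.1 < 2 ^ (k+1) * r}).indicator fun p => (2 ^ k * r)⁻¹ * G p with hS
  have hSi : ∀ k, Integrable (S k) := fun k =>
    (integrable_indicator_iff (hmB _)).2 ((IntegrableOn.mono_set hGi inter_subset_left).const_mul _)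
  have hS0 : ∀ k p, 0 ≤ S k p := fun k p => indicator_nonneg (fun z _ => mul_nonneg (by positivity) (hG z)) p
  have hpt : ∀ p, (DD c ∩ {p : ℝ × ℝ | r ≤ p.1}).indicator (fun p => G p / p.1) p ≤ ∑ k ∈ Finset.range N, S k p := by
    intro p
    by_cases hp : p ∈ DD c ∩ {p : ℝ × ℝ | r ≤ p.1}
    · rw [indicator_of_mem hp]
      have hp2 : r ≤ p.1 := hp.2
      have hx : 0 < p.1 := hp.1.1
      obtain ⟨k, hk1, hk2⟩ := exists_nat_pow_near (show 1 ≤ p.1 / r by rw [one_le_div hr]; exact hp2) (one_lt_two (α := ℝ))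
      rw [le_div_iff₀ hr] at hk1
      rw [div_lt_iff₀ hr] at hk2
      have hkN : k < N := by
        have : (2:ℝ) ^ k < 2 ^ N := by
          refine lt_of_le_of_lt ?_ hN
          rw [le_div_iff₀ hr]; exact hk1.trans hp.1.2.1.le
        exact (pow_lt_pow_iff_right₀ one_lt_two).1 this
      refine le_trans ?_ (Finset.single_le_sum (f := fun k => S k p) (fun i _ => hS0 i p) (Finset.mem_range.2 hkN))
      simp only [hS]
      rw [indicator_of_mem (show p ∈ DD c ∩ {p : ℝ × ℝ | p.1 < 2 ^ (k+1) * r} from ⟨hp.1, hk2⟩), div_eq_inv_mul]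
      exact mul_le_mul_of_nonneg_right (inv_anti₀ (by positivity) hk1) (hG p)
    · rw [indicator_of_notMem hp]
      exact Finset.sum_nonneg fun i _ => hS0 i p
  rw [← integral_indicator hmA]
  have hstep : ∫ p, (DD c ∩ {p : ℝ × ℝ | r ≤ p.1}).indicator (fun p => G p / p.1) p ≤ ∫ p, ∑ k ∈ Finset.range N, S k p :=
    integral_mono_of_nonneg (Eventually.of_forall fun p => indicator_nonneg (fun z hz => div_nonneg (hG z) hz.1.1.le) p)
      (integrable_finsetSum _ fun k _ => hSi k) (Eventually.of_forall hpt)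
  refine hstep.trans ?_
  rw [integral_finsetSum _ fun k _ => hSi k]
  have hlog : 0 ≤ |Real.log r| ^ e := by positivity
  have hrδ : 0 < r ^ (δ - 1) := Real.rpow_pos_of_pos hr _
  have hterm : ∀ k ∈ Finset.range N, ∫ p, S k p ≤ (K * 2 ^ δ * r ^ (δ - 1) * |Real.log r| ^ e) * q ^ k := by
    intro k _
    simp only [hS]
    rw [integral_indicator (hmB _), integral_const_mul]
    have h2k : (0:ℝ) < 2 ^ k := by positivity
    have := hM r hr hrc (2 ^ (k+1) * r) (le_mul_of_one_le_left hr.le (one_le_pow₀ one_le_two))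
    refine (mul_le_mul_of_nonneg_left this (by positivity)).trans (le_of_eq ?_)
    have e1 : ((2:ℝ) ^ (k+1) * r) ^ δ = 2 ^ δ * ((2:ℝ)^k) ^ δ * r ^ δ := by
      rw [Real.mul_rpow (by positivity) hr.le, pow_succ, Real.mul_rpow (by positivity) (by norm_num)]; ring
    have e2 : q ^ k = ((2:ℝ)^k) ^ δ / 2 ^ k := by
      have : q = 2 ^ δ / 2 := by rw [hq, Real.rpow_sub (by norm_num), Real.rpow_one]
      rw [this, div_pow, ← Real.rpow_natCast ((2:ℝ) ^ δ) k, ← Real.rpow_mul (by norm_num), mul_comm δ, Real.rpow_mul (by norm_num), Real.rpow_natCast]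
    have e3 : r ^ (δ - 1) = r ^ δ / r := by rw [Real.rpow_sub hr, Real.rpow_one]
    rw [e1, e2, e3]
    field_simp
  refine (Finset.sum_le_sum hterm).trans ?_
  rw [← Finset.mul_sum]
  have hg : ∑ k ∈ Finset.range N, q ^ k ≤ (1 - q)⁻¹ := by
    rw [← tsum_geometric_of_lt_one hq0.le hq1]
    exact (summable_geometric_of_lt_one hq0.le hq1).sum_le_tsum _ (fun i _ => by positivity)
  calc _ ≤ (K * 2 ^ δ * r ^ (δ - 1) * |Real.log r| ^ e) * (1 - q)⁻¹ := mul_le_mul_of_nonneg_left hg (by positivity)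
    _ = _ := by ring

lemma half_decay {c ρ' C δ bb : ℝ} {e : ℕ} {b P h G : ℝ × ℝ → ℝ} (D : IBPData c ρ' C b P h G)
    (hc : 0 < c) (hc3 : c ≤ 1/3) (hδ : 0 < δ) (hδ1 : δ < 1) (hbb : 0 ≤ bb)
    (hM : ∀ r, 0 < r → r < c → ∫ p in DD c ∩ {p | p.1 < r}, G p ≤ bb * r ^ δ * |Real.log r| ^ e) (H : ℝ) :
    ∃ K ≥ 0, ∀ s w : ℝ, c⁻¹ < |s| → |w| ≤ H → ‖∫ p in DD c, h p • eSW s w p‖ ≤ K * |s| ^ (-δ) * Real.log |s| ^ e := by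
  obtain ⟨K1, hK1, h1⟩ := dyadic_M hc3 hδ hbb D.G0 D.Gi hM
  obtain ⟨K2, hK2, h2⟩ := dyadic_sum hδ1 D.G0 D.Gi hK1 h1
  obtain ⟨C1, hC1, h3⟩ := ibp_main D H
  refine ⟨C1 * (K1 * 2 ^ δ + K2), by positivity, fun s w hs hw => ?_⟩
  have hs0 : 0 < |s| := (inv_pos.2 hc).trans hs
  set r := |s|⁻¹ with hr
  have hr0 : 0 < r := inv_pos.2 hs0
  have hrc : r < c := by rw [hr]; exact inv_lt_of_inv_lt₀ hc hs
  have e1 : |Real.log r| = Real.log |s| := by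
    rw [hr, Real.log_inv, abs_neg, abs_of_nonneg]
    apply Real.log_nonneg
    have : 1 ≤ c⁻¹ := (one_le_inv₀ hc).2 (by linarith)
    linarith
  have e2 : |s| ^ (-δ) = r ^ δ := by rw [hr, Real.rpow_neg hs0.le, Real.inv_rpow hs0.le]
  refine (h3 s w r (abs_pos.1 hs0) hw hr0).trans ?_
  have a1 := h1 r hr0 hrc (2 * r) (by linarith)
  have a2 := h2 r hr0 hrc
  rw [e1] at a1 a2
  rw [e2]
  rw [Real.mul_rpow (by norm_num) hr0.le] at a1
  have a3 : r * ∫ p in DD c ∩ {p | r ≤ p.1}, G p / p.1 ≤ K2 * r ^ δ * Real.log |s| ^ e := by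
    refine (mul_le_mul_of_nonneg_left a2 hr0.le).trans (le_of_eq ?_)
    rw [Real.rpow_sub hr0, Real.rpow_one]; field_simp
  calc _ ≤ C1 * (K1 * (2 ^ δ * r ^ δ) * Real.log |s| ^ e + K2 * r ^ δ * Real.log |s| ^ e) :=
        mul_le_mul_of_nonneg_left (add_le_add a1 a3) hC1
    _ = _ := by ring

def Lv (v : ℝ × ℝ) (σ : ℝ) : ℝ × ℝ →L[ℝ] ℝ × ℝ :=
  ((σ * v.1) • ContinuousLinearMap.fst ℝ ℝ ℝ + v.2 • ContinuousLinearMap.snd ℝ ℝ ℝ).prod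
    ((σ * v.2) • ContinuousLinearMap.fst ℝ ℝ ℝ + (-v.1) • ContinuousLinearMap.snd ℝ ℝ ℝ)

lemma Lv_apply (v : ℝ × ℝ) (σ : ℝ) (p : ℝ × ℝ) : Lv v σ p = (σ * v.1 * p.1 + v.2 * p.2, σ * v.2 * p.1 - v.1 * p.2) := by
  simp [Lv]; ring

lemma unit_sq {v : ℝ × ℝ} (hv : nrm2 v = 1) : v.1 ^ 2 + v.2 ^ 2 = 1 := by
  unfold nrm2 at hv
  have := Real.sqrt_eq_one.1 hv
  exact this

section
variable {v : ℝ × ℝ} (hv : nrm2 v = 1) {σ : ℝ} (hσ : σ ^ 2 = 1)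
include hv
lemma Lv_dot (p : ℝ × ℝ) : dot2 (Lv v σ p) v = σ * p.1 := by
  have := unit_sq hv
  simp only [Lv_apply, dot2]
  linear_combination (σ * p.1) * this

lemma Lv_dotp (p : ℝ × ℝ) : dot2 (Lv v σ p) (perp2 v) = p.2 := by
  have := unit_sq hv
  simp only [Lv_apply, dot2, perp2]
  linear_combination (p.2) * this

include hσ
lemma Lv_sq (p : ℝ × ℝ) : (Lv v σ p).1 ^ 2 + (Lv v σ p).2 ^ 2 = p.1 ^ 2 + p.2 ^ 2 := by
  have := unit_sq hv
  simp only [Lv_apply]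
  linear_combination (σ ^ 2 * p.1 ^ 2 + p.2 ^ 2) * this + p.1 ^ 2 * hσ

lemma Lv_nrm (p : ℝ × ℝ) : nrm2 (Lv v σ p) = nrm2 p := by
  unfold nrm2; rw [Lv_sq hv hσ]

lemma Lv_inj : Function.Injective (Lv v σ) := by
  intro p q h
  have h1 := Lv_dot hv (σ := σ) p
  have h2 := Lv_dotp hv (σ := σ) p
  rw [h, Lv_dot hv] at h1
  rw [h, Lv_dotp hv] at h2
  have hs : σ ≠ 0 := by rintro rfl; norm_num at hσ
  exact Prod.ext (mul_left_cancel₀ hs h1).symm h2.symm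

lemma Lv_emb : MeasurableEmbedding (Lv v σ) :=
  (Lv v σ).continuous.measurableEmbedding (Lv_inj hv hσ)

lemma Lv_mp : MeasurePreserving (Lv v σ) volume volume := by
  refine ⟨(Lv v σ).continuous.measurable, ?_⟩
  have hdet : LinearMap.det (Lv v σ : ℝ × ℝ →ₗ[ℝ] ℝ × ℝ) = -σ := by
    rw [← LinearMap.det_toMatrix (Module.Basis.finTwoProd ℝ), Matrix.det_fin_two]
    have := unit_sq hv
    simp [LinearMap.toMatrix_apply, Lv_apply]
    linear_combination (-σ) * this
  have hs : σ ≠ 0 := by rintro rfl; norm_num at hσ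
  have := Measure.map_linearMap_addHaar_eq_smul_addHaar (μ := (volume : Measure (ℝ × ℝ))) (f := (Lv v σ : ℝ × ℝ →ₗ[ℝ] ℝ × ℝ))
    (by rw [hdet]; exact neg_ne_zero.2 hs)
  rw [hdet] at this
  have e : |(-σ)⁻¹| = 1 := by
    rw [abs_inv, abs_neg]
    have : |σ| = 1 := by rw [← sq_eq_sq₀ (abs_nonneg _) zero_le_one, sq_abs, hσ]; norm_num
    rw [this]; norm_num
  rw [e] at this
  simpa using this
end

lemma coord_le_nrm (p : ℝ × ℝ) : ‖p‖ ≤ nrm2 p := by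
  rw [Prod.norm_def]
  refine max_le ?_ ?_
  · exact Real.abs_le_sqrt (by nlinarith [sq_nonneg p.2])
  · exact Real.abs_le_sqrt (by nlinarith [sq_nonneg p.1])

lemma nrm_field {C : ℝ} (hC : 0 ≤ C) {p : ℝ × ℝ} {β : ℝ} (hβ : |β| ≤ C * |p.2|) : nrm2 (p.1, β) ≤ (1 + C) * nrm2 p := by
  unfold nrm2
  rw [Real.sqrt_le_left (by positivity), mul_pow, Real.sq_sqrt (by positivity)]
  have : β ^ 2 ≤ C ^ 2 * p.2 ^ 2 := by
    rw [← sq_abs β, ← sq_abs p.2, ← mul_pow]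
    exact pow_le_pow_left₀ (abs_nonneg _) hβ 2
  simp only
  have h1 := sq_nonneg p.1
  have h2 := sq_nonneg p.2
  nlinarith [mul_nonneg hC h1, mul_nonneg hC h2, mul_nonneg (sq_nonneg C) h1]

lemma stdFun_nonneg (n : ℕ) (f : Fin n → ℝ × ℝ → ℝ) (γ : Fin n → ℝ) (E : Set (ℝ × ℝ)) (p : ℝ × ℝ) : 0 ≤ stdFun n f γ E p :=
  indicator_nonneg (fun z _ => Finset.prod_nonneg fun i _ => Real.rpow_nonneg (abs_nonneg _) _) p

lemma std_reg {n : ℕ} {f : Fin n → ℝ × ℝ → ℝ} {γ : Fin n → ℝ} {E : Set (ℝ × ℝ)} {z V : ℝ × ℝ} {C : ℝ}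
    (hfa : ∀ i, ContDiffAt ℝ 1 (f i) z) (hne : ∀ i, f i z ≠ 0) (hE : z ∉ frontier E)
    (hX : ∀ i, |fderiv ℝ (f i) z V| ≤ C * |f i z|) :
    ContDiffAt ℝ 1 (stdFun n f γ E) z ∧ |fderiv ℝ (stdFun n f γ E) z V| ≤ (C * ∑ i, |γ i|) * stdFun n f γ E z := by
  have hcase : z ∈ interior E ∨ z ∈ interior Eᶜ := by
    by_contra hcon
    push Not at hcon
    apply hE
    rw [frontier, Set.mem_sdiff]
    refine ⟨?_, hcon.1⟩
    by_contra h
    exact hcon.2 (by rw [interior_compl]; exact h)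
  rcases hcase with hz | hz
  · have heq : stdFun n f γ E =ᶠ[𝓝 z] fun p => Real.exp (∑ i, γ i * Real.log (f i p)) := by
      have h1 : ∀ᶠ p in 𝓝 z, ∀ i, f i p ≠ 0 := by
        rw [eventually_all]
        exact fun i => (hfa i).continuousAt.eventually_ne (hne i)
      filter_upwards [isOpen_interior.mem_nhds hz, h1] with p hp hp1
      rw [stdFun, indicator_of_mem (interior_subset hp), Real.exp_sum]
      refine Finset.prod_congr rfl fun i _ => ?_
      rw [Real.rpow_def_of_pos (abs_pos.2 (hp1 i)), Real.log_abs, mul_comm]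
    have hd : HasFDerivAt (fun p => Real.exp (∑ i, γ i * Real.log (f i p)))
        (Real.exp (∑ i, γ i * Real.log (f i z)) • ∑ i, γ i • ((f i z)⁻¹ • fderiv ℝ (f i) z)) z := by
      refine HasFDerivAt.exp ?_
      refine HasFDerivAt.fun_sum fun i _ => ?_
      exact (((hfa i).differentiableAt one_ne_zero).hasFDerivAt.log (hne i)).const_mul _
    constructor
    · refine ContDiffAt.congr_of_eventuallyEq ?_ heq
      refine ContDiffAt.exp ?_
      exact ContDiffAt.sum fun i _ => contDiffAt_const.mul ((hfa i).log (hne i))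
    · rw [heq.fderiv_eq, hd.fderiv, heq.self_of_nhds, _root_.smul_apply, smul_eq_mul, abs_mul, abs_of_pos (Real.exp_pos _), mul_comm]
      refine mul_le_mul_of_nonneg_right ?_ (Real.exp_pos _).le
      rw [_root_.sum_apply, Finset.mul_sum]
      refine (Finset.abs_sum_le_sum_abs _ _).trans (Finset.sum_le_sum fun i _ => ?_)
      rw [_root_.smul_apply, _root_.smul_apply, smul_eq_mul, smul_eq_mul, abs_mul, mul_comm]
      refine mul_le_mul_of_nonneg_right ?_ (abs_nonneg _)
      rw [abs_mul, abs_inv, inv_mul_le_iff₀ (abs_pos.2 (hne i)), mul_comm]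
      exact hX i
  · have heq : stdFun n f γ E =ᶠ[𝓝 z] fun _ => 0 := by
      filter_upwards [isOpen_interior.mem_nhds hz] with p hp
      rw [stdFun, indicator_of_notMem (interior_subset hp)]
    constructor
    · exact contDiffAt_const.congr_of_eventuallyEq heq
    · rw [heq.fderiv_eq, heq.self_of_nhds]; simp

lemma mk_data {n : ℕ} (f : Fin n → ℝ × ℝ → ℝ) (γ : Fin n → ℝ) (E : Set (ℝ × ℝ)) (hsf : StandardForm n f γ E)
    (x₀ y₀ A : ℝ) (hA : 0 < A) (α : ℝ × ℝ → ℝ) (hα : AlphaBound α A) (v : ℝ × ℝ) (hv : nrm2 v = 1) (σ : ℝ) (hσ : σ ^ 2 = 1) :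
    ∃ c₀ > (0:ℝ), ∀ c, c ≤ c₀ → ∀ r₁, 0 < r₁ → r₁ < c → ∀ φ : ℝ × ℝ → ℝ, IsBump φ x₀ y₀ r₁ →
      ∃ C b P, IBPData c r₁ C b P (fun p => φ ((x₀, y₀) + Lv v σ p) * (α (Lv v σ p) * stdFun n f γ E (Lv v σ p)))
        (fun p => stdFun n f γ E (Lv v σ p)) := by
  set L := Lv v σ with hL
  have hL0 : Tendsto L (𝓝 0) (𝓝 0) := by
    have := L.continuous.tendsto 0
    rwa [map_zero] at this
  obtain ⟨U₁, hU₁, han⟩ := hsf.analytic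
  obtain ⟨U₂, hU₂, hint⟩ := hsf.integ
  obtain ⟨ι, _, F, hF1, hF2, hF3⟩ := frontier_cover hsf.domain
  have hsσ : σ ≠ 0 := by rintro rfl; norm_num at hσ
  -- composition keeps analyticity and nontriviality
  have hopen : ∀ Q : ℝ × ℝ → Prop, (∀ᶠ p in 𝓝 (0:ℝ×ℝ), Q (L p)) → ∀ᶠ p in 𝓝 (0:ℝ×ℝ), Q p := by
    intro Q hQ
    have hsurj : ∀ z : ℝ × ℝ, L (σ * dot2 z v, dot2 z (perp2 v)) = z := by
      intro z
      have hu := unit_sq hv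
      rw [hL, Lv_apply]
      simp only [dot2, perp2]
      refine Prod.ext ?_ ?_
      · simp only
        linear_combination (v.1 * (z.1 * v.1 + z.2 * v.2)) * hσ + z.1 * hu
      · simp only
        linear_combination (v.2 * (z.1 * v.1 + z.2 * v.2)) * hσ + z.2 * hu
    have hcont : Tendsto (fun z : ℝ × ℝ => (σ * dot2 z v, dot2 z (perp2 v))) (𝓝 0) (𝓝 (0:ℝ×ℝ)) := by
      have : Continuous (fun z : ℝ × ℝ => (σ * dot2 z v, dot2 z (perp2 v))) := by unfold dot2; fun_prop
      have h := this.tendsto 0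
      simpa [dot2, Prod.zero_eq_mk] using h
    filter_upwards [hcont.eventually hQ] with z hz
    rwa [hsurj] at hz
  let Φ : Fin n ⊕ ι → ℝ × ℝ → ℝ := Sum.elim (fun i p => f i (L p)) (fun j p => F j (L p))
  have hcomp : ∀ k : ℝ × ℝ → ℝ, AnalyticAt ℝ k 0 → AnalyticAt ℝ (fun p => k (L p)) 0 := by
    intro k hk
    refine AnalyticAt.fun_comp (g := k) (f := L) ?_ (L.analyticAt 0)
    rwa [map_zero]
  obtain ⟨ρ, hρ, C, hC, b, P, hvf, hnull⟩ := vector_field Φ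
    (by rintro (i | j)
        · exact hcomp _ (han i 0 (mem_of_mem_nhds hU₁))
        · exact hcomp _ (hF1 j))
    (by rintro (i | j) h
        · exact hsf.nontriv i (hopen _ h)
        · exact hF2 j (hopen _ h))
  obtain ⟨ρ₂, hρ₂, hbox⟩ := exists_box ((hL0.eventually hF3).and (hL0.eventually hU₂))
  refine ⟨min (min ρ ρ₂) (1/3), by positivity, fun c hc r₁ hr₀ hr₁ φ hφ => ?_⟩
  have hcρ : c ≤ ρ := hc.trans ((min_le_left _ _).trans (min_le_left _ _))
  have hcρ₂ : c ≤ ρ₂ := hc.trans ((min_le_left _ _).trans (min_le_right _ _))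
  have hc3 : c ≤ 1/3 := hc.trans (min_le_right _ _)
  obtain ⟨φ1, φ2, φ3, φ4⟩ := hφ
  obtain ⟨α1, α2, α3⟩ := hα
  have φd : ContDiff ℝ 1 φ := φ1.of_le (by exact_mod_cast le_top)
  obtain ⟨M0, hM0⟩ := φ1.continuous.bounded_above_of_compact_support φ2
  obtain ⟨M1, hM1⟩ := (φd.continuous_fderiv one_ne_zero).bounded_above_of_compact_support (φ2.fderiv ℝ)
  have hM0' : 0 ≤ M0 := (norm_nonneg _).trans (hM0 0)
  have hM1' : 0 ≤ M1 := (norm_nonneg _).trans (hM1 0)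
  set Γ := ∑ i, |γ i| with hΓ
  have hΓ0 : 0 ≤ Γ := Finset.sum_nonneg fun i _ => abs_nonneg _
  set g := stdFun n f γ E with hg
  have hg0 : ∀ p, 0 ≤ g p := stdFun_nonneg n f γ E
  have hgL : (fun p => g (L p)) = stdFun n (fun i p => f i (L p)) γ (L ⁻¹' E) := by
    funext p
    by_cases hp : L p ∈ E
    · rw [hg, stdFun, stdFun, indicator_of_mem hp, indicator_of_mem (show p ∈ L ⁻¹' E from hp)]
    · rw [hg, stdFun, stdFun, indicator_of_notMem hp, indicator_of_notMem (show p ∉ L ⁻¹' E from hp)]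
  set K := M0 * A + (M1 * (1 + C) * A + M0 * (A * (1 + C)) + M0 * (A * (C * Γ))) + C with hK
  have hKC : C ≤ K := by rw [hK]; linarith [show 0 ≤ M0 * A + (M1 * (1 + C) * A + M0 * (A * (1 + C)) + M0 * (A * (C * Γ))) by positivity]
  -- pieces
  have pieces : ∀ p : ℝ × ℝ, 0 < p.1 → p.1 < c → |p.2| < c → P p ≠ 0 →
      (ContDiffAt ℝ 1 (fun p => g (L p)) p ∧ |fderiv ℝ (fun p => g (L p)) p (p.1, b p)| ≤ (C * Γ) * g (L p)) ∧
      (ContDiffAt ℝ 1 (fun p => α (L p)) p ∧ |fderiv ℝ (fun p => α (L p)) p (p.1, b p)| ≤ A * (1 + C)) ∧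
      (ContDiffAt ℝ 1 (fun p => φ ((x₀, y₀) + L p)) p ∧ |fderiv ℝ (fun p => φ ((x₀, y₀) + L p)) p (p.1, b p)| ≤ M1 * (1 + C)) := by
    intro p hp1 hp2 hp3 hP
    obtain ⟨w1, w2, w3, w4, w5, w6⟩ := hvf p hp1 (hp2.trans_le hcρ) (hp3.trans_le hcρ)
    have hnV := nrm_field hC.le w2
    have hnp : 0 < nrm2 p := Real.sqrt_pos.2 (by positivity)
    have hnp1 : nrm2 p ≤ 1 := by
      unfold nrm2
      rw [Real.sqrt_le_left zero_le_one]
      have : p.2 ^ 2 ≤ (1/3) ^ 2 := by rw [← sq_abs p.2]; exact pow_le_pow_left₀ (abs_nonneg _) (by linarith) 2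
      nlinarith
    have hLV : ‖L (p.1, b p)‖ ≤ (1 + C) * nrm2 p := by
      refine (coord_le_nrm _).trans ?_
      rw [hL, Lv_nrm hv hσ]; exact hnV
    refine ⟨?_, ?_, ?_⟩
    · rw [hgL, show g (L p) = stdFun n (fun i p => f i (L p)) γ (L ⁻¹' E) p from congrFun hgL p]
      refine std_reg (fun i => ?_) (fun i => ?_) ?_ (fun i => ?_)
      · exact (w6 (Sum.inl i)).1.contDiffAt
      · exact (w6 (Sum.inl i)).2.1 hP
      · intro hfr
        have hfr' : L p ∈ frontier E := L.continuous.frontier_preimage_subset E hfr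
        obtain ⟨j, hj⟩ := (hbox p (by rw [abs_of_pos hp1]; linarith) (by linarith)).1 hfr'
        exact (w6 (Sum.inr j)).2.1 hP hj
      · exact (w6 (Sum.inl i)).2.2
    · have hLp : L p ≠ 0 := by
        intro h0
        have := Lv_nrm hv hσ p
        rw [← hL, h0] at this
        simp [nrm2] at this
        rw [nrm2] at hnp
        linarith
      have ha : ContDiffAt ℝ 1 α (L p) := α1.contDiffAt (isOpen_compl_singleton.mem_nhds hLp)
      refine ⟨ha.comp p L.contDiff.contDiffAt, ?_⟩
      have hd : HasFDerivAt (fun p => α (L p)) ((fderiv ℝ α (L p)).comp L) p :=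
        (ha.differentiableAt one_ne_zero).hasFDerivAt.comp p L.hasFDerivAt
      rw [hd.fderiv, ContinuousLinearMap.comp_apply, ← Real.norm_eq_abs]
      refine (ContinuousLinearMap.le_opNorm _ _).trans ?_
      have h1 := α3 (L p) hLp
      rw [show nrm2 (L p) = nrm2 p from Lv_nrm hv hσ p] at h1
      refine (mul_le_mul h1 hLV (norm_nonneg _) (by positivity)).trans (le_of_eq ?_)
      field_simp
    · have hf : ContDiffAt ℝ 1 φ ((x₀, y₀) + L p) := φd.contDiffAt
      have hin : ContDiffAt ℝ 1 (fun p => (x₀, y₀) + L p) p := contDiffAt_const.add L.contDiff.contDiffAt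
      refine ⟨hf.comp p hin, ?_⟩
      have hd : HasFDerivAt (fun p => φ ((x₀, y₀) + L p)) ((fderiv ℝ φ ((x₀, y₀) + L p)).comp L) p :=
        HasFDerivAt.comp p (hf.differentiableAt one_ne_zero).hasFDerivAt (L.hasFDerivAt.const_add _)
      rw [hd.fderiv, ContinuousLinearMap.comp_apply, ← Real.norm_eq_abs]
      refine (ContinuousLinearMap.le_opNorm _ _).trans ?_
      refine mul_le_mul (hM1 _) (hLV.trans ?_) (norm_nonneg _) hM1'
      exact mul_le_of_le_one_right (by positivity) hnp1
  refine ⟨K, b, P, ?_⟩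
  refine { hρ := hr₁, hC := hC.le.trans hKC, b1 := ?_, b2 := ?_, b3 := ?_, P1 := ?_, P2 := ?_, h1 := ?_, h2 := ?_, h3 := ?_, h4 := ?_, G0 := fun p => hg0 _, Gi := ?_, Pn := ?_ }
  · exact fun p h1 h2 h3 => (hvf p h1 (h2.trans_le hcρ) (h3.trans_le hcρ)).1
  · intro p h1 h2 h3
    refine (hvf p h1 (h2.trans_le hcρ) (h3.trans_le hcρ)).2.1.trans (le_trans ?_ hKC)
    exact mul_le_of_le_one_right hC.le (by linarith)
  · exact fun p h1 h2 h3 => (hvf p h1 (h2.trans_le hcρ) (h3.trans_le hcρ)).2.2.1.trans hKC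
  · exact fun p h1 h2 h3 => (hvf p h1 (h2.trans_le hcρ) (h3.trans_le hcρ)).2.2.2.1.contDiffAt
  · intro p h1 h2 h3
    exact (hvf p h1 (h2.trans_le hcρ) (h3.trans_le hcρ)).2.2.2.2.1.trans (mul_le_mul_of_nonneg_right hKC (abs_nonneg _))
  · intro p h1 h2 h3 hP
    obtain ⟨⟨g1, -⟩, ⟨a1, -⟩, ⟨f1, -⟩⟩ := pieces p h1 h2 h3 hP
    exact f1.mul (a1.mul g1)
  · intro p h1 h2 h3 hP
    rw [abs_mul, abs_mul, abs_of_nonneg (hg0 _), ← mul_assoc]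
    refine mul_le_mul_of_nonneg_right ?_ (hg0 _)
    calc |φ ((x₀, y₀) + L p)| * |α (L p)| ≤ M0 * A := mul_le_mul (hM0 _) (α2 _) (abs_nonneg _) hM0'
      _ ≤ K := by rw [hK]; linarith [show 0 ≤ (M1 * (1 + C) * A + M0 * (A * (1 + C)) + M0 * (A * (C * Γ))) by positivity]
  · intro p h1 h2 h3 hP
    obtain ⟨⟨g1, g2⟩, ⟨a1, a2⟩, ⟨f1, f2⟩⟩ := pieces p h1 h2 h3 hP
    have dg := (g1.differentiableAt one_ne_zero).hasFDerivAt
    have da := (a1.differentiableAt one_ne_zero).hasFDerivAt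
    have df := (f1.differentiableAt one_ne_zero).hasFDerivAt
    rw [(df.fun_mul (da.fun_mul dg)).fderiv]
    simp only [_root_.add_apply, _root_.smul_apply, smul_eq_mul]
    set Xg := fderiv ℝ (fun p => g (L p)) p (p.1, b p)
    set Xa := fderiv ℝ (fun p => α (L p)) p (p.1, b p)
    set Xf := fderiv ℝ (fun p => φ ((x₀, y₀) + L p)) p (p.1, b p)
    have hgp := hg0 (L p)
    have n1 : |φ ((x₀, y₀) + L p) * (α (L p) * Xg + g (L p) * Xa)| ≤ M0 * (A * (C * Γ * g (L p)) + g (L p) * (A * (1 + C))) := by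
      rw [abs_mul]
      refine mul_le_mul (hM0 _) ((abs_add_le _ _).trans (add_le_add ?_ ?_)) (abs_nonneg _) hM0'
      · rw [abs_mul]; exact mul_le_mul (α2 _) g2 (abs_nonneg _) hA.le
      · rw [abs_mul, abs_of_nonneg hgp]; exact mul_le_mul_of_nonneg_left a2 hgp
    have n2 : |α (L p) * g (L p) * Xf| ≤ A * g (L p) * (M1 * (1 + C)) := by
      rw [abs_mul, abs_mul, abs_of_nonneg hgp]
      exact mul_le_mul (mul_le_mul_of_nonneg_right (α2 _) hgp) f2 (abs_nonneg _) (by positivity)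
    have n3 : 0 ≤ (M0 * A + C) * g (L p) := by positivity
    refine (abs_add_le _ _).trans ?_
    rw [hK]
    nlinarith
  · intro p h1 h2 h3 hno
    have : φ ((x₀, y₀) + L p) = 0 := by
      by_contra hne
      have hs := φ4 (subset_tsupport φ hne)
      have hs' : (L p).1 ^ 2 + (L p).2 ^ 2 < r₁ ^ 2 := by simpa using hs
      rw [hL, Lv_sq hv hσ] at hs'
      apply hno
      have hr0 : 0 ≤ r₁ := hr₀.le
      exact ⟨by nlinarith, abs_le_of_sq_le_sq (by nlinarith [sq_nonneg p.1]) hr0⟩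
    rw [this, zero_mul]
  · have hsub : {p : ℝ × ℝ | 0 < p.1 ∧ p.1 < c ∧ |p.2| < c} ⊆ L ⁻¹' U₂ := by
      rintro p ⟨h1, h2, h3⟩
      exact (hbox p (by rw [abs_of_pos h1]; linarith) (by linarith)).2
    have := ((Lv_mp hv hσ).integrableOn_comp_preimage (Lv_emb hv hσ) (f := g) (s := U₂)).2 hint
    exact IntegrableOn.mono_set this hsub
  · refine measure_mono_null ?_ hnull
    rintro p ⟨h1, h2, h3, h4⟩
    exact ⟨by rw [abs_of_pos h1]; linarith, by linarith, h4⟩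

lemma eSW_Lv (v : ℝ × ℝ) (σ t u : ℝ) (p : ℝ × ℝ) :
    eSW t u (Lv v σ p) = eSW (σ * dot2 (t, u) v) (dot2 (t, u) (perp2 v)) p := by
  rw [eSW, eSW, Lv_apply]
  congr 1
  simp only [dot2, perp2]
  push_cast; ring

lemma side_int {v : ℝ × ℝ} (hv : nrm2 v = 1) {σ : ℝ} (hσ : σ ^ 2 = 1) {c : ℝ} {Ψ : ℝ × ℝ → ℝ}
    (hi : IntegrableOn (fun p => Ψ (Lv v σ p)) (DD c))
    (hz : ∀ p : ℝ × ℝ, 0 < p.1 → p ∉ DD c → Ψ (Lv v σ p) = 0) (t u : ℝ) :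
    IntegrableOn (fun p => Ψ p • eSW t u p) {p | 0 < σ * dot2 p v} ∧
    ∫ p in {p | 0 < σ * dot2 p v}, Ψ p • eSW t u p =
      ∫ p in DD c, Ψ (Lv v σ p) • eSW (σ * dot2 (t, u) v) (dot2 (t, u) (perp2 v)) p := by
  have hpre : (Lv v σ) ⁻¹' {p | 0 < σ * dot2 p v} = {p : ℝ × ℝ | 0 < p.1} := by
    ext p
    change 0 < σ * dot2 (Lv v σ p) v ↔ 0 < p.1
    rw [Lv_dot hv, ← mul_assoc, ← sq, hσ, one_mul]
  have hsub : DD c ⊆ {p : ℝ × ℝ | 0 < p.1} := fun p hp => hp.1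
  have hmpos : MeasurableSet {p : ℝ × ℝ | 0 < p.1} := measurableSet_lt measurable_const measurable_fst
  have hz' : ∀ p ∈ {p : ℝ × ℝ | 0 < p.1} \ DD c, Ψ (Lv v σ p) • eSW t u (Lv v σ p) = 0 := by
    rintro p ⟨h1, h2⟩
    rw [hz p h1 h2, zero_smul]
  have hi' : IntegrableOn (fun p => Ψ (Lv v σ p) • eSW t u (Lv v σ p)) (DD c) := by
    refine Integrable.mono hi (hi.aestronglyMeasurable.smul
      ((eSW_continuous t u).comp (Lv v σ).continuous).aestronglyMeasurable) (Eventually.of_forall fun p => ?_)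
    rw [norm_smul, eSW_norm, mul_one]
  constructor
  · rw [← (Lv_mp hv hσ).integrableOn_comp_preimage (Lv_emb hv hσ), hpre]
    exact hi'.of_forall_sdiff_eq_zero hmpos hz'
  · rw [← (Lv_mp hv hσ).setIntegral_preimage_emb (Lv_emb hv hσ), hpre,
      setIntegral_eq_of_subset_of_forall_sdiff_eq_zero hmpos hsub hz']
    simp only [eSW_Lv]

lemma null_line {v : ℝ × ℝ} (hv : nrm2 v = 1) : volume {p : ℝ × ℝ | dot2 p v = 0} = 0 := by
  have hσ : (1:ℝ) ^ 2 = 1 := by norm_num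
  have hcl : MeasurableSet {p : ℝ × ℝ | dot2 p v = 0} := by
    have : Continuous fun p : ℝ × ℝ => dot2 p v := by unfold dot2; fun_prop
    exact (isClosed_eq this continuous_const).measurableSet
  rw [← (Lv_mp hv hσ).measure_preimage hcl.nullMeasurableSet]
  have : (Lv v 1) ⁻¹' {p : ℝ × ℝ | dot2 p v = 0} = ({0} : Set ℝ) ×ˢ (univ : Set ℝ) := by
    ext p
    change dot2 (Lv v 1 p) v = 0 ↔ _
    rw [Lv_dot hv]; simp
  rw [this, Measure.volume_eq_prod, Measure.prod_prod]
  simp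

lemma full_int {v : ℝ × ℝ} (hv : nrm2 v = 1) {c : ℝ} {Ψ : ℝ × ℝ → ℝ}
    (hi1 : IntegrableOn (fun p => Ψ (Lv v 1 p)) (DD c))
    (hz1 : ∀ p : ℝ × ℝ, 0 < p.1 → p ∉ DD c → Ψ (Lv v 1 p) = 0)
    (hi2 : IntegrableOn (fun p => Ψ (Lv v (-1) p)) (DD c))
    (hz2 : ∀ p : ℝ × ℝ, 0 < p.1 → p ∉ DD c → Ψ (Lv v (-1) p) = 0) (t u : ℝ) :
    ∫ p, Ψ p • eSW t u p =
      (∫ p in DD c, Ψ (Lv v 1 p) • eSW (1 * dot2 (t, u) v) (dot2 (t, u) (perp2 v)) p) +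
      ∫ p in DD c, Ψ (Lv v (-1) p) • eSW (-1 * dot2 (t, u) v) (dot2 (t, u) (perp2 v)) p := by
  obtain ⟨a1, a2⟩ := side_int hv (by norm_num) hi1 hz1 t u
  obtain ⟨b1, b2⟩ := side_int hv (by norm_num) hi2 hz2 t u
  have hcd : Continuous fun p : ℝ × ℝ => dot2 p v := by unfold dot2; fun_prop
  have hm : MeasurableSet {p : ℝ × ℝ | 0 < -1 * dot2 p v} := (isOpen_lt continuous_const (continuous_const.mul hcd)).measurableSet
  have hdis : Disjoint {p : ℝ × ℝ | 0 < 1 * dot2 p v} {p : ℝ × ℝ | 0 < -1 * dot2 p v} := by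
    rw [Set.disjoint_left]
    intro p h1 h2
    have h1 : 0 < 1 * dot2 p v := h1
    have h2 : 0 < -1 * dot2 p v := h2
    linarith
  rw [← a2, ← b2, ← setIntegral_union hdis hm a1 b1, ← setIntegral_univ]
  refine setIntegral_congr_set ?_
  have := null_line hv
  have hae : ∀ᵐ p : ℝ × ℝ, dot2 p v ≠ 0 := by rw [ae_iff]; simpa using this
  filter_upwards [hae] with p hp
  apply propext
  refine ⟨fun _ => ?_, fun _ => trivial⟩
  rcases lt_or_gt_of_ne hp with h | h
  · right; change 0 < -1 * dot2 p v; linarith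
  · left; change 0 < 1 * dot2 p v; linarith

lemma dot_sq {v : ℝ × ℝ} (hv : nrm2 v = 1) (p : ℝ × ℝ) : dot2 p v ^ 2 + dot2 p (perp2 v) ^ 2 = p.1 ^ 2 + p.2 ^ 2 := by
  have := unit_sq hv
  simp only [dot2, perp2]
  linear_combination (p.1 ^ 2 + p.2 ^ 2) * this

lemma strip_box {v : ℝ × ℝ} (hv : nrm2 v = 1) {r c : ℝ} (hrc : r ≤ c) {p : ℝ × ℝ} (hp : p ∈ strip2 v r c) :
    |p.1| < 2 * c ∧ |p.2| < 2 * c := by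
  obtain ⟨h1, h2⟩ := hp
  have hc : 0 < c := (abs_nonneg _).trans_lt h2
  have h := dot_sq hv p
  have e1 : dot2 p v ^ 2 < c ^ 2 := by rw [← sq_abs]; exact pow_lt_pow_left₀ (by linarith) (abs_nonneg _) two_ne_zero
  have e2 : dot2 p (perp2 v) ^ 2 < c ^ 2 := by rw [← sq_abs]; exact pow_lt_pow_left₀ h2 (abs_nonneg _) two_ne_zero
  constructor
  · exact abs_lt_of_sq_lt_sq (by nlinarith [sq_nonneg p.2]) (by linarith)
  · exact abs_lt_of_sq_lt_sq (by nlinarith [sq_nonneg p.1]) (by linarith)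

lemma delta_lt_one {g : ℝ × ℝ → ℝ} (hg : ∀ p, 0 ≤ g p) {W : Set (ℝ × ℝ)} (hW : W ∈ 𝓝 (0:ℝ×ℝ)) (hint : IntegrableOn g W)
    {ε δ : ℝ} {d e : ℕ} {v : ℝ × ℝ} (hv : nrm2 v = 1) (hball : BallBound g ε d) (hε : ε < 1/2) (hstrip : StripBound g v δ e) : δ < 1 := by
  obtain ⟨hε0, hd, c₁, hc₁, c₂, hc₂, c₃, hc₃, hb⟩ := hball
  obtain ⟨hδ0, he, cv, hcv, hs⟩ := hstrip
  obtain ⟨η, hη, hbox⟩ := exists_box (P := fun p => p ∈ W) hW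
  set c := min (cv / 2) (η / 2) with hc
  have hc0 : 0 < c := by positivity
  obtain ⟨a, ha, b, hb0, hab⟩ := hs c hc0 ((min_le_left _ _).trans_lt (by linarith))
  by_contra hδ
  push Not at hδ
  have hlim : Tendsto (fun x : ℝ => b * |Real.log x * x ^ (1 - ε)|) (𝓝[>] 0) (𝓝 0) := by
    have := ((tendsto_log_mul_rpow_nhdsGT_zero (r := 1 - ε) (by linarith)).abs).const_mul b
    simpa using this
  have hev : ∀ᶠ r : ℝ in 𝓝[>] 0, 0 < r ∧ r < c ∧ r < c₃ ∧ r < 1/3 := by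
    filter_upwards [self_mem_nhdsWithin, mem_nhdsWithin_of_mem_nhds (Iio_mem_nhds hc0), mem_nhdsWithin_of_mem_nhds (Iio_mem_nhds hc₃),
      mem_nhdsWithin_of_mem_nhds (Iio_mem_nhds (show (0:ℝ) < 1/3 by norm_num))] with r h1 h2 h3 h4
    exact ⟨h1, h2, h3, h4⟩
  obtain ⟨r, ⟨h1, h2, h3, h4⟩, h5⟩ := (hev.and (hlim.eventually_lt_const hc₁)).exists
  have hsub : disk2 r ⊆ strip2 v r c := by
    intro p hp
    have hp : p.1 ^ 2 + p.2 ^ 2 < r ^ 2 := hp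
    have h := dot_sq hv p
    exact ⟨abs_lt_of_sq_lt_sq (by nlinarith [sq_nonneg (dot2 p (perp2 v))]) h1.le,
      (abs_lt_of_sq_lt_sq (by nlinarith [sq_nonneg (dot2 p v)]) h1.le).trans h2⟩
  have hsI : IntegrableOn g (strip2 v r c) := hint.mono_set fun p hp => by
    have := strip_box hv h2.le hp
    have hcη : c ≤ η / 2 := min_le_right _ _
    exact hbox p (by linarith [this.1]) (by linarith [this.2])
  have hmono : ∫ p in disk2 r, g p ≤ ∫ p in strip2 v r c, g p :=
    setIntegral_mono_set hsI (Eventually.of_forall hg) (Eventually.of_forall hsub)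
  have k1 := ((hb r h1 h3).1.trans hmono).trans (hab r h1 h2).2
  have hl : 1 ≤ |Real.log r| := one_le_log h1 h4 le_rfl
  have k2 : c₁ * r ^ ε ≤ b * r * |Real.log r| := by
    have m1 : c₁ * r ^ ε ≤ c₁ * r ^ ε * |Real.log r| ^ d := le_mul_of_one_le_right (by positivity) (one_le_pow₀ hl)
    have m2 : |Real.log r| ^ e ≤ |Real.log r| := by
      calc _ ≤ |Real.log r| ^ 1 := pow_le_pow_right₀ hl he
        _ = _ := pow_one _
    have m3 : r ^ δ ≤ r := by
      calc r ^ δ ≤ r ^ (1:ℝ) := Real.rpow_le_rpow_of_exponent_ge h1 (by linarith) hδ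
        _ = r := Real.rpow_one r
    have m4 : b * r ^ δ * |Real.log r| ^ e ≤ b * r * |Real.log r| :=
      mul_le_mul (mul_le_mul_of_nonneg_left m3 hb0.le) m2 (by positivity) (by positivity)
    linarith
  have hrε : 0 < r ^ ε := Real.rpow_pos_of_pos h1 _
  have k3 : b * |Real.log r * r ^ (1 - ε)| * r ^ ε = b * r * |Real.log r| := by
    rw [abs_mul, abs_of_pos (Real.rpow_pos_of_pos h1 _), Real.rpow_sub h1, Real.rpow_one]
    field_simp
  have := mul_lt_mul_of_pos_right h5 hrε
  linarith

lemma Kphi_norm {φ m Ψ : ℝ × ℝ → ℝ} {x₀ y₀ : ℝ} (hΨ : ∀ p, φ ((x₀, y₀) + p) * m ((x₀, y₀) + p) = Ψ p) (t u : ℝ) :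
    ‖Kphi φ m t u‖ = ‖∫ p, Ψ p • eSW t u p‖ := by
  rw [Kphi, oscInt, setIntegral_univ, ← integral_add_left_eq_self _ ((x₀, y₀) : ℝ × ℝ)]
  have : ∀ p : ℝ × ℝ, ((φ ((x₀, y₀) + p) * m ((x₀, y₀) + p) : ℝ) : ℂ) *
      Complex.exp (Complex.I * ((t : ℂ) * ((((x₀, y₀) + p : ℝ × ℝ).1 : ℝ) : ℂ) + (u : ℂ) * ((((x₀, y₀) + p : ℝ × ℝ).2 : ℝ) : ℂ))) =
      eSW t u (x₀, y₀) * (Ψ p • eSW t u p) := by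
    intro p
    rw [hΨ, eSW, eSW, Complex.real_smul, mul_left_comm, ← Complex.exp_add]
    congr 2
    simp; ring
  rw [integral_congr_ae (Eventually.of_forall this), integral_const_mul, norm_mul, eSW_norm, one_mul]

lemma nrm_st {v : ℝ × ℝ} (hv : nrm2 v = 1) (p : ℝ × ℝ) : |dot2 p v| ≤ nrm2 p ∧ nrm2 p ≤ |dot2 p v| + |dot2 p (perp2 v)| := by
  have h := dot_sq hv p
  unfold nrm2
  rw [← h]
  constructor
  · exact Real.abs_le_sqrt (by nlinarith [sq_nonneg (dot2 p (perp2 v))])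
  · rw [Real.sqrt_le_left (by positivity), ← sq_abs (dot2 p v), ← sq_abs (dot2 p (perp2 v))]
    nlinarith [abs_nonneg (dot2 p v), abs_nonneg (dot2 p (perp2 v)), mul_nonneg (abs_nonneg (dot2 p v)) (abs_nonneg (dot2 p (perp2 v)))]

lemma strip_side {g : ℝ × ℝ → ℝ} (hg : ∀ p, 0 ≤ g p) {v : ℝ × ℝ} (hv : nrm2 v = 1) {σ : ℝ} (hσ : σ ^ 2 = 1) {r c : ℝ}
    (hi : IntegrableOn g (strip2 v r c)) :
    ∫ p in DD c ∩ {p | p.1 < r}, g (Lv v σ p) ≤ ∫ p in strip2 v r c, g p := by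
  rw [← (Lv_mp hv hσ).setIntegral_preimage_emb (Lv_emb hv hσ) g (strip2 v r c)]
  refine setIntegral_mono_set (((Lv_mp hv hσ).integrableOn_comp_preimage (Lv_emb hv hσ)).2 hi) (Eventually.of_forall fun p => hg _) (Eventually.of_forall fun p hp => ?_)
  obtain ⟨h1, h2⟩ := hp
  have h2 : p.1 < r := h2
  have hs : |σ| = 1 := by rw [← sq_eq_sq₀ (abs_nonneg _) zero_le_one, sq_abs, hσ]; norm_num
  refine ⟨?_, ?_⟩
  · rw [Lv_dot hv, abs_mul, hs, one_mul, abs_of_pos h1.1]; exact h2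
  · rw [Lv_dotp hv]; exact h1.2.2

/-- **Theorem 1.3 a), exceptional directions.** In the local multiplier setup, if the ball
exponent satisfies `ε < 1/2` and the unit direction `v` of the line `l` is perpendicular to
one of the lines `l₁, …, l_p`, then for bump functions `φ` with sufficiently small support
there is a constant `C` such that on the strip `l_H` one has
`|K_φ(t,u)| ≤ C (2+|(t,u)|)^{−δ_v} (ln(2+|(t,u)|))^{e_v}`. -/
theorem kernel_bound_exceptional_direction {n : ℕ} (f : Fin n → ℝ × ℝ → ℝ)
    (γ : Fin n → ℝ) (E : Set (ℝ × ℝ)) (hsf : StandardForm n f γ E)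
    (x₀ y₀ A : ℝ) (hA : 0 < A) (α m : ℝ × ℝ → ℝ) (hα : AlphaBound α A)
    (U : Set (ℝ × ℝ)) (hU : U ∈ 𝓝 (0:ℝ×ℝ))
    (hm : ∀ p ∈ U, m ((x₀, y₀) + p) = α p * stdFun n f γ E p)
    (ε : ℝ) (d : ℕ) (hball : BallBound (stdFun n f γ E) ε d) (hε : ε < 1/2)
    (v : ℝ × ℝ) (hv : nrm2 v = 1) (δv : ℝ) (ev : ℕ)
    (hstrip : StripBound (stdFun n f γ E) v δv ev)
    (hperp : ExceptionalDir n f E (perp2 v))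
    (H : ℝ) (hH : 0 < H) :
    ∃ r₁ > (0:ℝ), ∀ φ : ℝ × ℝ → ℝ, IsBump φ x₀ y₀ r₁ →
      ∃ C > (0:ℝ), ∀ t u : ℝ, |dot2 (t, u) (perp2 v)| ≤ H →
        ‖Kphi φ m t u‖ ≤ C * (2 + nrm2 (t, u)) ^ (-δv) *
          (Real.log (2 + nrm2 (t, u))) ^ ev := by
  obtain ⟨W, hW, hint⟩ := hsf.integ
  have hg0 := stdFun_nonneg n f γ E
  have hδ1 : δv < 1 := delta_lt_one hg0 hW hint hv hball hε hstrip
  have hs1 : (1:ℝ) ^ 2 = 1 := by norm_num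
  have hs2 : (-1:ℝ) ^ 2 = 1 := by norm_num
  obtain ⟨cp, hcp, Dp⟩ := mk_data f γ E hsf x₀ y₀ A hA α hα v hv 1 hs1
  obtain ⟨cm, hcm, Dm⟩ := mk_data f γ E hsf x₀ y₀ A hA α hα v hv (-1) hs2
  obtain ⟨hδ0, he, cv, hcv, hst⟩ := hstrip
  obtain ⟨η, hη, hbox⟩ := exists_box (P := fun p => p ∈ W) hW
  obtain ⟨η', hη', hbox'⟩ := exists_box (P := fun p => p ∈ U) hU
  set g := stdFun n f γ E with hg
  obtain ⟨c, hc0, hc1, hc2, hc3, hc4, hc5⟩ : ∃ c > (0:ℝ), c ≤ cp ∧ c ≤ cm ∧ c < cv ∧ 2 * c ≤ η ∧ c ≤ 1/3 := by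
    refine ⟨min (min (min cp cm) (cv/2)) (min (η/2) (1/3)), by positivity, ?_, ?_, ?_, ?_, ?_⟩
    · exact (min_le_left _ _).trans ((min_le_left _ _).trans (min_le_left _ _))
    · exact (min_le_left _ _).trans ((min_le_left _ _).trans (min_le_right _ _))
    · exact ((min_le_left _ _).trans (min_le_right _ _)).trans_lt (by linarith)
    · have := (min_le_right (min (min cp cm) (cv/2)) (min (η/2) (1/3))).trans (min_le_left _ _)
      linarith
    · exact (min_le_right _ _).trans (min_le_right _ _)
  obtain ⟨a, ha, bb, hbb, hab⟩ := hst c hc0 hc3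
  refine ⟨min (c / 2) η', by positivity, fun φ hφ => ?_⟩
  set r₁ := min (c / 2) η' with hr₁
  have hr0 : 0 < r₁ := by positivity
  have hrc : r₁ < c := (min_le_left _ _).trans_lt (by linarith)
  obtain ⟨C1, b1, P1, D1⟩ := Dp c hc1 r₁ hr0 hrc φ hφ
  obtain ⟨C2, b2, P2, D2⟩ := Dm c hc2 r₁ hr0 hrc φ hφ
  have hsupp : ∀ p : ℝ × ℝ, φ ((x₀, y₀) + p) ≠ 0 → p.1 ^ 2 + p.2 ^ 2 < r₁ ^ 2 := by
    intro p hp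
    have := hφ.2.2.2 (subset_tsupport φ hp)
    simpa using this
  set Ψ : ℝ × ℝ → ℝ := fun p => φ ((x₀, y₀) + p) * (α p * g p) with hΨ
  have hΨm : ∀ p, φ ((x₀, y₀) + p) * m ((x₀, y₀) + p) = Ψ p := by
    intro p
    by_cases hp : φ ((x₀, y₀) + p) = 0
    · simp [hΨ, hp]
    · have hlt := hsupp p hp
      have hη1 : r₁ ≤ η' := min_le_right _ _
      have hpU : p ∈ U := hbox' p ((abs_lt_of_sq_lt_sq (by nlinarith [sq_nonneg p.2]) hr0.le).trans_le hη1)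
        ((abs_lt_of_sq_lt_sq (by nlinarith [sq_nonneg p.1]) hr0.le).trans_le hη1)
      rw [hm p hpU]
  have hzero : ∀ σ : ℝ, σ ^ 2 = 1 → ∀ p : ℝ × ℝ, 0 < p.1 → p ∉ DD c → Ψ (Lv v σ p) = 0 := by
    intro σ hσ p hp hpD
    by_contra hne
    have h1 : φ ((x₀, y₀) + Lv v σ p) ≠ 0 := fun h => hne (by simp [hΨ, h])
    have hlt := hsupp _ h1
    rw [Lv_sq hv hσ] at hlt
    apply hpD
    exact ⟨hp, (abs_lt.1 (abs_lt_of_sq_lt_sq (by nlinarith [sq_nonneg p.2]) hr0.le)).2.trans hrc,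
      (abs_lt_of_sq_lt_sq (by nlinarith [sq_nonneg p.1]) hr0.le).trans hrc⟩
  have hsI : ∀ r, r < c → IntegrableOn g (strip2 v r c) := fun r hr => hint.mono_set fun p hp => by
    have := strip_box hv hr.le hp
    exact hbox p (by linarith [this.1]) (by linarith [this.2])
  have hMs : ∀ σ : ℝ, σ ^ 2 = 1 → ∀ r, 0 < r → r < c →
      ∫ p in DD c ∩ {p | p.1 < r}, g (Lv v σ p) ≤ bb * r ^ δv * |Real.log r| ^ ev := fun σ hσ r h1 h2 =>
    (strip_side hg0 hv hσ (hsI r h2)).trans (hab r h1 h2).2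
  obtain ⟨K1, hK1, k1⟩ := half_decay D1 hc0 hc5 hδ0 hδ1 hbb.le (hMs 1 hs1) H
  obtain ⟨K2, hK2, k2⟩ := half_decay D2 hc0 hc5 hδ0 hδ1 hbb.le (hMs (-1) hs2) H
  set K0 := ∫ p, ‖Ψ p‖ with hK0
  have hK00 : 0 ≤ K0 := integral_nonneg fun p => norm_nonneg _
  set R := c⁻¹ + H + 2 with hR
  have hcinv : 0 < c⁻¹ := inv_pos.2 hc0
  set T0 := 2 + R + H with hT0
  have hT00 : 0 < T0 := by positivity
  have hl2 : 0 < Real.log 2 := Real.log_pos (by norm_num)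
  have hCa : 0 ≤ (K1 + K2) * 2 ^ δv := by positivity
  have hCb : 0 ≤ K0 * T0 ^ δv * (Real.log 2 ^ ev)⁻¹ := by positivity
  refine ⟨(K1 + K2) * 2 ^ δv + K0 * T0 ^ δv * (Real.log 2 ^ ev)⁻¹ + 1, by linarith, fun t u htu => ?_⟩
  rw [Kphi_norm hΨm]
  set N := nrm2 (t, u) with hN
  have hN0 : 0 ≤ N := Real.sqrt_nonneg _
  obtain ⟨n1, n2⟩ := nrm_st hv (t, u)
  set s := dot2 (t, u) v with hs
  set w := dot2 (t, u) (perp2 v) with hw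
  have hT2 : 0 < 2 + N := by linarith
  have hTpos : 0 < (2 + N) ^ (-δv) := Real.rpow_pos_of_pos hT2 _
  have hlog : Real.log 2 ≤ Real.log (2 + N) := Real.log_le_log (by norm_num) (by linarith)
  have hlogp : 0 ≤ Real.log (2 + N) ^ ev := pow_nonneg (by linarith) _
  rcases le_or_gt |s| R with hsR | hsR
  · have hb : ‖∫ p, Ψ p • eSW t u p‖ ≤ K0 := by
      refine (norm_integral_le_integral_norm _).trans (le_of_eq ?_)
      simp only [norm_smul, eSW_norm, mul_one]
      rfl
    have hTT : 2 + N ≤ T0 := by rw [hT0]; linarith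
    have e1 : 1 ≤ T0 ^ δv * (2 + N) ^ (-δv) := by
      rw [Real.rpow_neg hT2.le, ← div_eq_mul_inv, one_le_div (Real.rpow_pos_of_pos hT2 _)]
      exact Real.rpow_le_rpow hT2.le hTT hδ0.le
    have e2 : 1 ≤ (Real.log 2 ^ ev)⁻¹ * Real.log (2 + N) ^ ev := by
      rw [inv_mul_eq_div, one_le_div (by positivity)]
      exact pow_le_pow_left₀ hl2.le hlog _
    have e3 : 1 ≤ (T0 ^ δv * (2 + N) ^ (-δv)) * ((Real.log 2 ^ ev)⁻¹ * Real.log (2 + N) ^ ev) := one_le_mul_of_one_le_of_one_le e1 e2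
    have e4 : K0 ≤ K0 * T0 ^ δv * (Real.log 2 ^ ev)⁻¹ * ((2 + N) ^ (-δv) * Real.log (2 + N) ^ ev) := by
      calc K0 ≤ K0 * ((T0 ^ δv * (2 + N) ^ (-δv)) * ((Real.log 2 ^ ev)⁻¹ * Real.log (2 + N) ^ ev)) := le_mul_of_one_le_right hK00 e3
        _ = _ := by ring
    have e5 : 0 ≤ ((K1 + K2) * 2 ^ δv + 1) * ((2 + N) ^ (-δv) * Real.log (2 + N) ^ ev) := by positivity
    rw [mul_assoc]
    linarith
  · have hsc : c⁻¹ < |s| := by linarith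
    have hs0 : 0 < |s| := by linarith
    rw [full_int hv (D_hi D1) (hzero 1 hs1) (D_hi D2) (hzero (-1) hs2)]
    have q1 := k1 (1 * s) w (by rwa [one_mul]) htu
    have q2 := k2 (-1 * s) w (by rw [neg_one_mul, abs_neg]; exact hsc) htu
    rw [one_mul] at q1
    rw [neg_one_mul, abs_neg] at q2
    rw [one_mul, neg_one_mul]
    refine (norm_add_le _ _).trans ((add_le_add q1 q2).trans ?_)
    have e1 : |s| ^ (-δv) ≤ 2 ^ δv * (2 + N) ^ (-δv) := by
      have h2s : 2 + N ≤ 2 * |s| := by linarith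
      rw [Real.rpow_neg hs0.le, Real.rpow_neg hT2.le, ← div_eq_mul_inv, le_div_iff₀ (Real.rpow_pos_of_pos hT2 _),
        inv_mul_le_iff₀ (Real.rpow_pos_of_pos hs0 _), ← Real.mul_rpow hs0.le (by norm_num), mul_comm |s|]
      exact Real.rpow_le_rpow hT2.le h2s hδ0.le
    have hls : 0 ≤ Real.log |s| := Real.log_nonneg (by linarith)
    have e2 : Real.log |s| ^ ev ≤ Real.log (2 + N) ^ ev :=
      pow_le_pow_left₀ hls (Real.log_le_log hs0 (by linarith)) _
    have e3 : |s| ^ (-δv) * Real.log |s| ^ ev ≤ 2 ^ δv * (2 + N) ^ (-δv) * Real.log (2 + N) ^ ev :=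
      mul_le_mul e1 e2 (by positivity) (by positivity)
    have e4 := mul_le_mul_of_nonneg_left e3 (show 0 ≤ K1 + K2 by positivity)
    have e5 : 0 ≤ (K0 * T0 ^ δv * (Real.log 2 ^ ev)⁻¹ + 1) * ((2 + N) ^ (-δv) * Real.log (2 + N) ^ ev) := by positivity
    calc _ = (K1 + K2) * (|s| ^ (-δv) * Real.log |s| ^ ev) := by ring
      _ ≤ _ := e4
      _ ≤ (K1 + K2) * (2 ^ δv * (2 + N) ^ (-δv) * Real.log (2 + N) ^ ev) +
          (K0 * T0 ^ δv * (Real.log 2 ^ ev)⁻¹ + 1) * ((2 + N) ^ (-δv) * Real.log (2 + N) ^ ev) := le_add_of_nonneg_right e5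
      _ = _ := by ring
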